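/- Theorem 4.1(iii), first case: Suppose the measurable coefficients a^{ij} on ℝ^{d+1} satisfy ν|ξ|² ≤ a^{ij}(t,x)ξ^iξ^j and Σ_{i,j}|a^{ij}(t,x)|² ≤ ν^{−2} for all (t,x), ξ, and are independent of x'. Let δ ∈ (0,1), let f⃗ = (f^1,…,f^d) satisfy [f⃗]_{x',δ;Q_1} := max_i [f^i]_{x',δ;Q_1} < ∞, and let u be a bounded weak solution of u_t − D_i(a^{ij}D_j u) = div f⃗ in the parabolic cylinder Q_1 = (−1,0)×B_1. Then there is a constant N depending only on d, q, δ, ν such that [u]_{x',1+δ;Q_{1/2}} := max_{i≤q}[D_i u]_{x',δ;Q_{1/2}} ≤ N ( [f⃗]_{x',δ;Q_1} + sup_{Q_1}|u| ). -/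

import Mathlib

open MeasureTheory Metric Set Filter

noncomputable section

/-- Spatial first-order partial derivative `D_i`. -/
def sd {d : ℕ} (i : Fin d) (v : EuclideanSpace ℝ (Fin d) → ℝ)
    (x : EuclideanSpace ℝ (Fin d)) : ℝ :=
  fderiv ℝ v x (EuclideanSpace.single i 1)

/-- Spatial second-order partial derivative `D_i D_j`. -/
def sd2 {d : ℕ} (i j : Fin d) (v : EuclideanSpace ℝ (Fin d) → ℝ)
    (x : EuclideanSpace ℝ (Fin d)) : ℝ :=
  sd i (fun y => sd j v y) x

/-- Time derivative `∂_t`. -/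
def td {d : ℕ} (u : ℝ → EuclideanSpace ℝ (Fin d) → ℝ) (t : ℝ)
    (x : EuclideanSpace ℝ (Fin d)) : ℝ :=
  deriv (fun s => u s x) t

/-- Parabolic cylinder `Q_ρ = (-ρ², 0) × B_ρ`. -/
def parQ (d : ℕ) (ρ : ℝ) : Set (ℝ × EuclideanSpace ℝ (Fin d)) :=
  Ioo (-(ρ ^ 2)) 0 ×ˢ ball (0 : EuclideanSpace ℝ (Fin d)) ρ

/-- The half space `ℝ^{d+1}_0 = (-∞, 0) × ℝ^d`. -/
def parNeg (d : ℕ) : Set (ℝ × EuclideanSpace ℝ (Fin d)) :=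
  Iio (0 : ℝ) ×ˢ (univ : Set (EuclideanSpace ℝ (Fin d)))

/-- Partial Hölder bound in the first `q` spatial coordinates `x'`. -/
def PHolderXPar (d q : ℕ) (δ : ℝ) (Q : Set (ℝ × EuclideanSpace ℝ (Fin d)))
    (g : ℝ → EuclideanSpace ℝ (Fin d) → ℝ) (K : ℝ) : Prop :=
  ∀ (t : ℝ) (x y : EuclideanSpace ℝ (Fin d)), (t, x) ∈ Q → (t, y) ∈ Q →
    (∀ i : Fin d, q ≤ (i : ℕ) → x i = y i) → |g t x - g t y| ≤ K * dist x y ^ δ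

/-- Full spatial Hölder bound. -/
def HolderXPar (d : ℕ) (δ : ℝ) (Q : Set (ℝ × EuclideanSpace ℝ (Fin d)))
    (g : ℝ → EuclideanSpace ℝ (Fin d) → ℝ) (K : ℝ) : Prop :=
  ∀ (t : ℝ) (x y : EuclideanSpace ℝ (Fin d)), (t, x) ∈ Q → (t, y) ∈ Q →
    |g t x - g t y| ≤ K * dist x y ^ δ

/-- Hölder bound in the time variable `t`, with exponent `γ`. -/
def HolderTPar (d : ℕ) (γ : ℝ) (Q : Set (ℝ × EuclideanSpace ℝ (Fin d)))
    (g : ℝ → EuclideanSpace ℝ (Fin d) → ℝ) (K : ℝ) : Prop :=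
  ∀ (t s : ℝ) (x : EuclideanSpace ℝ (Fin d)), (t, x) ∈ Q → (s, x) ∈ Q →
    |g t x - g s x| ≤ K * |t - s| ^ γ

/-- Classical regularity of parabolic solutions: `u`, `∂_t u`, `Du`, `D²u` exist and are
continuous on `Q`. -/
def ParClassical {d : ℕ} (Q : Set (ℝ × EuclideanSpace ℝ (Fin d)))
    (u : ℝ → EuclideanSpace ℝ (Fin d) → ℝ) : Prop :=
  (∀ z ∈ Q, DifferentiableAt ℝ (fun s => u s z.2) z.1) ∧
  (∀ z ∈ Q, ContDiffAt ℝ 2 (u z.1) z.2) ∧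
  ContinuousOn (fun z : ℝ × EuclideanSpace ℝ (Fin d) => u z.1 z.2) Q ∧
  ContinuousOn (fun z : ℝ × EuclideanSpace ℝ (Fin d) => td u z.1 z.2) Q ∧
  (∀ i : Fin d,
    ContinuousOn (fun z : ℝ × EuclideanSpace ℝ (Fin d) => sd i (u z.1) z.2) Q) ∧
  (∀ i j : Fin d,
    ContinuousOn (fun z : ℝ × EuclideanSpace ℝ (Fin d) => sd2 i j (u z.1) z.2) Q)

/-- Uniform ellipticity with constant `ν` (parabolic, two-sided bound). -/
def UnifEllipticP (d : ℕ) (ν : ℝ)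
    (a : Fin d → Fin d → ℝ → EuclideanSpace ℝ (Fin d) → ℝ) : Prop :=
  ∀ (t : ℝ) (x : EuclideanSpace ℝ (Fin d)) (ξ : Fin d → ℝ),
    ν * ∑ i, ξ i ^ 2 ≤ ∑ i, ∑ j, a i j t x * ξ i * ξ j ∧
      ∑ i, ∑ j, a i j t x * ξ i * ξ j ≤ ν⁻¹ * ∑ i, ξ i ^ 2

noncomputable section

abbrev EE (d : ℕ) := EuclideanSpace ℝ (Fin d)

instance volume_prod_isAddHaar (d : ℕ) : (volume : Measure (ℝ × EE d)).IsAddHaarMeasure :=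
  inferInstanceAs ((volume : Measure ℝ).prod (volume : Measure (EE d))).IsAddHaarMeasure

/-- weak solutions of `w_t = div F`, where `P` is the spatial gradient of `w`. -/
structure WSol {d : ℕ} (U : Set (ℝ × EE d)) (w : ℝ × EE d → ℝ) (P F : ℝ × EE d → EE d) :
    Prop where
  isOpen : IsOpen U
  contw : ContinuousOn w U
  contP : ContinuousOn P U
  grad : ∀ z ∈ U, HasFDerivAt (fun y => w (z.1, y)) (innerSL ℝ (P z)) z.2
  locF : LocallyIntegrableOn F U
  weak : ∀ φ : ℝ × EE d → ℝ, ContDiff ℝ (⊤ : ℕ∞) φ → HasCompactSupport φ → tsupport φ ⊆ U →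
    ∫ z, w z * fderiv ℝ φ z (1, 0) = ∫ z, fderiv ℝ φ z (0, F z)

/-- smooth approximation of compactly supported `C^1` functions, in `C^1`. -/
lemma exists_smooth_approx {V : Type} [NormedAddCommGroup V] [NormedSpace ℝ V]
    [FiniteDimensional ℝ V] [MeasurableSpace V] [BorelSpace V] (μ : Measure V)
    [μ.IsAddHaarMeasure]
    (φ : V → ℝ) (hφ : ContDiff ℝ 1 φ)
    (hc : HasCompactSupport φ) (ρ ε : ℝ) (hρ : 0 < ρ) (hε : 0 < ε) :
    ∃ ψ : V → ℝ, ContDiff ℝ (⊤ : ℕ∞) ψ ∧ tsupport ψ ⊆ cthickening ρ (tsupport φ) ∧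
      ∀ z, ‖fderiv ℝ ψ z - fderiv ℝ φ z‖ ≤ ε := by
  have hDc : HasCompactSupport (fderiv ℝ φ) := hc.fderiv (𝕜 := ℝ)
  have hDcont : Continuous (fderiv ℝ φ) := hφ.continuous_fderiv one_ne_zero
  have huc : UniformContinuous (fderiv ℝ φ) := hDc.uniformContinuous_of_continuous hDcont
  obtain ⟨δ, hδ, hδ'⟩ := Metric.uniformContinuous_iff.1 huc ε hε
  set r := min ρ δ with hr
  have hr0 : 0 < r := lt_min hρ hδ
  let β : ContDiffBump (0 : V) := ⟨r / 2, r, by positivity, by linarith⟩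
  have h_integ : LocallyIntegrable φ μ := hφ.continuous.locallyIntegrable
  refine ⟨convolution (β.normed μ) φ (ContinuousLinearMap.lsmul ℝ ℝ) μ, ?_, ?_, ?_⟩
  · exact β.hasCompactSupport_normed.contDiff_convolution_left _ β.contDiff_normed h_integ
  · have h1 : Function.support (convolution (β.normed μ) φ (ContinuousLinearMap.lsmul ℝ ℝ) μ)
        ⊆ cthickening ρ (tsupport φ) := by
      intro z hz
      obtain ⟨a, ha, b, hb, hab⟩ := Set.mem_add.1 (support_convolution_subset _ hz)
      rw [β.support_normed_eq, mem_ball_zero_iff] at ha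
      have : dist z b ≤ ρ := by
        rw [← hab, dist_eq_norm]; simp
        have : ‖a‖ < r := ha
        exact this.le.trans (min_le_left _ _)
      exact mem_cthickening_of_dist_le z b ρ _ (subset_tsupport _ hb) this
    exact closure_minimal h1 isClosed_cthickening
  · intro z
    have hd := HasCompactSupport.hasFDerivAt_convolution_right
      (L := ContinuousLinearMap.lsmul ℝ ℝ) (μ := μ) (𝕜 := ℝ) (f := β.normed μ) hc
      (β.continuous_normed.locallyIntegrable) hφ z
    rw [hd.fderiv]
    have h2 := ContDiffBump.dist_normed_convolution_le (μ := μ) (φ := β) (g := fderiv ℝ φ)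
      (x₀ := z) (ε := ε) hDcont.aestronglyMeasurable (by
        intro x hx
        exact (hδ' (lt_of_lt_of_le hx (min_le_right _ _))).le)
    rw [dist_eq_norm] at h2
    have e : convolution (β.normed μ) (fderiv ℝ φ)
        (ContinuousLinearMap.precompR V (ContinuousLinearMap.lsmul ℝ ℝ)) μ z =
        convolution (β.normed μ) (fderiv ℝ φ) (ContinuousLinearMap.lsmul ℝ ℝ) μ z := by
      rw [convolution_def, convolution_def]
      refine integral_congr_ae (Eventually.of_forall fun t => ?_)
      ext v
      simp [ContinuousLinearMap.precompR_apply]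
    rw [e]
    exact h2

lemma WSol.weakC1 {d : ℕ} {U : Set (ℝ × EE d)} {w : ℝ × EE d → ℝ} {P F : ℝ × EE d → EE d}
    (h : WSol U w P F) (φ : ℝ × EE d → ℝ) (hφ : ContDiff ℝ 1 φ) (hc : HasCompactSupport φ)
    (hs : tsupport φ ⊆ U) :
    ∫ z, w z * fderiv ℝ φ z (1, 0) = ∫ z, fderiv ℝ φ z (0, F z) := by
  obtain ⟨ρ, hρ, hρU⟩ := (show IsCompact (tsupport φ) from hc).exists_cthickening_subset_open
    h.isOpen hs
  set K := cthickening ρ (tsupport φ) with hK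
  have hKc : IsCompact K := (show IsCompact (tsupport φ) from hc).cthickening
  have hφK : tsupport φ ⊆ K := self_subset_cthickening _
  have hwI : IntegrableOn w K := (h.contw.mono hρU).integrableOn_compact hKc
  have hFI : IntegrableOn F K := h.locF.integrableOn_compact_subset hρU hKc
  -- reduction to set integrals, and integrability
  have key : ∀ ψ : ℝ × EE d → ℝ, ContDiff ℝ 1 ψ → tsupport ψ ⊆ K →
      (∫ z, w z * fderiv ℝ ψ z (1, 0) = ∫ z in K, w z * fderiv ℝ ψ z (1, 0)) ∧
      (∫ z, fderiv ℝ ψ z (0, F z) = ∫ z in K, fderiv ℝ ψ z (0, F z)) ∧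
      IntegrableOn (fun z => w z * fderiv ℝ ψ z (1, 0)) K ∧
      IntegrableOn (fun z => fderiv ℝ ψ z (0, F z)) K := by
    intro ψ hψ hψK
    have h0 : ∀ z, z ∉ K → fderiv ℝ ψ z = 0 := fun z hz => by
      by_contra hne
      exact hz (hψK (support_fderiv_subset ℝ (f := ψ) hne))
    have hDc : Continuous (fderiv ℝ ψ) := hψ.continuous_fderiv one_ne_zero
    refine ⟨(setIntegral_eq_integral_of_forall_compl_eq_zero fun z hz => by simp [h0 z hz]).symm,
      (setIntegral_eq_integral_of_forall_compl_eq_zero fun z hz => by simp [h0 z hz]).symm, ?_, ?_⟩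
    · refine hwI.mul_continuousOn ?_ hKc
      exact (hDc.clm_apply continuous_const).continuousOn
    · obtain ⟨C, hC⟩ := hKc.exists_bound_of_continuousOn hDc.continuousOn
      refine Integrable.mono' (g := fun z => C * ‖F z‖) (hFI.norm.const_mul C) ?_ ?_
      · have : Continuous (fun p : (ℝ × EE d →L[ℝ] ℝ) × EE d => p.1 (0, p.2)) := by fun_prop
        exact this.comp_aestronglyMeasurable
          (hDc.aestronglyMeasurable.prodMk hFI.aestronglyMeasurable)
      · refine (ae_restrict_iff' hKc.measurableSet).2 (Eventually.of_forall fun z hz => ?_)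
        refine (ContinuousLinearMap.le_opNorm _ _).trans ?_
        have : ‖((0 : ℝ), F z)‖ = ‖F z‖ := by simp [Prod.norm_def]
        rw [this]
        gcongr
        exact hC z hz
  obtain ⟨k1, k2, k3, k4⟩ := key φ hφ hφK
  have hle : ∀ ε > 0, |(∫ z, w z * fderiv ℝ φ z (1, 0)) - ∫ z, fderiv ℝ φ z (0, F z)| ≤
      ε * ((∫ z in K, ‖w z‖) + ∫ z in K, ‖F z‖) := by
    intro ε hε
    obtain ⟨ψ, hψ, hψK, hψε⟩ := exists_smooth_approx volume φ hφ hc ρ ε hρ hε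
    have hψ1 : ContDiff ℝ 1 ψ := hψ.of_le (by exact_mod_cast le_top)
    obtain ⟨l1, l2, l3, l4⟩ := key ψ hψ1 hψK
    have hw := h.weak ψ hψ (HasCompactSupport.intro hKc fun z hz => by
      by_contra hne; exact hz (hψK (subset_tsupport _ hne))) (hψK.trans hρU)
    have e1 : (∫ z, w z * fderiv ℝ φ z (1, 0)) - ∫ z, fderiv ℝ φ z (0, F z) =
        (∫ z in K, (w z * fderiv ℝ φ z (1, 0) - w z * fderiv ℝ ψ z (1, 0))) -
        ∫ z in K, (fderiv ℝ φ z (0, F z) - fderiv ℝ ψ z (0, F z)) := by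
      rw [integral_sub k3 l3, integral_sub k4 l4, ← k1, ← l1, ← k2, ← l2, hw]; ring
    rw [e1]
    refine (abs_sub _ _).trans ?_
    rw [mul_add]
    refine add_le_add ?_ ?_
    · rw [← Real.norm_eq_abs, ← integral_const_mul]
      refine norm_integral_le_of_norm_le (hwI.norm.const_mul _) (Eventually.of_forall fun z => ?_)
      rw [← mul_sub, norm_mul, mul_comm]
      gcongr
      rw [← _root_.sub_apply]
      refine (ContinuousLinearMap.le_opNorm _ _).trans ?_
      rw [norm_sub_rev]
      simpa [Prod.norm_def] using hψε z
    · rw [← Real.norm_eq_abs, ← integral_const_mul]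
      refine norm_integral_le_of_norm_le (hFI.norm.const_mul _) (Eventually.of_forall fun z => ?_)
      rw [← _root_.sub_apply]
      refine (ContinuousLinearMap.le_opNorm _ _).trans ?_
      rw [norm_sub_rev]
      have : ‖((0 : ℝ), F z)‖ = ‖F z‖ := by simp [Prod.norm_def]
      rw [this]
      gcongr
      exact hψε z
  set B := (∫ z in K, ‖w z‖) + ∫ z in K, ‖F z‖ with hB
  have hB0 : 0 ≤ B := add_nonneg (integral_nonneg fun _ => norm_nonneg _)
    (integral_nonneg fun _ => norm_nonneg _)
  have : |(∫ z, w z * fderiv ℝ φ z (1, 0)) - ∫ z, fderiv ℝ φ z (0, F z)| ≤ 0 := by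
    refine le_of_forall_pos_le_add fun η hη => ?_
    have := hle (η / (B + 1)) (by positivity)
    refine this.trans ?_
    rw [zero_add, div_mul_eq_mul_div, div_le_iff₀ (by positivity)]
    nlinarith
  have h0 := abs_nonpos_iff.1 this
  linarith
end

noncomputable section

lemma st_deriv_zero (y : ℝ) (hy : y ∉ Icc (0:ℝ) 1) : deriv Real.smoothTransition y = 0 := by
  rw [mem_Icc, not_and_or, not_le, not_le] at hy
  rcases hy with hy | hy
  · have : Real.smoothTransition =ᶠ[nhds y] fun _ => 0 := by
      filter_upwards [Iio_mem_nhds hy] with z hz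
      exact Real.smoothTransition.zero_of_nonpos (le_of_lt hz)
    rw [this.deriv_eq]; simp
  · have : Real.smoothTransition =ᶠ[nhds y] fun _ => 1 := by
      filter_upwards [Ioi_mem_nhds hy] with z hz
      exact Real.smoothTransition.one_of_one_le (le_of_lt hz)
    rw [this.deriv_eq]; simp

lemma st_deriv_cont : Continuous (deriv Real.smoothTransition) :=
  (Real.smoothTransition.contDiff (n := 1)).continuous_deriv le_rfl

lemma st_lim (m : ℝ → ℝ) (hm : Continuous m) (a c : ℝ) :
    Tendsto (fun n : ℕ => ∫ t, ((n + 1 : ℝ) * deriv Real.smoothTransition ((n + 1) * (t - a) + c))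
      * m t) atTop (nhds (m a)) := by
  have e : ∀ n : ℕ, ∫ t, ((n + 1 : ℝ) * deriv Real.smoothTransition ((n + 1) * (t - a) + c)) * m t
      = ∫ y in (0:ℝ)..1, deriv Real.smoothTransition y * m (a + (y - c) / (n + 1)) := by
    intro n
    have hn : (0:ℝ) < n + 1 := by positivity
    set g : ℝ → ℝ := fun y => deriv Real.smoothTransition y * m (a + (y - c) / (n + 1)) with hg
    have e1 : ∀ t, ((n + 1 : ℝ) * deriv Real.smoothTransition ((n + 1) * (t - a) + c)) * m t =
        (n + 1) * g ((n + 1) * (t - a) + c) := by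
      intro t
      simp only [hg]
      have : a + ((n + 1) * (t - a) + c - c) / (n + 1 : ℝ) = t := by field_simp; ring
      rw [this]; ring
    simp_rw [e1]
    rw [integral_const_mul, integral_sub_right_eq_self (fun t => g ((n + 1) * t + c)) a,
      Measure.integral_comp_mul_left (fun t => g (t + c)), integral_add_right_eq_self g c,
      abs_of_pos (inv_pos.2 hn), smul_eq_mul, ← mul_assoc, mul_inv_cancel₀ hn.ne', one_mul,
      intervalIntegral.integral_of_le zero_le_one, ← integral_Icc_eq_integral_Ioc]
    exact (setIntegral_eq_integral_of_forall_compl_eq_zero fun y hy => by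
      simp [hg, st_deriv_zero y hy]).symm
  simp_rw [e]
  have h1 : m a = ∫ y in (0:ℝ)..1, deriv Real.smoothTransition y * m a := by
    rw [intervalIntegral.integral_mul_const, intervalIntegral.integral_deriv_eq_sub]
    · simp
    · intro x _
      exact (Real.smoothTransition.contDiff (n := 1)).differentiable one_ne_zero x
    · exact st_deriv_cont.intervalIntegrable _ _
  rw [h1]
  have hlim : ∀ y : ℝ, Tendsto (fun n : ℕ => a + (y - c) / ((n:ℝ) + 1)) atTop (nhds a) := by
    intro y
    have : Tendsto (fun n : ℕ => a + (y - c) * (1 / ((n:ℝ) + 1))) atTop (nhds (a + (y - c) * 0)) :=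
      (tendsto_one_div_add_atTop_nhds_zero_nat.const_mul _).const_add _
    simpa [div_eq_mul_inv] using this
  obtain ⟨C, hC⟩ := (isCompact_Icc (a := a - (1 + |c|)) (b := a + (1 + |c|))).exists_bound_of_continuousOn
    hm.continuousOn
  obtain ⟨C', hC'⟩ := (isCompact_Icc (a := (0:ℝ)) (b := 1)).exists_bound_of_continuousOn
    st_deriv_cont.continuousOn
  refine intervalIntegral.tendsto_integral_filter_of_dominated_convergence (fun _ => C' * C)
    (Eventually.of_forall fun n => ?_) (Eventually.of_forall fun n => ?_) ?_ ?_
  · refine Continuous.aestronglyMeasurable ?_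
    have := st_deriv_cont
    fun_prop
  · refine Eventually.of_forall fun y hy => ?_
    rw [uIoc_of_le zero_le_one] at hy
    rw [norm_mul]
    refine mul_le_mul (hC' y ⟨hy.1.le, hy.2⟩) (hC _ ?_) (norm_nonneg _)
      ((norm_nonneg _).trans (hC' y ⟨hy.1.le, hy.2⟩))
    have hn : (1:ℝ) ≤ n + 1 := by
      have : (0:ℝ) ≤ n := n.cast_nonneg
      linarith
    have : |(y - c) / ((n:ℝ) + 1)| ≤ 1 + |c| := by
      rw [abs_div, abs_of_pos (by linarith : (0:ℝ) < n + 1)]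
      refine (div_le_self (abs_nonneg _) hn).trans ?_
      refine (abs_sub _ _).trans ?_
      rw [abs_of_pos hy.1]
      linarith [hy.2]
    rw [abs_le] at this
    constructor <;> linarith [this.1, this.2]
  · simp
  · refine Eventually.of_forall fun y _ => ?_
    exact ((hm.tendsto a).comp (hlim y)).const_mul _

/-- continuity of a product when the second factor vanishes off `K`. -/
lemma contOn_smul_supp {d : ℕ} {V : Type} [NormedAddCommGroup V] [NormedSpace ℝ V]
    {U : Set (ℝ × EE d)} (hU : IsOpen U) {K : Set (EE d)} (hK : IsClosed K) {I : Set ℝ}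
    (hIK : I ×ˢ K ⊆ U) {f : ℝ × EE d → V} (hf : ContinuousOn f U) {g : ℝ × EE d → ℝ}
    (hg : Continuous g) (hg0 : ∀ z, z.2 ∉ K → g z = 0) :
    ContinuousOn (fun z => g z • f z) (I ×ˢ (univ : Set (EE d))) := by
  rintro ⟨t, x⟩ ⟨ht, -⟩
  refine ContinuousAt.continuousWithinAt ?_
  by_cases hx : x ∈ K
  · exact hg.continuousAt.smul (hf.continuousAt (hU.mem_nhds (hIK ⟨ht, hx⟩)))
  · have : (fun z => g z • f z) =ᶠ[nhds (t, x)] fun _ => 0 := by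
      have : {z : ℝ × EE d | z.2 ∉ K} ∈ nhds (t, x) :=
        (hK.isOpen_compl.preimage continuous_snd).mem_nhds hx
      filter_upwards [this] with z hz
      simp [hg0 z hz]
    exact continuousAt_const.congr this.symm

lemma WSol.slice {d : ℕ} {U : Set (ℝ × EE d)} {w : ℝ × EE d → ℝ} {P F : ℝ × EE d → EE d}
    (h : WSol U w P F) (θ : EE d → ℝ) (hθ : ContDiff ℝ 1 θ) {K : Set (EE d)} (hK : IsCompact K)
    (hθK : ∀ x, x ∉ K → θ x = 0) {t₁ t₂ : ℝ} (ht : t₁ < t₂) (hKU : Icc t₁ t₂ ×ˢ K ⊆ U) :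
    ∫ x, (w (t₂, x) - w (t₁, x)) * θ x = - ∫ z in Ioc t₁ t₂ ×ˢ K, fderiv ℝ θ z.2 (F z) := by
  set S := Real.smoothTransition with hS
  have hSc : ContDiff ℝ 1 S := Real.smoothTransition.contDiff
  have hts : tsupport θ ⊆ K := closure_minimal (fun x hx => by
    by_contra h'; exact hx (hθK x h')) hK.isClosed
  have hfK : ∀ x, x ∉ K → fderiv ℝ θ x = 0 := fun x hx => by
    by_contra hne; exact hx (hts (support_fderiv_subset ℝ (f := θ) hne))
  have hQ : IsCompact (Icc t₁ t₂ ×ˢ K) := isCompact_Icc.prod hK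
  set m : ℝ → ℝ := fun t => ∫ x, w (t, x) * θ x with hm
  have hcw : ContinuousOn (fun z : ℝ × EE d => w z * θ z.2) (Icc t₁ t₂ ×ˢ univ) := by
    have := contOn_smul_supp h.isOpen hK.isClosed hKU h.contw (g := fun z => θ z.2)
      (by have := hθ.continuous; fun_prop) (fun z hz => hθK _ hz)
    refine this.congr fun z _ => by simp [mul_comm]
  have hmc : ContinuousOn m (Icc t₁ t₂) := by
    refine continuousOn_integral_of_compact_support (k := K) (f := fun t x => w (t, x) * θ x) hK ?_ ?_
    · exact hcw
    · intro p x _ hx; simp [hθK x hx]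
  set m' : ℝ → ℝ := IccExtend ht.le ((Icc t₁ t₂).domRestrict m) with hm'
  have hm'c : Continuous m' := hmc.domRestrict.Icc_extend'
  have hm'e : ∀ t ∈ Icc t₁ t₂, m' t = m t := fun t h' => IccExtend_of_mem _ _ h'
  -- the cut-off in time
  set η : ℕ → ℝ → ℝ := fun n t => S ((n + 1) * (t - t₁) + 0) - S ((n + 1) * (t - t₂) + 1) with hη
  set η' : ℕ → ℝ → ℝ := fun n t => (n + 1) * deriv S ((n + 1) * (t - t₁) + 0) -
    (n + 1) * deriv S ((n + 1) * (t - t₂) + 1) with hη'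
  obtain ⟨N, hN⟩ : ∃ N : ℕ, ∀ n ≥ N, 1 ≤ (n + 1 : ℝ) * (t₂ - t₁) := by
    obtain ⟨N, hN⟩ := exists_nat_gt (1 / (t₂ - t₁))
    refine ⟨N, fun n hn => ?_⟩
    have h0 : 0 < t₂ - t₁ := sub_pos.2 ht
    rw [div_lt_iff₀ h0] at hN
    have : (N : ℝ) ≤ n := by exact_mod_cast hn
    nlinarith
  have hηd : ∀ n t, HasDerivAt (η n) (η' n t) t := by
    intro n t
    have hS' : ∀ y, HasDerivAt S (deriv S y) y := fun y =>
      ((hSc.differentiable one_ne_zero) y).hasDerivAt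
    have l1 : HasDerivAt (fun t : ℝ => ((n + 1 : ℝ)) * (t - t₁) + 0) (n + 1) t := by
      simpa using (((hasDerivAt_id t).sub_const t₁).const_mul (n + 1 : ℝ)).add_const 0
    have l2 : HasDerivAt (fun t : ℝ => ((n + 1 : ℝ)) * (t - t₂) + 1) (n + 1) t := by
      simpa using (((hasDerivAt_id t).sub_const t₂).const_mul (n + 1 : ℝ)).add_const 1
    have := ((hS' _).comp t l1).sub ((hS' _).comp t l2)
    refine this.congr_deriv ?_
    simp only [hη']; ring
  have hηc : ∀ n, ContDiff ℝ 1 (η n) := by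
    intro n
    refine (hSc.comp ?_).sub (hSc.comp ?_) <;> fun_prop
  have hη0 : ∀ n ≥ N, ∀ t, t ∉ Icc t₁ t₂ → η n t = 0 := by
    intro n hn t htt
    have hn0 : (0:ℝ) < n + 1 := by positivity
    rw [mem_Icc, not_and_or, not_le, not_le] at htt
    simp only [hη, hS]
    rcases htt with h' | h'
    · rw [Real.smoothTransition.zero_of_nonpos, Real.smoothTransition.zero_of_nonpos, sub_zero]
      · nlinarith [hN n hn]
      · nlinarith
    · rw [Real.smoothTransition.one_of_one_le, Real.smoothTransition.one_of_one_le, sub_self]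
      · nlinarith
      · nlinarith [hN n hn]
  have hη'0 : ∀ n ≥ N, ∀ t, t ∉ Icc t₁ t₂ → η' n t = 0 := by
    intro n hn t htt
    have : η n =ᶠ[nhds t] fun _ => 0 := by
      filter_upwards [isClosed_Icc.isOpen_compl.mem_nhds htt] with s hs
      exact hη0 n hn s hs
    rw [← (hηd n t).deriv, this.deriv_eq]; simp
  have hη1 : ∀ n t, |η n t| ≤ 1 := by
    intro n t
    simp only [hη, hS]
    rw [abs_le]
    constructor <;> linarith [Real.smoothTransition.nonneg ((n + 1 : ℝ) * (t - t₁) + 0),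
      Real.smoothTransition.le_one ((n + 1 : ℝ) * (t - t₁) + 0),
      Real.smoothTransition.nonneg ((n + 1 : ℝ) * (t - t₂) + 1),
      Real.smoothTransition.le_one ((n + 1 : ℝ) * (t - t₂) + 1)]
  have hηlim : ∀ t ∈ Ioo t₁ t₂, Tendsto (fun n => η n t) atTop (nhds 1) := by
    intro t htt
    refine tendsto_const_nhds.congr' ?_
    obtain ⟨M, hM⟩ := exists_nat_gt (1 / (t - t₁) + 1 / (t₂ - t))
    filter_upwards [eventually_ge_atTop M] with n hn
    have h1 : 0 < t - t₁ := sub_pos.2 htt.1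
    have h2 : 0 < t₂ - t := sub_pos.2 htt.2
    have hMn : (M : ℝ) ≤ n := by exact_mod_cast hn
    have a1 : 1 / (t - t₁) < n := by
      have : 0 < 1 / (t₂ - t) := by positivity
      linarith
    have a2 : 1 / (t₂ - t) < n := by
      have : 0 < 1 / (t - t₁) := by positivity
      linarith
    rw [div_lt_iff₀ h1] at a1
    rw [div_lt_iff₀ h2] at a2
    simp only [hη, hS]
    rw [Real.smoothTransition.one_of_one_le, Real.smoothTransition.zero_of_nonpos, sub_zero]
    · nlinarith
    · nlinarith
  -- weak formulation
  have hfd : ∀ n z, HasFDerivAt (fun z : ℝ × EE d => η n z.1 * θ z.2)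
      (η n z.1 • (fderiv ℝ θ z.2).comp (ContinuousLinearMap.snd ℝ ℝ (EE d)) +
        θ z.2 • (η' n z.1) • ContinuousLinearMap.fst ℝ ℝ (EE d)) z := by
    intro n z
    have a1 : HasFDerivAt (fun z : ℝ × EE d => η n z.1)
        ((η' n z.1) • ContinuousLinearMap.fst ℝ ℝ (EE d)) z :=
      (hηd n z.1).comp_hasFDerivAt z hasFDerivAt_fst
    have a2 : HasFDerivAt (fun z : ℝ × EE d => θ z.2)
        ((fderiv ℝ θ z.2).comp (ContinuousLinearMap.snd ℝ ℝ (EE d))) z :=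
      ((hθ.differentiable one_ne_zero) z.2).hasFDerivAt.comp z hasFDerivAt_snd
    exact a1.mul a2
  have hweak : ∀ n ≥ N, ∫ z : ℝ × EE d, η' n z.1 * (w z * θ z.2) =
      ∫ z : ℝ × EE d, η n z.1 * fderiv ℝ θ z.2 (F z) := by
    intro n hn
    have hz0 : ∀ z : ℝ × EE d, z ∉ Icc t₁ t₂ ×ˢ K → η n z.1 * θ z.2 = 0 := by
      intro z hz
      by_cases h1 : z.1 ∈ Icc t₁ t₂
      · rw [hθK z.2 (fun h2 => hz ⟨h1, h2⟩), mul_zero]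
      · rw [hη0 n hn _ h1, zero_mul]
    have := h.weakC1 (fun z => η n z.1 * θ z.2) (by
        exact ((hηc n).comp contDiff_fst).mul (hθ.comp contDiff_snd))
      (HasCompactSupport.intro hQ hz0)
      ((closure_minimal (fun x hx => by by_contra h'; exact hx (hz0 x h')) hQ.isClosed).trans hKU)
    simp_rw [(hfd n _).fderiv] at this
    simp at this
    rw [← this]
    refine integral_congr_ae (Eventually.of_forall fun z => ?_)
    simp; ring
  -- left side
  have hL : ∀ n ≥ N, ∫ z : ℝ × EE d, η' n z.1 * (w z * θ z.2) =
      (∫ t, ((n + 1 : ℝ) * deriv S ((n + 1) * (t - t₁) + 0)) * m' t) -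
        ∫ t, ((n + 1 : ℝ) * deriv S ((n + 1) * (t - t₂) + 1)) * m' t := by
    intro n hn
    have hη'c : Continuous (η' n) := by
      have := st_deriv_cont
      simp only [hη', hS]; fun_prop
    have h_integ : Integrable (fun z : ℝ × EE d => η' n z.1 * (w z * θ z.2)) := by
      have hz0 : ∀ z : ℝ × EE d, z ∉ Icc t₁ t₂ ×ˢ K → η' n z.1 * (w z * θ z.2) = 0 := by
        intro z hz
        by_cases h1 : z.1 ∈ Icc t₁ t₂
        · rw [hθK z.2 (fun h2 => hz ⟨h1, h2⟩), mul_zero, mul_zero]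
        · rw [hη'0 n hn _ h1, zero_mul]
      rw [← integrableOn_iff_integrable_of_support_subset (s := Icc t₁ t₂ ×ˢ K)]
      · refine ContinuousOn.integrableOn_compact hQ ?_
        refine (hη'c.comp continuous_fst).continuousOn.mul ?_
        exact hcw.mono (prod_mono_right (subset_univ _))
      · intro z hz
        by_contra h'; exact hz (hz0 z h')
    have hint2 : ∀ (s c : ℝ), Integrable (fun t =>
        ((n + 1 : ℝ) * deriv S ((n + 1) * (t - s) + c)) * m' t) := by
      intro s c
      refine Continuous.integrable_of_hasCompactSupport ?_ ?_
      · have := st_deriv_cont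
        fun_prop
      · refine HasCompactSupport.intro (isCompact_Icc (a := s + (0 - c)/(n+1)) (b := s + (1-c)/(n+1)))
          fun t htt => ?_
        rw [st_deriv_zero, mul_zero, zero_mul]
        intro h'
        apply htt
        have hn0 : (0:ℝ) < n + 1 := by positivity
        constructor
        · rw [← le_sub_iff_add_le', div_le_iff₀ hn0]; linarith [h'.1]
        · rw [← sub_le_iff_le_add', le_div_iff₀ hn0]; linarith [h'.2]
    rw [← integral_sub (hint2 _ _) (hint2 _ _), Measure.volume_eq_prod, integral_prod _ h_integ]
    refine integral_congr_ae (Eventually.of_forall fun t => ?_)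
    simp only
    rw [integral_const_mul, ← sub_mul]
    change η' n t * m t = η' n t * m' t
    by_cases htt : t ∈ Icc t₁ t₂
    · rw [hm'e t htt]
    · rw [hη'0 n hn t htt, zero_mul, zero_mul]
  have hL' : Tendsto (fun n => ∫ z : ℝ × EE d, η' n z.1 * (w z * θ z.2)) atTop
      (nhds (m t₁ - m t₂)) := by
    have := (st_lim m' hm'c t₁ 0).sub (st_lim m' hm'c t₂ 1)
    rw [hm'e t₁ ⟨le_rfl, ht.le⟩, hm'e t₂ ⟨ht.le, le_rfl⟩] at this
    refine this.congr' ?_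
    filter_upwards [eventually_ge_atTop N] with n hn
    rw [hL n hn]
  have hFI : IntegrableOn F (Icc t₁ t₂ ×ˢ K) := h.locF.integrableOn_compact_subset hKU hQ
  have hDc : Continuous (fderiv ℝ θ) := hθ.continuous_fderiv one_ne_zero
  obtain ⟨C, hC⟩ := hK.exists_bound_of_continuousOn hDc.continuousOn
  have hmeas : AEStronglyMeasurable (fun z : ℝ × EE d => fderiv ℝ θ z.2 (F z))
      (volume.restrict (Icc t₁ t₂ ×ˢ K)) := by
    have : Continuous (fun p : (EE d →L[ℝ] ℝ) × EE d => p.1 p.2) := by fun_prop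
    exact this.comp_aestronglyMeasurable
      ((hDc.comp continuous_snd).aestronglyMeasurable.prodMk hFI.aestronglyMeasurable)
  have hR' : Tendsto (fun n => ∫ z : ℝ × EE d, η n z.1 * fderiv ℝ θ z.2 (F z)) atTop
      (nhds (∫ z in Icc t₁ t₂ ×ˢ K, fderiv ℝ θ z.2 (F z))) := by
    have h1 : Tendsto (fun n => ∫ z in Icc t₁ t₂ ×ˢ K, η n z.1 * fderiv ℝ θ z.2 (F z)) atTop
      (nhds (∫ z in Icc t₁ t₂ ×ˢ K, fderiv ℝ θ z.2 (F z))) := by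
      refine tendsto_integral_of_dominated_convergence (fun z => C * ‖F z‖) (fun n => ?_)
        (hFI.norm.const_mul C) (fun n => ?_) ?_
      · exact (((hηc n).continuous.comp continuous_fst).aestronglyMeasurable).mul hmeas
      · refine (ae_restrict_iff' hQ.measurableSet).2 (Eventually.of_forall fun z hz => ?_)
        rw [norm_mul]
        refine (mul_le_of_le_one_left (norm_nonneg _) (hη1 n _)).trans ?_
        refine (ContinuousLinearMap.le_opNorm _ _).trans ?_
        gcongr
        exact hC _ hz.2
      · have hnull : ∀ᵐ z : ℝ × EE d, z.1 ≠ t₁ ∧ z.1 ≠ t₂ := by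
          have hh : ∀ s : ℝ, ∀ᵐ z : ℝ × EE d, z.1 ≠ s := by
            intro s
            have : (volume : Measure (ℝ × EE d)) (({s} : Set ℝ) ×ˢ univ) = 0 := by
              rw [Measure.volume_eq_prod, Measure.prod_prod]; simp
            rw [ae_iff]
            convert this using 2
            ext z; simp
          filter_upwards [hh t₁, hh t₂] with z a b using ⟨a, b⟩
        rw [ae_restrict_iff' hQ.measurableSet]
        filter_upwards [hnull] with z hz hzQ
        have hzI : z.1 ∈ Ioo t₁ t₂ := ⟨lt_of_le_of_ne hzQ.1.1 (Ne.symm hz.1),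
          lt_of_le_of_ne hzQ.1.2 hz.2⟩
        simpa using (hηlim z.1 hzI).mul_const (fderiv ℝ θ z.2 (F z))
    refine h1.congr' ?_
    filter_upwards [eventually_ge_atTop N] with n hn
    refine setIntegral_eq_integral_of_forall_compl_eq_zero fun z hz => ?_
    by_cases h1 : z.1 ∈ Icc t₁ t₂
    · rw [hfK z.2 (fun h2 => hz ⟨h1, h2⟩)]; simp
    · rw [hη0 n hn _ h1, zero_mul]
  have heq : m t₁ - m t₂ = ∫ z in Icc t₁ t₂ ×ˢ K, fderiv ℝ θ z.2 (F z) := by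
    refine tendsto_nhds_unique hL' (hR'.congr' ?_)
    filter_upwards [eventually_ge_atTop N] with n hn
    rw [hweak n hn]
  have hset : ∫ z in Icc t₁ t₂ ×ˢ K, fderiv ℝ θ z.2 (F z) =
      ∫ z in Ioc t₁ t₂ ×ˢ K, fderiv ℝ θ z.2 (F z) := by
    refine setIntegral_congr_set ?_
    rw [Measure.volume_eq_prod]
    exact Measure.set_prod_ae_eq Ioc_ae_eq_Icc.symm (ae_eq_refl _)
  have hsl : ∀ t ∈ Icc t₁ t₂, Integrable (fun x => w (t, x) * θ x) := by
    intro t htt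
    refine Continuous.integrable_of_hasCompactSupport ?_
      (HasCompactSupport.intro hK fun x hx => by rw [hθK x hx, mul_zero])
    exact hcw.comp_continuous (f := fun x : EE d => (t, x)) (by fun_prop) (fun x => ⟨htt, mem_univ _⟩)
  simp_rw [sub_mul]
  rw [integral_sub (hsl _ ⟨ht.le, le_rfl⟩) (hsl _ ⟨le_rfl, ht.le⟩), ← hset, ← heq]
  ring
end

noncomputable section

/-- the spatial derivative of `Phi1 (w) ψ`. -/
def Lfun {d : ℕ} (w : ℝ × EE d → ℝ) (P : ℝ × EE d → EE d) (Φ1 Φ2 : ℝ → ℝ)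
    (ψ : ℝ × EE d → ℝ) (z : ℝ × EE d) : EE d →L[ℝ] ℝ :=
  (ψ z * Φ2 (w z)) • innerSL ℝ (P z) +
    Φ1 (w z) • (fderiv ℝ ψ z).comp (ContinuousLinearMap.inr ℝ ℝ (EE d))

lemma anti_of_local (f : ℝ → ℝ) (a b : ℝ) (hab : a ≤ b) (δ : ℝ) (hδ : 0 < δ)
    (h : ∀ t₁ t₂, a ≤ t₁ → t₁ < t₂ → t₂ ≤ b → t₂ - t₁ < δ → f t₂ ≤ f t₁) : f b ≤ f a := by
  rcases hab.eq_or_lt with rfl | hab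
  · exact le_rfl
  obtain ⟨n, hn⟩ := exists_nat_gt ((b - a) / δ)
  have hba : 0 < b - a := sub_pos.2 hab
  have hn0 : (0:ℝ) < n := lt_trans (by positivity) hn
  rw [div_lt_iff₀ hδ] at hn
  have hs : (b - a) / n < δ := by rw [div_lt_iff₀ hn0]; linarith
  have hs0 : 0 < (b - a) / n := by positivity
  have key : ∀ k : ℕ, k ≤ n → f (a + k * ((b - a) / n)) ≤ f a := by
    intro k
    induction k with
    | zero => simp
    | succ k ih =>
      intro hk
      refine le_trans (h (a + k * ((b - a) / n)) _ ?_ ?_ ?_ ?_) (ih (by omega))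
      · have : 0 ≤ (k:ℝ) * ((b - a) / n) := by positivity
        linarith
      · push_cast; linarith
      · have : ((k + 1 : ℕ):ℝ) ≤ n := by exact_mod_cast hk
        calc a + ((k + 1 : ℕ):ℝ) * ((b - a) / n) ≤ a + n * ((b - a) / n) := by gcongr
          _ = b := by field_simp; ring
      · push_cast; linarith
  have := key n le_rfl
  rwa [show a + (n:ℝ) * ((b - a) / n) = b by field_simp; ring] at this

section
variable {d : ℕ} {U : Set (ℝ × EE d)} {w : ℝ × EE d → ℝ} {P F : ℝ × EE d → EE d}

lemma zero_near {K : Set (EE d)} (hK : IsClosed K) {ψ : ℝ × EE d → ℝ}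
    (hψK : ∀ z, z.2 ∉ K → ψ z = 0) (z : ℝ × EE d) (hz : z.2 ∉ K) : ψ =ᶠ[nhds z] fun _ => 0 := by
  have : {z : ℝ × EE d | z.2 ∉ K} ∈ nhds z :=
    (hK.isOpen_compl.preimage continuous_snd).mem_nhds hz
  filter_upwards [this] with y hy using hψK y hy

lemma fderiv_zero_off {K : Set (EE d)} (hK : IsClosed K) {ψ : ℝ × EE d → ℝ}
    (hψK : ∀ z, z.2 ∉ K → ψ z = 0) (z : ℝ × EE d) (hz : z.2 ∉ K) : fderiv ℝ ψ z = 0 := by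
  rw [(zero_near hK hψK z hz).fderiv_eq]; simp

lemma Lfun_zero {K : Set (EE d)} (hK : IsClosed K) {ψ : ℝ × EE d → ℝ}
    (hψK : ∀ z, z.2 ∉ K → ψ z = 0) (Φ1 Φ2 : ℝ → ℝ) (z : ℝ × EE d) (hz : z.2 ∉ K) :
    Lfun w P Φ1 Φ2 ψ z = 0 := by
  rw [Lfun, fderiv_zero_off hK hψK z hz, hψK z hz]; simp

lemma WSol.Lfun_cont (h : WSol U w P F) {K : Set (EE d)} (hK : IsClosed K) {I : Set ℝ}
    (hIK : I ×ˢ K ⊆ U) {ψ : ℝ × EE d → ℝ} (hψ : ContDiff ℝ 1 ψ)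
    (hψK : ∀ z, z.2 ∉ K → ψ z = 0) {Φ1 Φ2 : ℝ → ℝ} (h1 : Continuous Φ1) (h2 : Continuous Φ2) :
    ContinuousOn (Lfun w P Φ1 Φ2 ψ) (I ×ˢ (univ : Set (EE d))) := by
  rintro z ⟨ht, -⟩
  refine ContinuousAt.continuousWithinAt ?_
  by_cases hx : z.2 ∈ K
  · have hw := h.contw.continuousAt (h.isOpen.mem_nhds (hIK ⟨ht, hx⟩))
    have hP := h.contP.continuousAt (h.isOpen.mem_nhds (hIK ⟨ht, hx⟩))
    have hD : ContinuousAt (fderiv ℝ ψ) z := (hψ.continuous_fderiv one_ne_zero).continuousAt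
    have hψ0 : ContinuousAt ψ z := hψ.continuous.continuousAt
    unfold Lfun
    refine ContinuousAt.add (ContinuousAt.smul (hψ0.mul (h2.continuousAt.comp hw)) ?_)
      (ContinuousAt.smul (h1.continuousAt.comp hw) ?_)
    · exact (innerSL ℝ).continuous.continuousAt.comp hP
    · exact hD.clm_comp continuousAt_const
  · have : Lfun w P Φ1 Φ2 ψ =ᶠ[nhds z] fun _ => 0 := by
      have : {z : ℝ × EE d | z.2 ∉ K} ∈ nhds z :=
        (hK.isOpen_compl.preimage continuous_snd).mem_nhds hx
      filter_upwards [this] with y hy using Lfun_zero hK hψK _ _ y hy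
    exact continuousAt_const.congr this.symm

lemma WSol.theta (h : WSol U w P F) {K : Set (EE d)} (hK : IsClosed K) {t : ℝ}
    (hIK : ∀ x ∈ K, (t, x) ∈ U) {ψ : ℝ × EE d → ℝ} (hψ : ContDiff ℝ 1 ψ)
    (hψK : ∀ z, z.2 ∉ K → ψ z = 0) {Φ1 Φ2 : ℝ → ℝ} (h1 : ∀ s, HasDerivAt Φ1 (Φ2 s) s) (x : EE d) :
    HasFDerivAt (fun y => Φ1 (w (t, y)) * ψ (t, y)) (Lfun w P Φ1 Φ2 ψ (t, x)) x := by
  have hp : HasFDerivAt (fun y => ψ (t, y))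
      ((fderiv ℝ ψ (t, x)).comp (ContinuousLinearMap.inr ℝ ℝ (EE d))) x :=
    ((hψ.differentiable one_ne_zero) (t, x)).hasFDerivAt.comp x (hasFDerivAt_prodMk_right t x)
  by_cases hx : x ∈ K
  · have hw := (h1 (w (t, x))).comp_hasFDerivAt x (h.grad _ (hIK x hx))
    refine (hw.mul hp).congr_fderiv ?_
    unfold Lfun
    ext v
    simp; ring
  · rw [Lfun_zero hK hψK _ _ _ hx]
    refine (hasFDerivAt_const (0:ℝ) x).congr_of_eventuallyEq ?_
    filter_upwards [hK.isOpen_compl.mem_nhds hx] with y hy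
    rw [hψK (t, y) hy, mul_zero]

lemma WSol.energy_integrable (h : WSol U w P F) {K : Set (EE d)} (hK : IsCompact K) {T₀ τ : ℝ}
    (hKU : Icc T₀ τ ×ˢ K ⊆ U)
    {ψ : ℝ × EE d → ℝ} (hψ : ContDiff ℝ 1 ψ)
    (hψK : ∀ z, z.2 ∉ K → ψ z = 0)
    {Φ1 Φ2 : ℝ → ℝ} (h1 : Continuous Φ1) (h2 : Continuous Φ2) :
    IntegrableOn (fun z => Lfun w P Φ1 Φ2 ψ z (F z)) (Icc T₀ τ ×ˢ K) := by
  have hQ : IsCompact (Icc T₀ τ ×ˢ K) := isCompact_Icc.prod hK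
  have hFI : IntegrableOn F (Icc T₀ τ ×ˢ K) := h.locF.integrableOn_compact_subset hKU hQ
  have hLc := (h.Lfun_cont hK.isClosed hKU hψ hψK h1 h2).mono
    (prod_mono_right (subset_univ K))
  obtain ⟨C, hC⟩ := hQ.exists_bound_of_continuousOn hLc
  refine Integrable.mono' (hFI.norm.const_mul C) ?_ ?_
  · have : Continuous (fun p : (EE d →L[ℝ] ℝ) × EE d => p.1 p.2) := by fun_prop
    exact this.comp_aestronglyMeasurable
      ((hLc.aestronglyMeasurable hQ.measurableSet).prodMk hFI.aestronglyMeasurable)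
  · refine (ae_restrict_iff' hQ.measurableSet).2 (Eventually.of_forall fun z hz => ?_)
    refine (ContinuousLinearMap.le_opNorm _ _).trans ?_
    gcongr
    exact hC z hz

lemma WSol.energy (h : WSol U w P F) {K : Set (EE d)} (hK : IsCompact K) {T₀ τ : ℝ}
    (hTτ : T₀ ≤ τ) (hKU : Icc T₀ τ ×ˢ K ⊆ U)
    {ψ : ℝ × EE d → ℝ} (hψ : ContDiff ℝ 1 ψ) (hψ0 : ∀ z, 0 ≤ ψ z)
    (hψK : ∀ z, z.2 ∉ K → ψ z = 0)
    {Φ Φ1 Φ2 : ℝ → ℝ} (h0 : ∀ s, HasDerivAt Φ (Φ1 s) s)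
    (h1 : ∀ s, HasDerivAt Φ1 (Φ2 s) s) (h2 : Continuous Φ2) (h2' : ∀ s, 0 ≤ Φ2 s) :
    (∫ x, Φ (w (τ, x)) * ψ (τ, x)) - (∫ x, Φ (w (T₀, x)) * ψ (T₀, x)) ≤
      ∫ z in Ioc T₀ τ ×ˢ K, (Φ (w z) * fderiv ℝ ψ z (1, 0) - Lfun w P Φ1 Φ2 ψ z (F z)) := by
  have hΦc : Continuous Φ := continuous_iff_continuousAt.2 fun s => (h0 s).continuousAt
  have hPhi1c : Continuous Φ1 := continuous_iff_continuousAt.2 fun s => (h1 s).continuousAt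
  have hQ : IsCompact (Icc T₀ τ ×ˢ K) := isCompact_Icc.prod hK
  have hFI : IntegrableOn F (Icc T₀ τ ×ˢ K) := h.locF.integrableOn_compact_subset hKU hQ
  have hLI := h.energy_integrable hK hKU hψ hψK hPhi1c h2
  have hLc := h.Lfun_cont hK.isClosed hKU hψ hψK hPhi1c h2
  have hLcK := hLc.mono (prod_mono_right (subset_univ K))
  have hDc : Continuous (fun z => fderiv ℝ ψ z (1, 0)) :=
    (hψ.continuous_fderiv one_ne_zero).clm_apply continuous_const
  have hΦw : ContinuousOn (fun z => Φ (w z)) (Icc T₀ τ ×ˢ K) :=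
    hΦc.comp_continuousOn (h.contw.mono hKU)
  have hJI : IntegrableOn (fun z => Φ (w z) * fderiv ℝ ψ z (1, 0) - Lfun w P Φ1 Φ2 ψ z (F z))
      (Icc T₀ τ ×ˢ K) :=
    ((hΦw.mul hDc.continuousOn).integrableOn_compact hQ).sub hLI
  obtain ⟨Cψ, hCψ⟩ := hQ.exists_bound_of_continuousOn hDc.continuousOn
  have hGI : IntegrableOn (fun z => |Cψ| + ‖F z‖) (Icc T₀ τ ×ˢ K) :=
    (integrableOn_const hQ.measure_lt_top.ne).add hFI.norm
  set J := fun z => Φ (w z) * fderiv ℝ ψ z (1, 0) - Lfun w P Φ1 Φ2 ψ z (F z) with hJ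
  set G := fun z => |Cψ| + ‖F z‖ with hG
  set E : ℝ → ℝ := fun t => ∫ x, Φ (w (t, x)) * ψ (t, x) with hE
  have hcE : ∀ t ∈ Icc T₀ τ, ∀ g : ℝ × EE d → ℝ, ContinuousOn g (Icc T₀ τ ×ˢ univ) →
      (∀ z, z.2 ∉ K → g z = 0) → Integrable (fun x => g (t, x)) := by
    intro t ht g hg hg0
    refine Continuous.integrable_of_hasCompactSupport ?_
      (HasCompactSupport.intro hK fun x hx => hg0 _ hx)
    exact hg.comp_continuous (f := fun x : EE d => (t, x)) (by fun_prop) (fun x => ⟨ht, mem_univ _⟩)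
  have hstep : ∀ ε > 0, ∃ δ > 0, ∀ t₁ t₂, T₀ ≤ t₁ → t₁ < t₂ → t₂ ≤ τ → t₂ - t₁ < δ →
      E t₂ - E t₁ ≤ (∫ z in Ioc t₁ t₂ ×ˢ K, J z) + ε * ∫ z in Ioc t₁ t₂ ×ˢ K, G z := by
    intro ε hε
    obtain ⟨δ₁, hδ₁, hu₁⟩ := Metric.uniformContinuousOn_iff.1
      (hQ.uniformContinuousOn_of_continuous hLcK) ε hε
    obtain ⟨δ₂, hδ₂, hu₂⟩ := Metric.uniformContinuousOn_iff.1
      (hQ.uniformContinuousOn_of_continuous hΦw) ε hε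
    refine ⟨min δ₁ δ₂, lt_min hδ₁ hδ₂, fun t₁ t₂ ht₁ ht ht₂ hδ => ?_⟩
    have m1 : t₁ ∈ Icc T₀ τ := ⟨ht₁, ht.le.trans ht₂⟩
    have m2 : t₂ ∈ Icc T₀ τ := ⟨ht₁.trans ht.le, ht₂⟩
    have hsub : Ioc t₁ t₂ ×ˢ K ⊆ Icc T₀ τ ×ˢ K :=
      prod_mono_left fun s hs => ⟨ht₁.trans hs.1.le, hs.2.trans ht₂⟩
    have hmeas : MeasurableSet (Ioc t₁ t₂ ×ˢ K) := measurableSet_Ioc.prod hK.measurableSet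
    have hθd := fun x => h.theta hK.isClosed (t := t₂) (fun x hx => hKU ⟨m2, hx⟩) hψ hψK h1 x
    have hθ : ContDiff ℝ 1 (fun y => Φ1 (w (t₂, y)) * ψ (t₂, y)) := by
      rw [contDiff_one_iff_fderiv]
      refine ⟨fun x => (hθd x).differentiableAt, ?_⟩
      have : fderiv ℝ (fun y => Φ1 (w (t₂, y)) * ψ (t₂, y)) =
          fun x => Lfun w P Φ1 Φ2 ψ (t₂, x) := funext fun x => (hθd x).fderiv
      rw [this]
      exact hLc.comp_continuous (f := fun x : EE d => (t₂, x)) (by fun_prop)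
        (fun x => ⟨m2, mem_univ _⟩)
    have hsl := h.slice _ hθ hK (fun x hx => by rw [hψK (t₂, x) hx, mul_zero]) ht
      ((prod_mono_left (Icc_subset_Icc ht₁ ht₂)).trans hKU)
    simp_rw [(hθd _).fderiv] at hsl
    -- continuity facts
    have hwψ : ∀ (g : ℝ × EE d → ℝ), Continuous g → (∀ z, z.2 ∉ K → g z = 0) →
        ∀ f : ℝ × EE d → ℝ, ContinuousOn f U → ContinuousOn (fun z => f z * g z)
        (Icc T₀ τ ×ˢ (univ : Set (EE d))) := by
      intro g hg hg0 f hf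
      refine (contOn_smul_supp h.isOpen hK.isClosed hKU hf hg hg0).congr fun z _ => by
        simp [mul_comm]
    have shiftc : ∀ s : ℝ, Continuous (fun z : ℝ × EE d => ψ (s, z.2)) := fun s => by
      have := hψ.continuous; fun_prop
    have c1 := fun s => hwψ (fun z => ψ (s, z.2)) (shiftc s) (fun z hz => hψK _ hz)
      (fun z => Φ (w z)) (hΦc.comp_continuousOn h.contw)
    have c2 := hwψ (fun z => ψ (t₂, z.2)) (shiftc t₂) (fun z hz => hψK _ hz)
      (fun z => Φ1 (w z)) (hPhi1c.comp_continuousOn h.contw)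
    have c3 := hwψ (fun z => ψ (t₂, z.2)) (shiftc t₂) (fun z hz => hψK _ hz)
      (fun z => Φ1 (w z) * w z) ((hPhi1c.comp_continuousOn h.contw).mul h.contw)
    have i2 : Integrable (fun x => Φ (w (t₂, x)) * ψ (t₂, x)) :=
      hcE t₂ m2 _ (c1 t₂) (fun z hz => by simp [hψK (t₂, z.2) hz])
    have i1 : ∀ s, Integrable (fun x => Φ (w (t₁, x)) * ψ (s, x)) := fun s =>
      hcE t₁ m1 _ (c1 s) (fun z hz => by simp [hψK (s, z.2) hz])
    have i3 : Integrable (fun x => (w (t₂, x) - w (t₁, x)) * (Φ1 (w (t₂, x)) * ψ (t₂, x))) := by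
      refine Continuous.integrable_of_hasCompactSupport ?_
        (HasCompactSupport.intro hK fun x hx => by simp [hψK (t₂, x) hx])
      have a1 : Continuous (fun x => w (t₂, x) * (Φ1 (w (t₂, x)) * ψ (t₂, x))) := by
        refine (c3.comp_continuous (f := fun x : EE d => (t₂, x)) (by fun_prop)
          (fun x => ⟨m2, mem_univ _⟩)).congr fun x => by simp; ring
      have a2 : Continuous (fun x => w (t₁, x) * (Φ1 (w (t₂, x)) * ψ (t₂, x))) := by
        have := hwψ (fun z => Φ1 (w (t₂, z.2)) * ψ (t₂, z.2)) (by
          have : Continuous (fun x => Φ1 (w (t₂, x)) * ψ (t₂, x)) := hθ.continuous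
          exact this.comp continuous_snd) (fun z hz => by simp [hψK (t₂, z.2) hz])
          w h.contw
        exact this.comp_continuous (f := fun x : EE d => (t₁, x)) (by fun_prop)
          (fun x => ⟨m1, mem_univ _⟩)
      refine (a1.sub a2).congr fun x => by simp; ring
    have i4 : Integrable (fun x => Φ (w (t₁, x)) * (ψ (t₂, x) - ψ (t₁, x))) := by
      refine ((i1 t₂).sub (i1 t₁)).congr (Eventually.of_forall fun x => by simp; ring)
    have hstep1 : E t₂ - E t₁ ≤ (∫ x, (w (t₂, x) - w (t₁, x)) * (Φ1 (w (t₂, x)) * ψ (t₂, x))) +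
        ∫ x, Φ (w (t₁, x)) * (ψ (t₂, x) - ψ (t₁, x)) := by
      simp only [hE]
      rw [← integral_sub i2 (i1 t₁), ← integral_add i3 i4]
      refine integral_mono (i2.sub (i1 t₁)) (i3.add i4) fun x => ?_
      have hcv : Φ (w (t₂, x)) - Φ (w (t₁, x)) ≤ Φ1 (w (t₂, x)) * (w (t₂, x) - w (t₁, x)) := by
        have hconv : ConvexOn ℝ univ Φ := by
          have hmono : Monotone Φ1 := monotone_of_deriv_nonneg
            (fun s => (h1 s).differentiableAt) (fun s => by rw [(h1 s).deriv]; exact h2' s)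
          refine Monotone.convexOn_univ_of_deriv (fun s => (h0 s).differentiableAt) ?_
          rw [show deriv Φ = Φ1 from funext fun s => (h0 s).deriv]
          exact hmono
        rcases lt_trichotomy (w (t₁, x)) (w (t₂, x)) with hlt | heq | hgt
        · have := hconv.slope_le_of_hasDerivAt (mem_univ (w (t₁, x))) (mem_univ (w (t₂, x))) hlt
            (h0 (w (t₂, x)))
          rw [slope_def_field, div_le_iff₀ (sub_pos.2 hlt)] at this
          exact this
        · rw [heq]; simp
        · have := hconv.le_slope_of_hasDerivAt (mem_univ (w (t₂, x))) (mem_univ (w (t₁, x))) hgt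
            (h0 (w (t₂, x)))
          rw [slope_def_field, le_div_iff₀ (sub_pos.2 hgt)] at this
          linarith
      have := mul_le_mul_of_nonneg_right hcv (hψ0 (t₂, x))
      linarith
    have hstep2 : ∫ x, Φ (w (t₁, x)) * (ψ (t₂, x) - ψ (t₁, x)) =
        ∫ z in Ioc t₁ t₂ ×ˢ K, Φ (w (t₁, z.2)) * fderiv ℝ ψ z (1, 0) := by
      have h_integ : IntegrableOn (fun z : ℝ × EE d => Φ (w (t₁, z.2)) * fderiv ℝ ψ z (1, 0))
          (Icc T₀ τ ×ˢ K) := by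
        refine ContinuousOn.integrableOn_compact hQ (ContinuousOn.mul ?_ hDc.continuousOn)
        exact hΦw.comp (f := fun z : ℝ × EE d => (t₁, z.2)) (by fun_prop)
          (fun z hz => ⟨m1, hz.2⟩)
      have h_integ' := h_integ.mono_set hsub
      rw [IntegrableOn, Measure.volume_eq_prod, ← Measure.prod_restrict] at h_integ'
      rw [Measure.volume_eq_prod, ← Measure.prod_restrict, integral_prod_symm _ h_integ']
      rw [← setIntegral_eq_integral_of_forall_compl_eq_zero (s := K) (fun x hx => by
        simp [hψK (t₂, x) hx, hψK (t₁, x) hx])]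
      refine integral_congr_ae (Eventually.of_forall fun x => ?_)
      simp only
      rw [integral_const_mul, ← intervalIntegral.integral_of_le ht.le]
      congr 1
      refine (intervalIntegral.integral_eq_sub_of_hasDerivAt
        (f := fun s => ψ (s, x)) (f' := fun s => fderiv ℝ ψ (s, x) (1, 0)) ?_ ?_).symm
      · intro s _
        have := ((hψ.differentiable one_ne_zero) (s, x)).hasFDerivAt.comp_hasDerivAt s
          ((hasDerivAt_id s).prodMk (hasDerivAt_const s x))
        simpa [Function.comp_def] using this
      · exact (hDc.comp (by fun_prop : Continuous fun s : ℝ => (s, x))).intervalIntegrable _ _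
    rw [hsl, hstep2] at hstep1
    refine hstep1.trans ?_
    have iA : IntegrableOn (fun z : ℝ × EE d => Lfun w P Φ1 Φ2 ψ (t₂, z.2) (F z))
        (Ioc t₁ t₂ ×ˢ K) := by
      have hFI' := hFI.mono_set hsub
      obtain ⟨C, hC⟩ := hQ.exists_bound_of_continuousOn hLcK
      have hcc : Continuous (fun z : ℝ × EE d => Lfun w P Φ1 Φ2 ψ (t₂, z.2)) :=
        hLc.comp_continuous (f := fun z : ℝ × EE d => (t₂, z.2)) (by fun_prop)
        (fun x => ⟨m2, mem_univ _⟩)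
      refine Integrable.mono' (hFI'.norm.const_mul C) ?_ ?_
      · have : Continuous (fun p : (EE d →L[ℝ] ℝ) × EE d => p.1 p.2) := by fun_prop
        exact this.comp_aestronglyMeasurable
          (hcc.aestronglyMeasurable.prodMk hFI'.aestronglyMeasurable)
      · refine (ae_restrict_iff' hmeas).2 (Eventually.of_forall fun z hz => ?_)
        refine (ContinuousLinearMap.le_opNorm _ _).trans ?_
        gcongr
        exact hC _ ⟨m2, hz.2⟩
    have iB : IntegrableOn (fun z : ℝ × EE d => Φ (w (t₁, z.2)) * fderiv ℝ ψ z (1, 0))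
          (Ioc t₁ t₂ ×ˢ K) := by
      refine IntegrableOn.mono_set ?_ hsub
      refine ContinuousOn.integrableOn_compact hQ (ContinuousOn.mul ?_ hDc.continuousOn)
      exact hΦw.comp (f := fun z : ℝ × EE d => (t₁, z.2)) (by fun_prop)
          (fun z hz => ⟨m1, hz.2⟩)
    have iA2 : IntegrableOn (fun z : ℝ × EE d => -Lfun w P Φ1 Φ2 ψ (t₂, z.2) (F z))
        (Ioc t₁ t₂ ×ˢ K) := iA.neg
    rw [← integral_neg, ← integral_add iA2 iB, ← integral_const_mul,
      ← integral_add (hJI.mono_set hsub) ((hGI.mono_set hsub).const_mul ε)]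
    refine setIntegral_mono_on (iA2.add iB)
      ((hJI.mono_set hsub).add ((hGI.mono_set hsub).const_mul ε)) hmeas fun z hz => ?_
    have hzQ := hsub hz
    have d1 : dist (t₂, z.2) z < δ₁ := by
      rw [Prod.dist_eq]; simp only [dist_self, Real.dist_eq]
      rw [max_eq_left (abs_nonneg _), abs_of_nonneg (by linarith [hz.1.2])]
      linarith [hz.1.1, min_le_left δ₁ δ₂]
    have d2 : dist (t₁, z.2) z < δ₂ := by
      rw [Prod.dist_eq]; simp only [dist_self, Real.dist_eq]
      rw [max_eq_left (abs_nonneg _), abs_of_nonpos (by linarith [hz.1.1])]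
      linarith [hz.1.2, min_le_right δ₁ δ₂]
    have e1 := hu₁ (t₂, z.2) ⟨m2, hz.2⟩ z hzQ d1
    have e2 := hu₂ (t₁, z.2) ⟨m1, hz.2⟩ z hzQ d2
    rw [dist_eq_norm] at e1
    rw [Real.dist_eq] at e2
    have b1 : |Lfun w P Φ1 Φ2 ψ (t₂, z.2) (F z) - Lfun w P Φ1 Φ2 ψ z (F z)| ≤ ε * ‖F z‖ := by
      rw [← _root_.sub_apply, ← Real.norm_eq_abs]
      refine (ContinuousLinearMap.le_opNorm _ _).trans ?_
      gcongr
    have b2 : |(Φ (w (t₁, z.2)) - Φ (w z)) * fderiv ℝ ψ z (1, 0)| ≤ ε * |Cψ| := by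
      rw [abs_mul]
      refine mul_le_mul e2.le ((hCψ z hzQ).trans (le_abs_self _)) (abs_nonneg _) hε.le
    simp only [hJ, hG, Pi.add_apply, Pi.neg_apply]
    rw [abs_le] at b1 b2
    nlinarith [b1.1, b1.2, b2.1, b2.2]
  refine le_of_forall_pos_le_add fun ε' hε' => ?_
  set IG := ∫ z in Ioc T₀ τ ×ˢ K, G z with hIG
  have hIG0 : 0 ≤ IG := integral_nonneg fun z => by simp only [hG]; positivity
  set ε := ε' / (IG + 1) with hεd
  have hε : 0 < ε := by positivity
  obtain ⟨δ, hδ, hst⟩ := hstep ε hε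
  have hfin := anti_of_local (fun t => E t - (∫ z in Ioc T₀ t ×ˢ K, J z) -
    ε * ∫ z in Ioc T₀ t ×ˢ K, G z) T₀ τ hTτ δ hδ (by
      intro t₁ t₂ ht₁ ht ht₂ hd
      have := hst t₁ t₂ ht₁ ht ht₂ hd
      have hsplit : ∀ g : ℝ × EE d → ℝ, IntegrableOn g (Icc T₀ τ ×ˢ K) →
          ∫ z in Ioc T₀ t₂ ×ˢ K, g z = (∫ z in Ioc T₀ t₁ ×ˢ K, g z) +
            ∫ z in Ioc t₁ t₂ ×ˢ K, g z := by
        intro g hg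
        rw [← Ioc_union_Ioc_eq_Ioc ht₁ ht.le, union_prod]
        refine setIntegral_union ?_ (measurableSet_Ioc.prod hK.measurableSet)
          (hg.mono_set ?_) (hg.mono_set ?_)
        · exact Disjoint.set_prod_left (Ioc_disjoint_Ioc_of_le le_rfl) _ _
        · exact prod_mono_left fun s hs => ⟨hs.1.le, by linarith [hs.2]⟩
        · exact prod_mono_left fun s hs => ⟨by linarith [hs.1], by linarith [hs.2]⟩
      simp only [hsplit J hJI, hsplit G hGI]
      linarith)
  simp only [Ioc_self, empty_prod, Measure.restrict_empty, integral_zero_measure] at hfin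
  have : ε * IG ≤ ε' := by
    rw [hεd, div_mul_eq_mul_div, div_le_iff₀ (by positivity)]
    nlinarith
  linarith
end
end

noncomputable section

/-- weak solutions with the structure bounds. -/
structure Core {d : ℕ} (ν G : ℝ) (U : Set (ℝ × EE d)) (w : ℝ × EE d → ℝ)
    (P F : ℝ × EE d → EE d) : Prop where
  sol : WSol U w P F
  Fb : ∀ z ∈ U, ‖F z‖ ≤ ν⁻¹ * ‖P z‖ + G
  ell : ∀ z ∈ U, ν * ‖P z‖ ^ 2 - G * ‖P z‖ ≤ inner ℝ (P z) (F z)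

def C0 (D c : ℝ) : ℝ := 2 + 4 * D * c + 16 * D ^ 2 * c ^ 2

lemma pointwise_energy {p m D c ν G s b ζ A X S f2 e dt Dx Fn : ℝ} (hp : 1 ≤ p) (hm : 1 ≤ m)
    (hmD : m ≤ D * p) (hD : 1 ≤ D) (hc : 1 ≤ c) (hν : 0 < ν) (hν1 : ν ≤ 1) (hG : 0 < G)
    (hb : 0 ≤ b) (hζ : 0 ≤ ζ) (hζ1 : ζ ≤ 1) (hA : 0 ≤ A) (hX : 0 ≤ X) (hS : S = s ^ 2 + G ^ 2)
    (hf2 : 2 * p * X ≤ f2) (hf2' : f2 ≤ 4 * p ^ 2 * X) (he : ν * b ^ 2 - G * b ≤ e)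
    (hdt : |dt| ≤ 2 * m * c * A * ζ) (hF : Fn ≤ ν⁻¹ * b + G)
    (hDx : |Dx| ≤ 2 * m * c * A * ζ * Fn) :
    X * S * dt - (A * ζ ^ 2 * f2 * e + 2 * p * s * X * Dx) ≤
      - (3 / 4) * p * ν * (X * b ^ 2 * (A * ζ ^ 2)) + C0 D c * ν⁻¹ ^ 3 * p ^ 3 * (X * S * A) := by
  have hS0 : 0 ≤ S := by rw [hS]; positivity
  set n := ν⁻¹ with hn
  have hn1 : 1 ≤ n := (one_le_inv₀ hν).2 hν1
  have hnν : n * ν = 1 := inv_mul_cancel₀ hν.ne'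
  have hm0 : 0 ≤ m := by linarith
  -- ellipticity
  have t1 : ν / 2 * b ^ 2 - n / 2 * G ^ 2 ≤ e := by
    have : 0 ≤ n / 2 * (ν * b - G) ^ 2 := by positivity
    have e1 : n / 2 * (ν * b - G) ^ 2 = ν / 2 * b ^ 2 - G * b + n / 2 * G ^ 2 := by
      have : n / 2 * (ν * b - G) ^ 2 =
        (n * ν) * ν / 2 * b ^ 2 - (n * ν) * (G * b) + n / 2 * G ^ 2 := by ring
      rw [this, hnν]; ring
    linarith
  have hAζ : 0 ≤ A * ζ ^ 2 := by positivity
  have hf20 : 0 ≤ f2 := le_trans (by positivity) hf2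
  have t2 : A * ζ ^ 2 * (p * ν * X * b ^ 2) - A * (2 * p ^ 2 * n * (X * S)) ≤
      A * ζ ^ 2 * f2 * e := by
    have q1 : A * ζ ^ 2 * f2 * (ν / 2 * b ^ 2 - n / 2 * G ^ 2) ≤ A * ζ ^ 2 * f2 * e :=
      mul_le_mul_of_nonneg_left t1 (by positivity)
    have q2 : A * ζ ^ 2 * (p * ν * X * b ^ 2) ≤ A * ζ ^ 2 * (f2 * (ν / 2 * b ^ 2)) := by
      have : 0 ≤ ν / 2 * b ^ 2 := by positivity
      have := mul_le_mul_of_nonneg_right hf2 this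
      refine mul_le_mul_of_nonneg_left ?_ hAζ
      linarith
    have q3 : A * ζ ^ 2 * (f2 * (n / 2 * G ^ 2)) ≤ A * (2 * p ^ 2 * n * (X * S)) := by
      have r1 : f2 * (n / 2 * G ^ 2) ≤ 4 * p ^ 2 * X * (n / 2 * S) := by
        refine mul_le_mul hf2' ?_ (by positivity) (by positivity)
        rw [hS]
        have : 0 ≤ s ^ 2 := sq_nonneg s
        gcongr; linarith
      have r2 : A * ζ ^ 2 ≤ A := by
        refine mul_le_of_le_one_right hA (pow_le_one₀ hζ hζ1)
      calc _ ≤ A * (4 * p ^ 2 * X * (n / 2 * S)) := mul_le_mul r2 r1 (by positivity) hA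
        _ = _ := by ring
    linarith
  -- time derivative
  have hAζ1 : A * ζ ≤ A := mul_le_of_le_one_right hA hζ1
  have t3 : X * S * dt ≤ 2 * m * c * (X * S * A) := by
    have : dt ≤ 2 * m * c * A := by
      refine (le_abs_self _).trans (hdt.trans ?_)
      have : 0 ≤ 2 * m * c := by positivity
      nlinarith
    have := mul_le_mul_of_nonneg_left this (mul_nonneg hX hS0)
    linarith
  -- cross term
  have t4 : - (2 * p * s * X * Dx) ≤ X * A * (p * ν / 4 * b ^ 2 * ζ ^ 2 +
      16 * p * m ^ 2 * c ^ 2 * n ^ 3 * S) + 2 * p * m * c * (X * S * A) := by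
    have q1 : - (2 * p * s * X * Dx) ≤ 2 * p * |s| * X * (2 * m * c * A * ζ * (n * b + G)) := by
      have : |2 * p * s * X * Dx| ≤ 2 * p * |s| * X * (2 * m * c * A * ζ * (n * b + G)) := by
        rw [abs_mul, abs_mul, abs_mul, abs_mul, abs_of_nonneg hX, abs_of_nonneg (by linarith : 0 ≤ p),
          abs_of_pos (by norm_num : (0:ℝ) < 2)]
        refine mul_le_mul_of_nonneg_left (hDx.trans ?_) (by positivity)
        exact mul_le_mul_of_nonneg_left hF (by positivity)
      exact (neg_le_abs _).trans this
    have q2 : 4 * p * m * c * n * |s| * b * ζ ≤ p * ν / 4 * b ^ 2 * ζ ^ 2 +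
      16 * p * m ^ 2 * c ^ 2 * n ^ 3 * s ^ 2 := by
      have : 0 ≤ p * ν * (b * ζ / 2 - 4 * m * c * n ^ 2 * |s|) ^ 2 := by positivity
      have e1 : p * ν * (b * ζ / 2 - 4 * m * c * n ^ 2 * |s|) ^ 2 = p * ν / 4 * b ^ 2 * ζ ^ 2
        - (n * ν) * (4 * p * m * c * n * |s| * b * ζ) + (n * ν) *
          (16 * p * m ^ 2 * c ^ 2 * n ^ 3 * |s| ^ 2) := by ring
      rw [e1, hnν, sq_abs] at this
      linarith
    have q3 : |s| * G ≤ S / 2 := by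
      have := sq_nonneg (|s| - G)
      rw [sub_sq, sq_abs] at this
      rw [hS]; linarith
    have hsS : s ^ 2 ≤ S := by rw [hS]; nlinarith [sq_nonneg G]
    have q4 : 4 * p * m * c * n * |s| * b * ζ ≤ p * ν / 4 * b ^ 2 * ζ ^ 2 +
      16 * p * m ^ 2 * c ^ 2 * n ^ 3 * S := by
      refine q2.trans ?_
      have : 16 * p * m ^ 2 * c ^ 2 * n ^ 3 * s ^ 2 ≤ 16 * p * m ^ 2 * c ^ 2 * n ^ 3 * S := by
        gcongr
      linarith
    have q5 := mul_le_mul_of_nonneg_left q4 (mul_nonneg hX hA)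
    have q6 : 4 * p * m * c * X * (A * ζ) * (|s| * G) ≤ 4 * p * m * c * X * A * (S / 2) := by
      have : 0 ≤ 4 * p * m * c * X := by positivity
      refine mul_le_mul (mul_le_mul_of_nonneg_left hAζ1 this) q3 (by positivity) (by positivity)
    refine q1.trans ?_
    have e2 : 2 * p * |s| * X * (2 * m * c * A * ζ * (n * b + G)) =
      X * A * (4 * p * m * c * n * |s| * b * ζ) + 4 * p * m * c * X * (A * ζ) * (|s| * G) := by ring
    rw [e2]
    linarith
  -- constants
  have t5 : 2 * m * c + 2 * p ^ 2 * n + 2 * p * m * c + 16 * p * m ^ 2 * c ^ 2 * n ^ 3 ≤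
      C0 D c * n ^ 3 * p ^ 3 := by
    have hDp : 0 ≤ D * p := by positivity
    have n3 : 1 ≤ n ^ 3 := one_le_pow₀ hn1
    have n3' : n ≤ n ^ 3 := le_self_pow₀ hn1 (by norm_num)
    have p3 : p ^ 2 ≤ p ^ 3 := pow_le_pow_right₀ hp (by norm_num)
    have p1 : p ≤ p ^ 3 := le_self_pow₀ hp (by norm_num)
    have c0 : 0 ≤ c := by linarith
    have u1 : 2 * m * c ≤ 2 * D * c * n ^ 3 * p ^ 3 := by
      calc 2 * m * c ≤ 2 * (D * p) * c := by gcongr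
        _ ≤ 2 * (D * p ^ 3) * c := by gcongr
        _ ≤ 2 * (D * p ^ 3) * c * n ^ 3 := le_mul_of_one_le_right (by positivity) n3
        _ = _ := by ring
    have u2 : 2 * p ^ 2 * n ≤ 2 * n ^ 3 * p ^ 3 := by
      calc 2 * p ^ 2 * n ≤ 2 * p ^ 3 * n ^ 3 := by gcongr
        _ = _ := by ring
    have u3 : 2 * p * m * c ≤ 2 * D * c * n ^ 3 * p ^ 3 := by
      calc 2 * p * m * c ≤ 2 * p * (D * p) * c := by gcongr
        _ = 2 * (D * p ^ 2) * c := by ring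
        _ ≤ 2 * (D * p ^ 3) * c := by gcongr
        _ ≤ 2 * (D * p ^ 3) * c * n ^ 3 := le_mul_of_one_le_right (by positivity) n3
        _ = _ := by ring
    have u4 : 16 * p * m ^ 2 * c ^ 2 * n ^ 3 ≤ 16 * D ^ 2 * c ^ 2 * n ^ 3 * p ^ 3 := by
      calc 16 * p * m ^ 2 * c ^ 2 * n ^ 3 ≤ 16 * p * (D * p) ^ 2 * c ^ 2 * n ^ 3 := by gcongr
        _ = _ := by ring
    unfold C0
    linarith
  have t6 := mul_le_mul_of_nonneg_right t5 (mul_nonneg (mul_nonneg hX hS0) hA)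
  linarith

section
variable {G p : ℝ}

def Phi (G p : ℝ) (s : ℝ) : ℝ := (s ^ 2 + G ^ 2) ^ p
def Phi1 (G p : ℝ) (s : ℝ) : ℝ := 2 * p * s * (s ^ 2 + G ^ 2) ^ (p - 1)
def Phi2 (G p : ℝ) (s : ℝ) : ℝ := 2 * p * (s ^ 2 + G ^ 2) ^ (p - 1) +
  4 * p * (p - 1) * s ^ 2 * (s ^ 2 + G ^ 2) ^ (p - 2)

lemma SG_pos (hG : 0 < G) (s : ℝ) : 0 < s ^ 2 + G ^ 2 := by positivity

lemma SG_deriv (hG : 0 < G) (r s : ℝ) : HasDerivAt (fun s => (s ^ 2 + G ^ 2) ^ r)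
    (2 * r * s * (s ^ 2 + G ^ 2) ^ (r - 1)) s := by
  have h1 : HasDerivAt (fun s : ℝ => s ^ 2 + G ^ 2) (2 * s) s := by
    simpa using (hasDerivAt_pow 2 s).add_const (G ^ 2)
  refine (h1.rpow_const (p := r) (Or.inl (SG_pos hG s).ne')).congr_deriv ?_
  ring

lemma Phi_deriv (hG : 0 < G) (s : ℝ) : HasDerivAt (Phi G p) (Phi1 G p s) s := SG_deriv hG p s

lemma Phi1_deriv (hG : 0 < G) (s : ℝ) : HasDerivAt (Phi1 G p) (Phi2 G p s) s := by
  have h1 : HasDerivAt (fun s : ℝ => 2 * p * s) (2 * p) s := by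
    simpa using (hasDerivAt_id s).const_mul (2 * p)
  refine (h1.mul (SG_deriv hG (p - 1) s)).congr_deriv ?_
  unfold Phi2
  rw [show p - 1 - 1 = p - 2 by ring]
  ring

lemma Phi2_cont (hG : 0 < G) : Continuous (Phi2 G p) := by
  have h1 : ∀ r : ℝ, Continuous (fun s : ℝ => (s ^ 2 + G ^ 2) ^ r) := fun r =>
    continuous_iff_continuousAt.2 fun s => (SG_deriv hG r s).continuousAt
  unfold Phi2
  have := h1 (p - 1)
  have := h1 (p - 2)
  fun_prop

lemma Phi2_lb (hG : 0 < G) (hp : 1 ≤ p) (s : ℝ) :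
    2 * p * (s ^ 2 + G ^ 2) ^ (p - 1) ≤ Phi2 G p s := by
  unfold Phi2
  have := (Real.rpow_pos_of_pos (SG_pos hG s) (p - 2)).le
  have hp' : 0 ≤ p - 1 := by linarith
  have : 0 ≤ 4 * p * (p - 1) * s ^ 2 * (s ^ 2 + G ^ 2) ^ (p - 2) := by positivity
  linarith

lemma Phi2_ub (hG : 0 < G) (hp : 1 ≤ p) (s : ℝ) :
    Phi2 G p s ≤ 4 * p ^ 2 * (s ^ 2 + G ^ 2) ^ (p - 1) := by
  unfold Phi2
  have h0 := (Real.rpow_pos_of_pos (SG_pos hG s) (p - 2)).le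
  have h1 := (Real.rpow_pos_of_pos (SG_pos hG s) (p - 1)).le
  have hp' : 0 ≤ p - 1 := by linarith
  have e : (s ^ 2 + G ^ 2) * (s ^ 2 + G ^ 2) ^ (p - 2) = (s ^ 2 + G ^ 2) ^ (p - 1) := by
    have := Real.rpow_add (SG_pos hG s) 1 (p - 2)
    rw [Real.rpow_one] at this
    rw [← this]; congr 1; ring
  have h2 : s ^ 2 * (s ^ 2 + G ^ 2) ^ (p - 2) ≤ (s ^ 2 + G ^ 2) ^ (p - 1) := by
    rw [← e]
    gcongr
    nlinarith [sq_nonneg G]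
  have h3 := mul_le_mul_of_nonneg_left h2 (by positivity : 0 ≤ 4 * p * (p - 1))
  nlinarith
end
end

noncomputable section

structure Cutoff {d : ℕ} (R c : ℝ) (ζ : ℝ × EE d → ℝ) : Prop where
  smooth : ContDiff ℝ 1 ζ
  nonneg : ∀ z, 0 ≤ ζ z
  le_one : ∀ z, ζ z ≤ 1
  bd : ∀ z, ‖fderiv ℝ ζ z‖ ≤ c
  off : ∀ z, z.2 ∉ closedBall (0 : EE d) R → ζ z = 0
  h_init : ∀ x, ζ (-R, x) = 0

def Sf {d : ℕ} (G : ℝ) (w : ℝ × EE d → ℝ) (z : ℝ × EE d) : ℝ := w z ^ 2 + G ^ 2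

def Box (d : ℕ) (R : ℝ) : Set (ℝ × EE d) := Icc (-R) 0 ×ˢ closedBall (0 : EE d) R

section
variable {d : ℕ} {U : Set (ℝ × EE d)} {w : ℝ × EE d → ℝ} {P F : ℝ × EE d → EE d}
  {ν G R c : ℝ} {ζ : ℝ × EE d → ℝ}

lemma Sf_pos (hG : 0 < G) (z : ℝ × EE d) : 0 < Sf G w z := by unfold Sf; positivity

lemma Sf_cont (hw : ContinuousOn w U) (hG : 0 < G) (r : ℝ) :
    ContinuousOn (fun z => Sf G w z ^ r) U := by
  refine ContinuousOn.rpow_const ?_ fun z _ => Or.inl (Sf_pos hG z).ne'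
  unfold Sf
  fun_prop

lemma Cutoff.cont_rpow (hζ : Cutoff R c ζ) {r : ℝ} (hr : 0 ≤ r) :
    Continuous (fun z => ζ z ^ r) :=
  hζ.smooth.continuous.rpow_const fun _ => Or.inr hr

lemma isCompact_Box (R : ℝ) : IsCompact (Box d R) := isCompact_Icc.prod (isCompact_closedBall _ _)

lemma Core.energy_p (h : Core ν G U w P F) (hζ : Cutoff R c ζ) (hR : 0 < R) (hBox : Box d R ⊆ U)
    (hν : 0 < ν) (hν1 : ν ≤ 1) (hG : 0 < G) {p m D : ℝ} (hp : 1 ≤ p) (hm : 1 ≤ m)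
    (hmD : m ≤ D * p) (hD : 1 ≤ D) (hc : 1 ≤ c) {τ : ℝ} (hτ : τ ∈ Icc (-R) 0) :
    (∫ x, Sf G w (τ, x) ^ p * ζ (τ, x) ^ (2 * m)) + 3 / 4 * p * ν *
      (∫ z in Ioc (-R) τ ×ˢ closedBall (0 : EE d) R, Sf G w z ^ (p - 1) * ‖P z‖ ^ 2 * ζ z ^ (2 * m))
      ≤ C0 D c * ν⁻¹ ^ 3 * p ^ 3 *
        ∫ z in Ioc (-R) τ ×ˢ closedBall (0 : EE d) R, Sf G w z ^ p * ζ z ^ (2 * m - 2) := by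
  have hK := isCompact_closedBall (0 : EE d) R
  have hsub : Icc (-R) τ ×ˢ closedBall (0 : EE d) R ⊆ U :=
    (prod_mono_left (Icc_subset_Icc_right hτ.2)).trans hBox
  have hQ : IsCompact (Icc (-R) τ ×ˢ closedBall (0 : EE d) R) := isCompact_Icc.prod hK
  have hIoc : Ioc (-R) τ ×ˢ closedBall (0 : EE d) R ⊆ Icc (-R) τ ×ˢ closedBall (0 : EE d) R :=
    prod_mono_left Ioc_subset_Icc_self
  have h2m : (1:ℝ) ≤ 2 * m := by linarith
  set ψ : ℝ × EE d → ℝ := fun z => ζ z ^ (2 * m) with hψ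
  have hψs : ContDiff ℝ 1 ψ := by
    have := hζ.smooth.rpow_const_of_le (m := 1) (p := 2 * m) (by simpa using h2m)
    exact_mod_cast this
  have hψ0 : ∀ z, 0 ≤ ψ z := fun z => Real.rpow_nonneg (hζ.nonneg z) _
  have hψK : ∀ z : ℝ × EE d, z.2 ∉ closedBall (0 : EE d) R → ψ z = 0 := fun z hz => by
    simp only [hψ]
    rw [hζ.off z hz, Real.zero_rpow (by linarith)]
  have hψd : ∀ z, fderiv ℝ ψ z = (2 * m * (ζ z ^ (2 * m - 2) * ζ z)) • fderiv ℝ ζ z := by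
    intro z
    have := ((hζ.smooth.differentiable one_ne_zero) z).hasFDerivAt.rpow_const (p := 2 * m)
      (Or.inr h2m)
    rw [this.fderiv]
    congr 2
    rw [← Real.rpow_add_one' (hζ.nonneg z) (by linarith)]
    congr 1; ring
  have hζ2 : ∀ z, ζ z ^ (2 * m) = ζ z ^ (2 * m - 2) * ζ z ^ 2 := by
    intro z
    have := Real.rpow_add_natCast' (hζ.nonneg z) (y := 2 * m - 2) (n := 2) (by push_cast; linarith)
    rw [← this]; congr 1; push_cast; ring
  have hXS : ∀ z, Sf G w z ^ p = Sf G w z ^ (p - 1) * Sf G w z := by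
    intro z
    rw [← Real.rpow_add_one (Sf_pos hG z).ne']; congr 1; ring
  have hen := h.sol.energy hK hτ.1 hsub hψs hψ0 hψK (Phi_deriv (p := p) hG) (Phi1_deriv hG)
    (Phi2_cont hG) (fun s => le_trans (by
      have := (Real.rpow_pos_of_pos (SG_pos hG s) (p - 1)).le
      positivity) (Phi2_lb hG hp s))
  have hz0 : ∫ x, Phi G p (w (-R, x)) * ψ (-R, x) = 0 := by
    simp only [hψ, hζ.h_init]
    rw [Real.zero_rpow (by linarith)]; simp
  rw [hz0, sub_zero] at hen
  have hPhi1c : Continuous (Phi1 G p) :=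
    continuous_iff_continuousAt.2 fun s => (Phi1_deriv hG s).continuousAt
  have iL := h.sol.energy_integrable hK hsub hψs hψK hPhi1c (Phi2_cont (p := p) hG)
  have hDc : Continuous (fun z => fderiv ℝ ψ z (1, 0)) :=
    (hψs.continuous_fderiv one_ne_zero).clm_apply continuous_const
  have hwc := h.sol.contw.mono hsub
  have iT : IntegrableOn (fun z => Phi G p (w z) * fderiv ℝ ψ z (1, 0))
      (Icc (-R) τ ×ˢ closedBall (0 : EE d) R) := by
    refine ContinuousOn.integrableOn_compact hQ (ContinuousOn.mul ?_ hDc.continuousOn)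
    exact Sf_cont hwc hG p
  have iB : IntegrableOn (fun z => Sf G w z ^ (p - 1) * ‖P z‖ ^ 2 * ζ z ^ (2 * m))
      (Icc (-R) τ ×ˢ closedBall (0 : EE d) R) := by
    refine ContinuousOn.integrableOn_compact hQ (ContinuousOn.mul (ContinuousOn.mul ?_ ?_) ?_)
    · exact Sf_cont hwc hG _
    · exact (h.sol.contP.mono hsub).norm.pow 2
    · exact (hζ.cont_rpow (by linarith)).continuousOn
  have iS : IntegrableOn (fun z => Sf G w z ^ p * ζ z ^ (2 * m - 2))
      (Icc (-R) τ ×ˢ closedBall (0 : EE d) R) := by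
    refine ContinuousOn.integrableOn_compact hQ (ContinuousOn.mul ?_ ?_)
    · exact Sf_cont hwc hG _
    · exact (hζ.cont_rpow (by linarith)).continuousOn
  have hle : ∫ z in Ioc (-R) τ ×ˢ closedBall (0 : EE d) R,
      (Phi G p (w z) * fderiv ℝ ψ z (1, 0) - Lfun w P (Phi1 G p) (Phi2 G p) ψ z (F z)) ≤
      ∫ z in Ioc (-R) τ ×ˢ closedBall (0 : EE d) R,
        (- (3 / 4) * p * ν * (Sf G w z ^ (p - 1) * ‖P z‖ ^ 2 * ζ z ^ (2 * m)) +
          C0 D c * ν⁻¹ ^ 3 * p ^ 3 * (Sf G w z ^ p * ζ z ^ (2 * m - 2))) := by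
    refine setIntegral_mono_on ((iT.sub iL).mono_set hIoc)
      (((iB.mono_set hIoc).const_mul _).add ((iS.mono_set hIoc).const_mul _))
      (measurableSet_Ioc.prod hK.measurableSet) fun z hz => ?_
    have hzU := hsub (hIoc hz)
    have hA : 0 ≤ ζ z ^ (2 * m - 2) := Real.rpow_nonneg (hζ.nonneg z) _
    have hDn : ∀ v : ℝ × EE d, |fderiv ℝ ψ z v| ≤ 2 * m * c * ζ z ^ (2 * m - 2) * ζ z * ‖v‖ := by
      intro v
      rw [hψd z, _root_.smul_apply, smul_eq_mul, abs_mul,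
        abs_of_nonneg (mul_nonneg (by linarith) (mul_nonneg hA (hζ.nonneg z)))]
      have h1 : |fderiv ℝ ζ z v| ≤ c * ‖v‖ := by
        rw [← Real.norm_eq_abs]
        refine (ContinuousLinearMap.le_opNorm _ _).trans ?_
        gcongr
        exact hζ.bd z
      have := mul_le_mul_of_nonneg_left h1 (a := 2 * m * (ζ z ^ (2 * m - 2) * ζ z))
        (mul_nonneg (by linarith) (mul_nonneg hA (hζ.nonneg z)))
      linarith
    have hdt : |fderiv ℝ ψ z (1, 0)| ≤ 2 * m * c * ζ z ^ (2 * m - 2) * ζ z := by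
      have := hDn (1, 0)
      simpa using this
    have hDx : |fderiv ℝ ψ z (0, F z)| ≤ 2 * m * c * ζ z ^ (2 * m - 2) * ζ z * ‖F z‖ := by
      have := hDn (0, F z)
      simpa using this
    have key := pointwise_energy (s := w z) (S := Sf G w z) hp hm hmD hD hc hν hν1 hG
      (norm_nonneg (P z)) (hζ.nonneg z) (hζ.le_one z) hA
      (Real.rpow_nonneg (Sf_pos hG z).le (p - 1)) rfl
      (Phi2_lb hG hp (w z)) (Phi2_ub hG hp (w z)) (h.ell z hzU) hdt (h.Fb z hzU) hDx
    rw [hζ2 z, hXS z]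
    refine le_trans (le_of_eq ?_) key
    unfold Lfun Phi Phi1
    simp only [_root_.add_apply, _root_.smul_apply, smul_eq_mul,
      innerSL_apply_apply, ContinuousLinearMap.comp_apply, ContinuousLinearMap.inr_apply]
    have := hXS z
    unfold Sf at this
    rw [this]
    simp only [hψ, hζ2 z]
    unfold Sf
    ring
  have hfin := hen.trans hle
  rw [integral_add ((iB.mono_set hIoc).const_mul _) ((iS.mono_set hIoc).const_mul _),
    integral_const_mul, integral_const_mul] at hfin
  have : ∫ x, Phi G p (w (τ, x)) * ψ (τ, x) = ∫ x, Sf G w (τ, x) ^ p * ζ (τ, x) ^ (2 * m) := rfl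
  rw [this] at hfin
  linarith
end
end

noncomputable section

lemma exists_cutoff (d : ℕ) {r R : ℝ} (hr : 0 < r) (hrR : r < R) :
    ∃ c, 1 ≤ c ∧ ∃ ζ : ℝ × EE d → ℝ, Cutoff R c ζ ∧ ∀ z ∈ closedBall (0 : ℝ × EE d) r, ζ z = 1 := by
  let β : ContDiffBump (0 : ℝ × EE d) := ⟨r, R, hr, hrR⟩
  have hs : ContDiff ℝ 1 β := β.contDiff
  have hcs : HasCompactSupport (fderiv ℝ β) := β.hasCompactSupport.fderiv (𝕜 := ℝ)
  obtain ⟨c, hc⟩ := (hs.continuous_fderiv one_ne_zero).bounded_above_of_compact_support hcs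
  refine ⟨max c 1, le_max_right _ _, β, ⟨hs, fun z => β.nonneg, fun z => β.le_one,
    fun z => (hc z).trans (le_max_left _ _), ?_, ?_⟩, fun z hz => β.one_of_mem_closedBall hz⟩
  · intro z hz
    refine β.zero_of_le_dist ?_
    rw [mem_closedBall, not_le] at hz
    rw [Prod.dist_eq]
    exact hz.le.trans (le_max_right _ _)
  · intro x
    refine β.zero_of_le_dist ?_
    rw [Prod.dist_eq]
    refine le_trans ?_ (le_max_left _ _)
    simp [β, le_abs_self]

lemma setInt_Box {d : ℕ} {R : ℝ} (g : ℝ × EE d → ℝ) :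
    ∫ z in Ioc (-R) 0 ×ˢ closedBall (0 : EE d) R, g z = ∫ z in Box d R, g z := by
  refine setIntegral_congr_set ?_
  rw [Measure.volume_eq_prod]
  exact Measure.set_prod_ae_eq Ioc_ae_eq_Icc (ae_eq_refl _)

section
variable {d : ℕ}

lemma Box_mono {r R : ℝ} (h : r ≤ R) : Box d r ⊆ Box d R :=
  prod_mono (Icc_subset_Icc_left (by linarith)) (closedBall_subset_closedBall h)

lemma Box_sub_ball {r : ℝ} (hr : 0 ≤ r) : Box d r ⊆ closedBall (0 : ℝ × EE d) r := by
  intro z hz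
  rw [mem_closedBall, Prod.dist_eq]
  refine max_le ?_ hz.2
  rw [Real.dist_eq, abs_le]
  constructor
  · simpa using hz.1.1
  · simpa using hz.1.2.trans hr

lemma Core.energy_top {U : Set (ℝ × EE d)} {w : ℝ × EE d → ℝ} {P F : ℝ × EE d → EE d}
    {ν G R c : ℝ} {ζ : ℝ × EE d → ℝ} (h : Core ν G U w P F) (hζ : Cutoff R c ζ) (hR : 0 < R)
    (hBox : Box d R ⊆ U)
    (hν : 0 < ν) (hν1 : ν ≤ 1) (hG : 0 < G) {p m D : ℝ} (hp : 1 ≤ p) (hm : 1 ≤ m)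
    (hmD : m ≤ D * p) (hD : 1 ≤ D) (hc : 1 ≤ c) :
    (∀ τ ∈ Icc (-R) 0, (∫ x, Sf G w (τ, x) ^ p * ζ (τ, x) ^ (2 * m)) ≤ C0 D c * ν⁻¹ ^ 3 * p ^ 3 *
        ∫ z in Box d R, Sf G w z ^ p * ζ z ^ (2 * m - 2)) ∧
    3 / 4 * p * ν * (∫ z in Box d R, Sf G w z ^ (p - 1) * ‖P z‖ ^ 2 * ζ z ^ (2 * m))
      ≤ C0 D c * ν⁻¹ ^ 3 * p ^ 3 *
        ∫ z in Box d R, Sf G w z ^ p * ζ z ^ (2 * m - 2) := by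
  have hC : 0 ≤ C0 D c * ν⁻¹ ^ 3 * p ^ 3 := by unfold C0; positivity
  constructor
  · intro τ hτ
    have := h.energy_p hζ hR hBox hν hν1 hG hp hm hmD hD hc hτ
    have h1 : 0 ≤ 3 / 4 * p * ν * (∫ z in Ioc (-R) τ ×ˢ closedBall (0 : EE d) R,
        Sf G w z ^ (p - 1) * ‖P z‖ ^ 2 * ζ z ^ (2 * m)) := by
      refine mul_nonneg (by positivity) (integral_nonneg fun z => ?_)
      have := Real.rpow_nonneg (Sf_pos hG z (w := w)).le (p - 1)
      have := Real.rpow_nonneg (hζ.nonneg z) (2 * m)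
      positivity
    have h2 : ∫ z in Ioc (-R) τ ×ˢ closedBall (0 : EE d) R, Sf G w z ^ p * ζ z ^ (2 * m - 2) ≤
        ∫ z in Box d R, Sf G w z ^ p * ζ z ^ (2 * m - 2) := by
      refine setIntegral_mono_set ?_ (Eventually.of_forall fun z => ?_) (LE.le.eventuallyLE ?_)
      · refine ContinuousOn.integrableOn_compact (isCompact_Box R) (ContinuousOn.mul ?_ ?_)
        · exact Sf_cont (h.sol.contw.mono hBox) hG _
        · exact (hζ.cont_rpow (by linarith)).continuousOn
      · have := Real.rpow_nonneg (Sf_pos hG z (w := w)).le p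
        have := Real.rpow_nonneg (hζ.nonneg z) (2 * m - 2)
        simp only [Pi.zero_apply]
        positivity
      · exact prod_mono_left fun s hs => ⟨hs.1.le, hs.2.trans hτ.2⟩
    have := mul_le_mul_of_nonneg_left h2 hC
    linarith
  · have := h.energy_p hζ hR hBox hν hν1 hG hp hm hmD hD hc (τ := 0) ⟨by linarith, le_rfl⟩
    rw [setInt_Box, setInt_Box] at this
    have h1 : 0 ≤ ∫ x, Sf G w (0, x) ^ p * ζ (0, x) ^ (2 * m) := by
      refine integral_nonneg fun x => ?_
      have := Real.rpow_nonneg (Sf_pos hG (0, x) (w := w)).le p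
      have := Real.rpow_nonneg (hζ.nonneg (0, x)) (2 * m)
      simp only [Pi.zero_apply]
      positivity
    linarith

lemma caccioppoli (d : ℕ) {ν : ℝ} (hν : 0 < ν) (hν1 : ν ≤ 1) :
    ∃ C, 0 < C ∧ ∀ (U : Set (ℝ × EE d)) (w : ℝ × EE d → ℝ) (P F : ℝ × EE d → EE d) (G : ℝ),
      0 < G → Core ν G U w P F → Box d 2 ⊆ U →
      ∫ z in Box d (3 / 2), ‖P z‖ ^ 2 ≤ C * ∫ z in Box d 2, (w z ^ 2 + G ^ 2) := by
  obtain ⟨c, hc, ζ, hζ, hζ1⟩ := exists_cutoff d (r := 3 / 2) (R := 2) (by norm_num) (by norm_num)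
  have hC0 : 0 < C0 1 c := by unfold C0; positivity
  refine ⟨4 / 3 * ν⁻¹ * (C0 1 c * ν⁻¹ ^ 3), by positivity, fun U w P F G hG h hBox => ?_⟩
  have h1 := (h.energy_top hζ (by norm_num) hBox hν hν1 hG (p := 1) (m := 1) (D := 1) le_rfl le_rfl
    (by norm_num) le_rfl hc).2
  have h2 : ∫ z in Box d (3 / 2), ‖P z‖ ^ 2 ≤
      ∫ z in Box d 2, Sf G w z ^ ((1:ℝ) - 1) * ‖P z‖ ^ 2 * ζ z ^ (2 * (1:ℝ)) := by
    calc ∫ z in Box d (3 / 2), ‖P z‖ ^ 2 =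
        ∫ z in Box d (3 / 2), Sf G w z ^ ((1:ℝ) - 1) * ‖P z‖ ^ 2 * ζ z ^ (2 * (1:ℝ)) := by
          refine setIntegral_congr_fun (isCompact_Box _).measurableSet fun z hz => ?_
          rw [hζ1 z (Box_sub_ball (by norm_num) hz)]
          simp
      _ ≤ _ := by
        refine setIntegral_mono_set ?_ (Eventually.of_forall fun z => ?_)
          (LE.le.eventuallyLE (Box_mono (by norm_num)))
        · refine ContinuousOn.integrableOn_compact (isCompact_Box 2)
            (ContinuousOn.mul (ContinuousOn.mul ?_ ?_) ?_)
          · exact Sf_cont (h.sol.contw.mono hBox) hG _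
          · exact (h.sol.contP.mono hBox).norm.pow 2
          · exact (hζ.cont_rpow (by linarith)).continuousOn
        · have := Real.rpow_nonneg (Sf_pos hG z (w := w)).le ((1:ℝ) - 1)
          have := Real.rpow_nonneg (hζ.nonneg z) (2 * (1:ℝ))
          simp only [Pi.zero_apply]
          positivity
  have h3 : ∫ z in Box d 2, Sf G w z ^ (1:ℝ) * ζ z ^ (2 * (1:ℝ) - 2) =
      ∫ z in Box d 2, (w z ^ 2 + G ^ 2) := by
    refine integral_congr_ae (Eventually.of_forall fun z => ?_)
    simp [Sf]
  rw [h3] at h1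
  set I := ∫ z in Box d 2, (w z ^ 2 + G ^ 2)
  set B := ∫ z in Box d 2, Sf G w z ^ ((1:ℝ) - 1) * ‖P z‖ ^ 2 * ζ z ^ (2 * (1:ℝ))
  refine h2.trans ?_
  have h4 := mul_le_mul_of_nonneg_left h1 (by positivity : 0 ≤ 4 / 3 * ν⁻¹)
  have e : 4 / 3 * ν⁻¹ * (3 / 4 * 1 * ν * B) = B := by field_simp
  rw [e] at h4
  calc B ≤ _ := h4
    _ = _ := by ring

/-- Gagliardo-Nirenberg-Sobolev for real integrals. -/
lemma gns_real (d : ℕ) (hd : 2 ≤ d) : ∃ C, 1 ≤ C ∧ ∀ u : EE d → ℝ, ContDiff ℝ 1 u →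
    HasCompactSupport u → (∀ x, 0 ≤ u x) →
    ∫ x, u x ^ ((d:ℝ) / (d - 1)) ≤ C * (∫ x, ‖fderiv ℝ u x‖) ^ ((d:ℝ) / (d - 1)) := by
  have hd' : (2:ℝ) ≤ d := by exact_mod_cast hd
  set κ : ℝ := (d:ℝ) / (d - 1) with hκ
  have hκ0 : 0 < κ := div_pos (by linarith) (by linarith)
  have hconj : Real.HolderConjugate (Module.finrank ℝ (EE d)) κ := by
    rw [finrank_euclideanSpace_fin]
    rw [Real.holderConjugate_iff]
    refine ⟨by linarith, ?_⟩
    rw [hκ, inv_div]; field_simp; ring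
  set C := lintegralPowLePowLIntegralFDerivConst (volume : Measure (EE d)) κ with hC
  refine ⟨max C 1, le_max_right _ _, fun u hu hc h0 => ?_⟩
  have h1 := lintegral_pow_le_pow_lintegral_fderiv volume hu hc hconj
  have iD : Integrable (fun x => ‖fderiv ℝ u x‖) := by
    refine ((hu.continuous_fderiv one_ne_zero).norm).integrable_of_hasCompactSupport ?_
    exact (hc.fderiv (𝕜 := ℝ)).norm
  have iu : Integrable (fun x => u x ^ κ) := by
    refine (hu.continuous.rpow_const fun x => Or.inr hκ0.le).integrable_of_hasCompactSupport ?_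
    exact hc.comp_left (g := fun s : ℝ => s ^ κ) (Real.zero_rpow hκ0.ne')
  have e1 : ∫⁻ x, ‖u x‖ₑ ^ κ = ENNReal.ofReal (∫ x, u x ^ κ) := by
    rw [ofReal_integral_eq_lintegral_ofReal iu (Eventually.of_forall fun x =>
      Real.rpow_nonneg (h0 x) _)]
    refine lintegral_congr fun x => ?_
    rw [← ENNReal.ofReal_rpow_of_nonneg (h0 x) hκ0.le, Real.enorm_of_nonneg (h0 x)]
  have e2 : ∫⁻ x, ‖fderiv ℝ u x‖ₑ = ENNReal.ofReal (∫ x, ‖fderiv ℝ u x‖) := by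
    rw [ofReal_integral_eq_lintegral_ofReal iD (Eventually.of_forall fun x => norm_nonneg _)]
    refine lintegral_congr fun x => ?_
    rw [ofReal_norm]
  have hD0 : 0 ≤ ∫ x, ‖fderiv ℝ u x‖ := integral_nonneg fun x => norm_nonneg _
  rw [e1, e2, ENNReal.ofReal_rpow_of_nonneg hD0 hκ0.le] at h1
  have h2 : ENNReal.ofReal (∫ x, u x ^ κ) ≤ ENNReal.ofReal (C * (∫ x, ‖fderiv ℝ u x‖) ^ κ) := by
    rw [ENNReal.ofReal_mul (NNReal.coe_nonneg C), ENNReal.ofReal_coe_nnreal]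
    exact h1
  have h3 := (ENNReal.ofReal_le_ofReal_iff (mul_nonneg C.2 (Real.rpow_nonneg hD0 _))).1 h2
  refine h3.trans ?_
  exact mul_le_mul_of_nonneg_right (le_max_left _ _) (Real.rpow_nonneg hD0 _)
end
end

noncomputable section

section
variable {d : ℕ} {U : Set (ℝ × EE d)} {w : ℝ × EE d → ℝ} {P F : ℝ × EE d → EE d}
  {ν G R c : ℝ} {ζ : ℝ × EE d → ℝ}

lemma Cutoff.pow_smooth (hζ : Cutoff R c ζ) {m : ℝ} (hm : 1 ≤ m) :
    ContDiff ℝ 1 (fun z => ζ z ^ (2 * m)) := by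
  have := hζ.smooth.rpow_const_of_le (m := 1) (p := 2 * m) (by norm_num; linarith)
  exact_mod_cast this

lemma Cutoff.pow_fderiv (hζ : Cutoff R c ζ) {m : ℝ} (hm : 1 ≤ m) (z : ℝ × EE d) :
    fderiv ℝ (fun z => ζ z ^ (2 * m)) z = (2 * m * (ζ z ^ (2 * m - 2) * ζ z)) • fderiv ℝ ζ z := by
  have := ((hζ.smooth.differentiable one_ne_zero) z).hasFDerivAt.rpow_const (p := 2 * m)
    (Or.inr (by linarith))
  rw [this.fderiv]
  congr 2
  rw [← Real.rpow_add_one' (hζ.nonneg z) (by linarith)]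
  congr 1; ring

lemma Cutoff.pow_two (hζ : Cutoff R c ζ) {m : ℝ} (hm : 1 ≤ m) (z : ℝ × EE d) :
    ζ z ^ (2 * m) = ζ z ^ (2 * m - 2) * ζ z ^ 2 := by
  have := Real.rpow_add_natCast' (hζ.nonneg z) (y := 2 * m - 2) (n := 2) (by push_cast; linarith)
  rw [← this]; congr 1; push_cast; ring

lemma Sf_pow (hG : 0 < G) (p : ℝ) (z : ℝ × EE d) :
    Sf G w z ^ p = Sf G w z ^ (p - 1) * Sf G w z := by
  rw [← Real.rpow_add_one (Sf_pos hG z).ne']; congr 1; ring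

/-- the density that controls the gradient. -/
def Bf (G c p m : ℝ) (w : ℝ × EE d → ℝ) (P : ℝ × EE d → EE d) (ζ : ℝ × EE d → ℝ)
    (z : ℝ × EE d) : ℝ :=
  8 * p ^ 2 * (Sf G w z ^ (p - 1) * ‖P z‖ ^ 2 * ζ z ^ (2 * m)) +
    8 * m ^ 2 * c ^ 2 * (Sf G w z ^ p * ζ z ^ (2 * m - 2))

lemma grad_bound (hζ : Cutoff R c ζ) (hG : 0 < G) {p m μ : ℝ} (hp : 1 ≤ p) (hm : 1 ≤ m)
    (hc : 0 ≤ c) (hμ : 0 < μ) (z : ℝ × EE d) :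
    2 * ‖Lfun w P (Phi G p) (Phi1 G p) (fun z => ζ z ^ (2 * m)) z‖ ≤
      μ * (Sf G w z ^ p * ζ z ^ (2 * m)) + Bf G c p m w P ζ z / μ := by
  set X := Sf G w z ^ (p - 1) with hX
  set S := Sf G w z with hS
  set A := ζ z ^ (2 * m - 2) with hA
  have hX0 : 0 ≤ X := Real.rpow_nonneg (Sf_pos hG z).le _
  have hA0 : 0 ≤ A := Real.rpow_nonneg (hζ.nonneg z) _
  have hS0 : 0 ≤ S := (Sf_pos hG z).le
  have hz0 := hζ.nonneg z
  have hL : ‖Lfun w P (Phi G p) (Phi1 G p) (fun z => ζ z ^ (2 * m)) z‖ ≤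
      A * ζ z ^ 2 * (2 * p * |w z| * X) * ‖P z‖ + X * S * (2 * m * (A * ζ z) * c) := by
    unfold Lfun
    refine (norm_add_le _ _).trans (add_le_add ?_ ?_)
    · rw [norm_smul, innerSL_apply_norm]
      beta_reduce
      rw [hζ.pow_two hm]
      refine le_of_eq ?_
      congr 1
      unfold Phi1
      rw [Real.norm_eq_abs, abs_mul, abs_of_nonneg (by positivity), abs_mul, abs_mul, abs_mul,
        abs_of_nonneg (by linarith : 0 ≤ p), abs_of_pos (by norm_num : (0:ℝ) < 2)]
      congr 2
      exact abs_of_nonneg hX0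
    · rw [norm_smul, hζ.pow_fderiv hm]
      have e1 : Phi G p (w z) = X * S := Sf_pow hG p z
      rw [e1, Real.norm_eq_abs, abs_of_nonneg (mul_nonneg hX0 hS0)]
      refine mul_le_mul_of_nonneg_left ?_ (mul_nonneg hX0 hS0)
      refine (ContinuousLinearMap.opNorm_comp_le _ _).trans ?_
      refine (mul_le_of_le_one_right (norm_nonneg _) (ContinuousLinearMap.norm_inr_le_one ℝ ℝ (EE d))).trans ?_
      rw [norm_smul, Real.norm_eq_abs, abs_of_nonneg (by positivity)]
      exact mul_le_mul_of_nonneg_left (hζ.bd z) (by positivity)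
  have hwS : w z ^ 2 ≤ S := by rw [hS]; unfold Sf; nlinarith [sq_nonneg G]
  set b := ‖P z‖ with hb
  have q1 : 4 * p * |w z| * b ≤ μ / 2 * S + 8 * p ^ 2 * b ^ 2 / μ := by
    have h1 : 0 ≤ (μ * |w z| - 4 * p * b) ^ 2 / (2 * μ) := by positivity
    have h2 : (μ * |w z| - 4 * p * b) ^ 2 / (2 * μ) = μ / 2 * |w z| ^ 2 - 4 * p * |w z| * b +
      8 * p ^ 2 * b ^ 2 / μ := by field_simp; ring
    rw [h2, sq_abs] at h1
    have : μ / 2 * w z ^ 2 ≤ μ / 2 * S := by gcongr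
    linarith
  have q2 : 4 * m * c * ζ z ≤ μ / 2 * ζ z ^ 2 + 8 * m ^ 2 * c ^ 2 / μ := by
    have h1 : 0 ≤ (μ * ζ z - 4 * m * c) ^ 2 / (2 * μ) := by positivity
    have h2 : (μ * ζ z - 4 * m * c) ^ 2 / (2 * μ) = μ / 2 * ζ z ^ 2 - 4 * m * c * ζ z +
      8 * m ^ 2 * c ^ 2 / μ := by field_simp; ring
    rw [h2] at h1
    linarith
  have q1' := mul_le_mul_of_nonneg_left q1 (by positivity : 0 ≤ A * ζ z ^ 2 * X)
  have q2' := mul_le_mul_of_nonneg_left q2 (by positivity : 0 ≤ X * S * A)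
  unfold Bf
  rw [← hA, hζ.pow_two hm, Sf_pow hG p, ← hX, ← hS, ← hA]
  have e : (8 * p ^ 2 * (X * b ^ 2 * (A * ζ z ^ 2)) + 8 * m ^ 2 * c ^ 2 * (X * S * A)) / μ =
    A * ζ z ^ 2 * X * (8 * p ^ 2 * b ^ 2 / μ) + X * S * A * (8 * m ^ 2 * c ^ 2 / μ) := by
    field_simp
  rw [e]
  linarith

lemma Bf_cont (h : WSol U w P F) (hζ : Cutoff R c ζ) (hG : 0 < G) {p m : ℝ} (hm : 1 ≤ m) :
    ContinuousOn (Bf G c p m w P ζ) U := by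
  have h1 := Sf_cont h.contw hG (p - 1)
  have h2 := Sf_cont h.contw hG p
  have h3 := (hζ.cont_rpow (r := 2 * m) (by linarith)).continuousOn (s := U)
  have h4 := (hζ.cont_rpow (r := 2 * m - 2) (by linarith)).continuousOn (s := U)
  have h5 := h.contP
  unfold Bf
  fun_prop

set_option maxHeartbeats 1000000 in
lemma slice_bound {Cg κ : ℝ} (hκ1 : 1 ≤ κ) (hκ2 : κ ≤ 2)
    (hgns : ∀ u : EE d → ℝ, ContDiff ℝ 1 u →
    HasCompactSupport u → (∀ x, 0 ≤ u x) →
    ∫ x, u x ^ κ ≤ Cg * (∫ x, ‖fderiv ℝ u x‖) ^ κ) (hCg : 1 ≤ Cg)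
    (h : WSol U w P F) (hζ : Cutoff R c ζ)
    (hG : 0 < G) {p m E τ : ℝ} (hp : 1 ≤ p) (hm : 1 ≤ m)
    (hc : 0 ≤ c) (hE : 0 < E) (hU : ∀ x ∈ closedBall (0 : EE d) R, (τ, x) ∈ U)
    (hA : ∫ x, Sf G w (τ, x) ^ p * ζ (τ, x) ^ (2 * m) ≤ E) :
    ∫ x in closedBall (0 : EE d) R, (Sf G w (τ, x) ^ p * ζ (τ, x) ^ (2 * m)) ^ κ ≤
      Cg * E ^ κ * (1 + (∫ x in closedBall (0 : EE d) R, Bf G c p m w P ζ (τ, x)) / E) := by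
  set f : EE d → ℝ := fun x => Sf G w (τ, x) ^ p * ζ (τ, x) ^ (2 * m) with hf
  have hK := isCompact_closedBall (0 : EE d) R
  have hfK : ∀ x, x ∉ closedBall (0 : EE d) R → f x = 0 := fun x hx => by
    simp only [hf]
    rw [hζ.off (τ, x) hx, Real.zero_rpow (by linarith), mul_zero]
  have hψK : ∀ z : ℝ × EE d, z.2 ∉ closedBall (0 : EE d) R → ζ z ^ (2 * m) = 0 := fun z hz => by
    rw [hζ.off z hz, Real.zero_rpow (by linarith)]
  have hfd : ∀ x, HasFDerivAt f (Lfun w P (Phi G p) (Phi1 G p) (fun z => ζ z ^ (2 * m)) (τ, x)) x :=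
    fun x => h.theta hK.isClosed (t := τ) hU (hζ.pow_smooth hm) hψK (Phi_deriv hG) x
  have hΦc : Continuous (Phi G p) :=
    continuous_iff_continuousAt.2 fun s => (Phi_deriv hG s).continuousAt
  have hPhi1c : Continuous (Phi1 G p) :=
    continuous_iff_continuousAt.2 fun s => (Phi1_deriv hG s).continuousAt
  have hτU : ({τ} : Set ℝ) ×ˢ closedBall (0 : EE d) R ⊆ U := by
    rintro ⟨t, x⟩ ⟨ht, hx⟩
    have ht2 : t = τ := ht
    rw [ht2]; exact hU x hx
  have hsl : Continuous (fun x : EE d => ((τ, x) : ℝ × EE d)) := by fun_prop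
  have hfs : ContDiff ℝ 1 f := by
    rw [contDiff_one_iff_fderiv]
    refine ⟨fun x => (hfd x).differentiableAt, ?_⟩
    rw [show fderiv ℝ f = _ from funext fun x => (hfd x).fderiv]
    exact (h.Lfun_cont hK.isClosed hτU (hζ.pow_smooth hm) hψK hΦc hPhi1c).comp_continuous hsl
      (fun x => ⟨rfl, mem_univ _⟩)
  have hf0 : ∀ x, 0 ≤ f x := fun x =>
    mul_nonneg (Real.rpow_nonneg (Sf_pos hG _).le _) (Real.rpow_nonneg (hζ.nonneg _) _)
  have hfc : HasCompactSupport f := HasCompactSupport.intro hK hfK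
  have hg := hgns f hfs hfc hf0
  set y := ∫ x in closedBall (0 : EE d) R, Bf G c p m w P ζ (τ, x) with hy
  have hB0 : ∀ z, 0 ≤ Bf G c p m w P ζ z := fun z => by
    have := Real.rpow_nonneg (Sf_pos hG z (w := w)).le p
    have := Real.rpow_nonneg (Sf_pos hG z (w := w)).le (p - 1)
    have := Real.rpow_nonneg (hζ.nonneg z) (2 * m)
    have := Real.rpow_nonneg (hζ.nonneg z) (2 * m - 2)
    unfold Bf
    positivity
  have hy0 : 0 ≤ y := integral_nonneg fun x => hB0 _
  have iB : IntegrableOn (fun x => Bf G c p m w P ζ (τ, x)) (closedBall (0 : EE d) R) :=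
    ContinuousOn.integrableOn_compact hK ((Bf_cont h hζ hG hm).comp hsl.continuousOn hU)
  set μ := Real.sqrt (1 + y / E) with hμ
  have hμ2 : μ ^ 2 = 1 + y / E := Real.sq_sqrt (by positivity)
  have hμ1 : 1 ≤ μ := by
    rw [hμ, Real.one_le_sqrt]
    have : 0 ≤ y / E := by positivity
    linarith
  have hμ0 : 0 < μ := by linarith
  have h_integ : ∫ x, ‖fderiv ℝ f x‖ ≤ E * μ := by
    have e1 : ∫ x, ‖fderiv ℝ f x‖ = ∫ x in closedBall (0 : EE d) R, ‖fderiv ℝ f x‖ := by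
      refine (setIntegral_eq_integral_of_forall_compl_eq_zero fun x hx => ?_).symm
      rw [(hfd x).fderiv]
      have := Lfun_zero (w := w) (P := P) (ψ := fun z => ζ z ^ (2 * m)) hK.isClosed hψK
        (Phi G p) (Phi1 G p) (τ, x) hx
      rw [this, norm_zero]
    have e2 : ∫ x in closedBall (0 : EE d) R, f x = ∫ x, f x :=
      setIntegral_eq_integral_of_forall_compl_eq_zero fun x hx => hfK x hx
    have if1 : IntegrableOn f (closedBall (0 : EE d) R) :=
      hfs.continuous.continuousOn.integrableOn_compact hK
    have iD1 : IntegrableOn (fun x => ‖fderiv ℝ f x‖) (closedBall (0 : EE d) R) :=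
      ((hfs.continuous_fderiv one_ne_zero).norm).continuousOn.integrableOn_compact hK
    have e3 : 2 * ∫ x in closedBall (0 : EE d) R, ‖fderiv ℝ f x‖ ≤
        μ * (∫ x, f x) + y / μ := by
      have j1 : IntegrableOn (fun x => μ * f x) (closedBall (0 : EE d) R) := if1.const_mul _
      have j2 : IntegrableOn (fun x => Bf G c p m w P ζ (τ, x) / μ) (closedBall (0 : EE d) R) :=
        iB.div_const _
      have j3 : IntegrableOn (fun x => 2 * ‖fderiv ℝ f x‖) (closedBall (0 : EE d) R) :=
        iD1.const_mul _
      have k1 : ∫ x in closedBall (0 : EE d) R, 2 * ‖fderiv ℝ f x‖ ≤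
          ∫ x in closedBall (0 : EE d) R, (μ * f x + Bf G c p m w P ζ (τ, x) / μ) := by
        refine setIntegral_mono_on j3 (j1.add j2) hK.measurableSet fun x _ => ?_
        rw [(hfd x).fderiv]
        exact grad_bound hζ hG hp hm hc hμ0 (τ, x)
      rw [integral_add j1 j2, integral_const_mul, integral_const_mul, integral_div, e2] at k1
      exact k1
    rw [e1]
    have e4 : μ * (∫ x, f x) ≤ μ * E := mul_le_mul_of_nonneg_left hA hμ0.le
    have e5 : y / μ ≤ E * μ := by
      rw [div_le_iff₀ hμ0]
      have : E * μ * μ = E + y := by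
        rw [mul_assoc, ← sq, hμ2]; field_simp
      linarith
    linarith
  have e6 : ∫ x in closedBall (0 : EE d) R, f x ^ κ = ∫ x, f x ^ κ :=
    setIntegral_eq_integral_of_forall_compl_eq_zero fun x hx => by
      rw [hfK x hx, Real.zero_rpow (by linarith)]
  rw [e6]
  refine hg.trans ?_
  rw [mul_assoc]
  refine mul_le_mul_of_nonneg_left ?_ (by linarith)
  calc (∫ x, ‖fderiv ℝ f x‖) ^ κ ≤ (E * μ) ^ κ := by
        refine Real.rpow_le_rpow (integral_nonneg fun x => norm_nonneg _) h_integ (by linarith)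
    _ = E ^ κ * μ ^ κ := Real.mul_rpow hE.le hμ0.le
    _ ≤ E ^ κ * μ ^ (2:ℝ) := by
        refine mul_le_mul_of_nonneg_left ?_ (Real.rpow_nonneg hE.le _)
        exact Real.rpow_le_rpow_of_exponent_le hμ1 hκ2
    _ = E ^ κ * (1 + y / E) := by rw [Real.rpow_two, hμ2]
end
end

noncomputable section

section
variable {d : ℕ} {U : Set (ℝ × EE d)} {w : ℝ × EE d → ℝ} {P F : ℝ × EE d → EE d}
  {ν G R c : ℝ} {ζ : ℝ × EE d → ℝ}

lemma box_fubini (g : ℝ × EE d → ℝ) (hg : IntegrableOn g (Box d R)) :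
    ∫ z in Box d R, g z = ∫ τ in Icc (-R) 0, ∫ x in closedBall (0 : EE d) R, g (τ, x) := by
  have h2 := hg
  unfold Box at h2 ⊢
  rw [Measure.volume_eq_prod] at h2 ⊢
  exact setIntegral_prod g h2

lemma box_fubini_int (g : ℝ × EE d → ℝ) (hg : IntegrableOn g (Box d R)) :
    IntegrableOn (fun τ => ∫ x in closedBall (0 : EE d) R, g (τ, x)) (Icc (-R) 0) := by
  have h2 := hg
  unfold Box at h2
  rw [IntegrableOn, Measure.volume_eq_prod, ← Measure.prod_restrict] at h2
  exact h2.integral_prod_left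

/-- The Moser integral. -/
def Imo (G : ℝ) (w ζ : ℝ × EE d → ℝ) (p : ℝ) : ℝ :=
  ∫ z in Box d 1, Sf G w z ^ p * ζ z ^ (2 * d * (p - 1))

set_option maxHeartbeats 1000000 in
lemma moser_step (hd : 2 ≤ d) (hν : 0 < ν) (hν1 : ν ≤ 1) (hc : 1 ≤ c) (hζ : Cutoff 1 c ζ) :
    ∃ C, 1 ≤ C ∧ ∀ (U : Set (ℝ × EE d)) (w : ℝ × EE d → ℝ) (P F : ℝ × EE d → EE d) (G : ℝ),
      0 < G → Core ν G U w P F → Box d 1 ⊆ U → ∀ p Y : ℝ, 1 ≤ p → 0 < Y → Imo G w ζ p ≤ Y →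
      Imo G w ζ (p * ((d:ℝ) / (d - 1))) ≤ (C * p ^ 5 * Y) ^ ((d:ℝ) / (d - 1)) := by
  obtain ⟨Cg, hCg, hgns⟩ := gns_real d hd
  have hd' : (2:ℝ) ≤ d := by exact_mod_cast hd
  set κ : ℝ := (d:ℝ) / (d - 1) with hκ
  have hκ1 : 1 ≤ κ := by rw [hκ, le_div_iff₀ (by linarith)]; linarith
  have hκ2 : κ ≤ 2 := by rw [hκ, div_le_iff₀ (by linarith)]; linarith
  have hC0 : 1 ≤ C0 d c := by unfold C0; nlinarith [mul_nonneg (by linarith : (0:ℝ) ≤ d) (by linarith : (0:ℝ) ≤ c), sq_nonneg ((d:ℝ) * c)]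
  have hν' : 1 ≤ ν⁻¹ := (one_le_inv₀ hν).2 hν1
  set Kc := 11 * ν⁻¹ + 8 * (d:ℝ) ^ 2 * c ^ 2 with hKc
  have hKc0 : 0 ≤ Kc := by positivity
  have hv3 : 1 ≤ C0 d c * ν⁻¹ ^ 3 := one_le_mul_of_one_le_of_one_le hC0 (one_le_pow₀ hν')
  have hCK : 1 ≤ Cg * (1 + Kc) := one_le_mul_of_one_le_of_one_le hCg (by linarith)
  refine ⟨Cg * (1 + Kc) * (C0 d c * ν⁻¹ ^ 3), one_le_mul_of_one_le_of_one_le hCK hv3, ?_⟩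
  intro U w P F G hG h hBox p Y hp hY hI
  set m : ℝ := d * p - d + 1 with hm_def
  have hm : 1 ≤ m := by rw [hm_def]; nlinarith
  have hmD : m ≤ d * p := by rw [hm_def]; linarith
  obtain ⟨a1, a2⟩ := h.energy_top hζ one_pos hBox hν hν1 hG hp hm hmD (by linarith) hc
  have eI : ∫ z in Box d 1, Sf G w z ^ p * ζ z ^ (2 * m - 2) = Imo G w ζ p := by
    unfold Imo
    rw [show 2 * m - 2 = 2 * d * (p - 1) by rw [hm_def]; ring]
  rw [eI] at a1 a2
  set E := C0 d c * ν⁻¹ ^ 3 * p ^ 3 * Y with hE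
  have hp3 : 1 ≤ p ^ 3 := one_le_pow₀ hp
  have hco : 1 ≤ C0 d c * ν⁻¹ ^ 3 * p ^ 3 := one_le_mul_of_one_le_of_one_le hv3 hp3
  have hYE : Y ≤ E := by rw [hE]; nlinarith
  have hE0 : 0 < E := by linarith
  have hIE : C0 d c * ν⁻¹ ^ 3 * p ^ 3 * Imo G w ζ p ≤ E :=
    mul_le_mul_of_nonneg_left hI (by linarith)
  have hcB := isCompact_Box (d := d) 1
  have iBf : IntegrableOn (Bf G c p m w P ζ) (Box d 1) :=
    ((Bf_cont h.sol hζ hG hm).mono hBox).integrableOn_compact hcB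
  have cS := fun r : ℝ => (Sf_cont h.sol.contw hG r).mono hBox
  have cP := h.sol.contP.mono hBox
  have cz := fun (r : ℝ) (hr : 0 ≤ r) => (hζ.cont_rpow hr).continuousOn (s := Box d 1)
  have i1 : IntegrableOn (fun z => Sf G w z ^ (p - 1) * ‖P z‖ ^ 2 * ζ z ^ (2 * m)) (Box d 1) :=
    (((cS (p - 1)).mul (cP.norm.pow 2)).mul (cz (2 * m) (by linarith))).integrableOn_compact hcB
  have i2 : IntegrableOn (fun z => Sf G w z ^ p * ζ z ^ (2 * m - 2)) (Box d 1) :=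
    ((cS p).mul (cz (2 * m - 2) (by linarith))).integrableOn_compact hcB
  have hBint : ∫ z in Box d 1, Bf G c p m w P ζ z ≤ E * (p ^ 2 * Kc) := by
    have e1 : ∫ z in Box d 1, Bf G c p m w P ζ z =
        8 * p ^ 2 * (∫ z in Box d 1, Sf G w z ^ (p - 1) * ‖P z‖ ^ 2 * ζ z ^ (2 * m)) +
        8 * m ^ 2 * c ^ 2 * Imo G w ζ p := by
      have j1 : IntegrableOn (fun z => 8 * p ^ 2 * (Sf G w z ^ (p - 1) * ‖P z‖ ^ 2 * ζ z ^ (2 * m)))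
        (Box d 1) := i1.const_mul _
      have j2 : IntegrableOn (fun z => 8 * m ^ 2 * c ^ 2 * (Sf G w z ^ p * ζ z ^ (2 * m - 2)))
        (Box d 1) := i2.const_mul _
      unfold Bf
      rw [integral_add j1 j2, integral_const_mul, integral_const_mul, eI]
    rw [e1]
    set J := ∫ z in Box d 1, Sf G w z ^ (p - 1) * ‖P z‖ ^ 2 * ζ z ^ (2 * m) with hJ
    have b1 : p * J ≤ 4 / 3 * ν⁻¹ * E := by
      have b : 3 / 4 * p * ν * J ≤ E := a2.trans hIE
      have := mul_le_mul_of_nonneg_left b (by positivity : 0 ≤ 4 / 3 * ν⁻¹)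
      calc p * J = 4 / 3 * ν⁻¹ * (3 / 4 * p * ν * J) := by field_simp
        _ ≤ _ := this
    have b2 : 8 * p ^ 2 * J ≤ p ^ 2 * (11 * ν⁻¹) * E := by
      have h1 : 8 * p ^ 2 * J ≤ 8 * p * (4 / 3 * ν⁻¹ * E) := by
        have := mul_le_mul_of_nonneg_left b1 (by linarith : 0 ≤ 8 * p)
        calc 8 * p ^ 2 * J = 8 * p * (p * J) := by ring
          _ ≤ _ := this
      have h2 : p ≤ p ^ 2 := by nlinarith
      have h3 : 0 ≤ ν⁻¹ * E := by positivity
      nlinarith [mul_le_mul_of_nonneg_right h2 h3]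
    have b3 : 8 * m ^ 2 * c ^ 2 * Imo G w ζ p ≤ 8 * (d * p) ^ 2 * c ^ 2 * E := by
      refine mul_le_mul ?_ (hI.trans hYE) ?_ (by positivity)
      · gcongr
      · refine setIntegral_nonneg hcB.measurableSet fun z _ => ?_
        exact mul_nonneg (Real.rpow_nonneg (Sf_pos hG _).le _) (Real.rpow_nonneg (hζ.nonneg _) _)
    have b4 : E * (p ^ 2 * Kc) = p ^ 2 * (11 * ν⁻¹) * E + 8 * (d * p) ^ 2 * c ^ 2 * E := by
      rw [hKc]; ring
    linarith
  have e2 : Imo G w ζ (p * κ) = ∫ z in Box d 1, (Sf G w z ^ p * ζ z ^ (2 * m)) ^ κ := by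
    unfold Imo
    refine setIntegral_congr_fun hcB.measurableSet fun z _ => ?_
    beta_reduce
    rw [Real.mul_rpow (Real.rpow_nonneg (Sf_pos hG _).le _) (Real.rpow_nonneg (hζ.nonneg _) _),
      ← Real.rpow_mul (Sf_pos hG _).le, ← Real.rpow_mul (hζ.nonneg _)]
    congr 2
    rw [hm_def, hκ]
    have : (d:ℝ) - 1 ≠ 0 := by linarith
    field_simp
    ring
  have cf : ContinuousOn (fun z => (Sf G w z ^ p * ζ z ^ (2 * m)) ^ κ) (Box d 1) :=
    ((cS p).mul (cz (2 * m) (by linarith))).rpow_const fun z _ => Or.inr (by linarith)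
  have if1 := cf.integrableOn_compact (μ := volume) hcB
  have iy := box_fubini_int _ iBf
  have key : Imo G w ζ (p * κ) ≤ Cg * E ^ κ * (1 + p ^ 2 * Kc) := by
    rw [e2, box_fubini _ if1]
    have s1 : ∫ τ in Icc (-1:ℝ) 0, ∫ x in closedBall (0 : EE d) 1,
        (Sf G w (τ, x) ^ p * ζ (τ, x) ^ (2 * m)) ^ κ ≤ ∫ τ in Icc (-1:ℝ) 0, Cg * E ^ κ *
        (1 + (∫ x in closedBall (0 : EE d) 1, Bf G c p m w P ζ (τ, x)) / E) := by
      refine setIntegral_mono_on (box_fubini_int _ if1) ?_ measurableSet_Icc fun τ hτ => ?_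
      · exact ((integrableOn_const (by simp)).add (iy.div_const _)).const_mul _
      · exact slice_bound hκ1 hκ2 hgns hCg h.sol hζ hG hp hm (by linarith) hE0
          (fun x hx => hBox ⟨hτ, hx⟩) ((a1 τ hτ).trans hIE)
    refine s1.trans ?_
    rw [integral_const_mul]
    refine mul_le_mul_of_nonneg_left ?_ (by positivity)
    have k1 : IntegrableOn (fun _ : ℝ => (1:ℝ)) (Icc (-1:ℝ) 0) := integrableOn_const (by simp)
    have k2 : IntegrableOn (fun τ => (∫ x in closedBall (0 : EE d) 1, Bf G c p m w P ζ (τ, x)) / E)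
      (Icc (-1:ℝ) 0) := iy.div_const _
    rw [integral_add k1 k2, integral_div, ← box_fubini _ iBf]
    have : ∫ _ in Icc (-1:ℝ) 0, (1:ℝ) = 1 := by simp
    rw [this]
    have : (∫ z in Box d 1, Bf G c p m w P ζ z) / E ≤ p ^ 2 * Kc := by
      rw [div_le_iff₀ hE0]; linarith
    linarith
  refine key.trans ?_
  have hp2 : 1 ≤ p ^ 2 := one_le_pow₀ hp
  have hb : 1 ≤ Cg * (1 + Kc) * p ^ 2 := one_le_mul_of_one_le_of_one_le hCK hp2
  calc Cg * E ^ κ * (1 + p ^ 2 * Kc) ≤ Cg * E ^ κ * (p ^ 2 * (1 + Kc)) := by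
        refine mul_le_mul_of_nonneg_left ?_ (by positivity); nlinarith
    _ = (Cg * (1 + Kc) * p ^ 2) * E ^ κ := by ring
    _ ≤ (Cg * (1 + Kc) * p ^ 2) ^ κ * E ^ κ := by
        refine mul_le_mul_of_nonneg_right ?_ (by positivity)
        exact Real.self_le_rpow_of_one_le hb hκ1
    _ = (Cg * (1 + Kc) * p ^ 2 * E) ^ κ := (Real.mul_rpow (by linarith) hE0.le).symm
    _ = _ := by rw [hE]; congr 1; ring

end
end

noncomputable section

lemma moser_iter {κ C b : ℝ} (hκ : 1 < κ) (hC : 1 ≤ C) (hb : 1 ≤ b) :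
    ∃ D, 1 ≤ D ∧ ∀ (I : ℕ → ℝ), (∀ n, 0 ≤ I n) →
      (∀ n Y, 0 < Y → I n ≤ Y → I (n + 1) ≤ (C * b ^ n * Y) ^ κ) →
      ∀ Y0, 0 < Y0 → I 0 ≤ Y0 → ∀ n, I n ≤ (D * Y0) ^ (κ ^ n) := by
  set e := κ / (κ - 1) with he
  have hk : 0 < κ - 1 := by linarith
  have he0 : 0 < e := by positivity
  have hC0 : 0 < C := by linarith
  have hb0 : 0 < b := by linarith
  set D := (C ^ κ * b ^ e) ^ (1 / (κ - 1)) with hD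
  have hbase : 1 ≤ C ^ κ * b ^ e :=
    one_le_mul_of_one_le_of_one_le (Real.one_le_rpow hC (by linarith)) (Real.one_le_rpow hb he0.le)
  have hD1 : 1 ≤ D := Real.one_le_rpow hbase (by positivity)
  have hD0 : 0 < D := by linarith
  have hDk : D ^ κ = D * (C ^ κ * b ^ e) := by
    have : D ^ (κ - 1) = C ^ κ * b ^ e := by
      rw [hD, ← Real.rpow_mul (by linarith), one_div_mul_cancel hk.ne', Real.rpow_one]
    rw [← this]
    rw [← Real.rpow_one_add' hD0.le (by linarith)]
    congr 1; ring
  refine ⟨D, hD1, fun I h0 hI Y0 hY0 hI0 => ?_⟩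
  have main : ∀ n, I n ≤ (D * Y0) ^ (κ ^ n) / (D * b ^ (e * n)) := by
    intro n
    induction n with
    | zero =>
      simp only [pow_zero, Real.rpow_one, Nat.cast_zero, mul_zero, Real.rpow_zero, mul_one]
      rw [mul_div_cancel_left₀ _ hD0.ne']
      exact hI0
    | succ n ih =>
      refine (hI n _ (by positivity) ih).trans (le_of_eq ?_)
      have hX : 0 < (D * Y0) := by positivity
      have e1 : C * b ^ n * ((D * Y0) ^ κ ^ n / (D * b ^ (e * ↑n))) =
        C * (D * Y0) ^ κ ^ n / D * (b ^ ((n:ℝ) - e * n)) := by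
        rw [Real.rpow_sub hb0, Real.rpow_natCast]
        field_simp
      rw [e1, Real.mul_rpow (by positivity) (by positivity), Real.div_rpow (by positivity) hD0.le,
        Real.mul_rpow hC0.le (by positivity), ← Real.rpow_mul hX.le, ← Real.rpow_mul hb0.le, hDk,
        ← pow_succ]
      have e2 : ((n:ℝ) - e * n) * κ = - (e * n) := by
        rw [he]; field_simp; ring
      rw [e2, Real.rpow_neg hb0.le]
      have e3 : b ^ (e * ((n + 1 : ℕ) : ℝ)) = b ^ (e * n) * b ^ e := by
        rw [← Real.rpow_add hb0]; congr 1; push_cast; ring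
      rw [e3]
      have : 0 < C ^ κ := by positivity
      have : 0 < b ^ e := by positivity
      have : 0 < b ^ (e * n) := by positivity
      field_simp
  intro n
  refine (main n).trans (div_le_self (by positivity) ?_)
  exact one_le_mul_of_one_le_of_one_le hD1 (Real.one_le_rpow hb (by positivity))

/-- local boundedness of weak solutions. -/
lemma local_bound (d : ℕ) (hd : 2 ≤ d) {ν : ℝ} (hν : 0 < ν) (hν1 : ν ≤ 1) :
    ∃ D, 1 ≤ D ∧ ∀ (U : Set (ℝ × EE d)) (w : ℝ × EE d → ℝ) (P F : ℝ × EE d → EE d) (G : ℝ),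
      0 < G → Core ν G U w P F → Box d 1 ⊆ U →
      w 0 ^ 2 ≤ D * ∫ z in Box d 1, (w z ^ 2 + G ^ 2) := by
  obtain ⟨c, hc, ζ, hζ, hζ1⟩ := exists_cutoff d (r := 1 / 2) (R := 1) (by norm_num) (by norm_num)
  obtain ⟨C, hC, hstep⟩ := moser_step hd hν hν1 hc hζ
  have hd' : (2:ℝ) ≤ d := by exact_mod_cast hd
  set κ : ℝ := (d:ℝ) / (d - 1) with hκ
  have hκ1 : 1 < κ := by rw [hκ, lt_div_iff₀ (by linarith)]; linarith
  obtain ⟨D, hD, hit⟩ := moser_iter (b := κ ^ 5) hκ1 hC (one_le_pow₀ hκ1.le)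
  refine ⟨D, hD, fun U w P F G hG h hBox => ?_⟩
  have hcB := isCompact_Box (d := d) 1
  have hI0 : ∀ p, 0 ≤ Imo G w ζ p := fun p =>
    setIntegral_nonneg hcB.measurableSet fun z _ =>
      mul_nonneg (Real.rpow_nonneg (Sf_pos hG _).le _) (Real.rpow_nonneg (hζ.nonneg _) _)
  have hvol : ∀ ε : ℝ, 0 < ε → 0 < volume.real (Box d ε) := by
    intro ε hε
    refine ENNReal.toReal_pos ?_ (isCompact_Box ε).measure_lt_top.ne
    have ho : IsOpen (Ioo (-ε) 0 ×ˢ ball (0 : EE d) ε) := isOpen_Ioo.prod isOpen_ball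
    have hne : (Ioo (-ε) 0 ×ˢ ball (0 : EE d) ε).Nonempty :=
      ⟨(-ε/2, 0), ⟨by constructor <;> linarith, mem_ball_self hε⟩⟩
    have := ho.measure_pos volume hne
    refine (this.trans_le (measure_mono ?_)).ne'
    exact prod_mono Ioo_subset_Icc_self ball_subset_closedBall
  have eI : Imo G w ζ 1 = ∫ z in Box d 1, (w z ^ 2 + G ^ 2) := by
    unfold Imo Sf
    simp
  have cS := fun r : ℝ => (Sf_cont h.sol.contw hG r).mono hBox
  have hInt : ∀ p : ℝ, 1 ≤ p → IntegrableOn (fun z => Sf G w z ^ p * ζ z ^ (2 * d * (p - 1))) (Box d 1) :=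
    fun p hp => ((cS p).mul ((hζ.cont_rpow (by have : 0 ≤ p - 1 := by linarith
                                               positivity)).continuousOn)).integrableOn_compact hcB
  have hlow : ∀ A ε : ℝ, 0 < A → 0 < ε → ε ≤ 1 / 2 → (∀ z ∈ Box d ε, A ≤ Sf G w z) → ∀ p : ℝ, 1 ≤ p →
      A ^ p * volume.real (Box d ε) ≤ Imo G w ζ p := by
    intro A ε hA hε hε2 hz p hp
    have hsub : Box d ε ⊆ Box d 1 := Box_mono (by linarith)
    calc A ^ p * volume.real (Box d ε) = ∫ _ in Box d ε, A ^ p := by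
          rw [setIntegral_const, smul_eq_mul, mul_comm]
      _ ≤ ∫ z in Box d ε, Sf G w z ^ p * ζ z ^ (2 * d * (p - 1)) := by
          refine setIntegral_mono_on (integrableOn_const (isCompact_Box ε).measure_lt_top.ne)
            ((hInt p hp).mono_set hsub) (isCompact_Box ε).measurableSet fun z hzB => ?_
          rw [hζ1 z (closedBall_subset_closedBall hε2 (Box_sub_ball hε.le hzB)), Real.one_rpow, mul_one]
          exact Real.rpow_le_rpow hA.le (hz z hzB) (by linarith)
      _ ≤ _ := by
          refine setIntegral_mono_set (hInt p hp) (ae_of_all _ fun z => ?_) hsub.eventuallyLE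
          exact mul_nonneg (Real.rpow_nonneg (Sf_pos hG _).le _) (Real.rpow_nonneg (hζ.nonneg _) _)
  have hIpos : 0 < Imo G w ζ 1 := by
    refine lt_of_lt_of_le ?_ (hlow (G ^ 2) (1 / 2) (by positivity) (by norm_num) le_rfl
      (fun z _ => ?_) 1 le_rfl)
    · exact mul_pos (by positivity) (hvol _ (by norm_num))
    · unfold Sf; nlinarith [sq_nonneg (w z)]
  have hup := hit (fun n => Imo G w ζ (κ ^ n)) (fun n => hI0 _) (fun n Y hY hn => by
    have := hstep U w P F G hG h hBox (κ ^ n) Y (one_le_pow₀ hκ1.le) hY hn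
    rw [← pow_succ, ← pow_mul, mul_comm n 5, pow_mul] at this
    exact this) _ hIpos (by simp)
  rw [← eI]
  have hS0 : w 0 ^ 2 ≤ Sf G w 0 := by unfold Sf; nlinarith [sq_nonneg G]
  refine hS0.trans ?_
  by_contra hcon
  push Not at hcon
  set X := D * Imo G w ζ 1 with hX
  have hX0 : 0 < X := by positivity
  obtain ⟨A, hXA, hAS⟩ := exists_between hcon
  have h0U : (0 : ℝ × EE d) ∈ U := hBox ⟨⟨by simp, le_rfl⟩, by simp⟩
  have hct : ContinuousAt (Sf G w) 0 := by
    have : ContinuousOn (Sf G w) U := by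
      have := h.sol.contw
      unfold Sf; fun_prop
    exact this.continuousAt (h.sol.isOpen.mem_nhds h0U)
  obtain ⟨ε, hε, hεA⟩ := Metric.eventually_nhds_iff_ball.1 (hct.eventually (lt_mem_nhds hAS))
  set ε' := min (ε / 2) (1 / 2) with hε'
  have hε'0 : 0 < ε' := lt_min (by linarith) (by norm_num)
  have hA0 : 0 < A := hX0.trans hXA
  have hbd : ∀ n : ℕ, (A / X) ^ (κ ^ n) * volume.real (Box d ε') ≤ 1 := by
    intro n
    have h1 := hlow A ε' hA0 hε'0 (min_le_right _ _) (fun z hz => by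
      refine (hεA z ?_).le
      have := Box_sub_ball hε'0.le hz
      rw [mem_closedBall] at this
      rw [mem_ball]
      have h2 : ε' ≤ ε / 2 := min_le_left _ _
      linarith) (κ ^ n) (one_le_pow₀ hκ1.le)
    have h2 := h1.trans (hup n)
    rw [Real.div_rpow hA0.le hX0.le, div_mul_eq_mul_div, div_le_one (by positivity)]
    exact h2
  have ht : Tendsto (fun n : ℕ => (A / X) ^ (κ ^ n)) atTop atTop :=
    (tendsto_rpow_atTop_of_base_gt_one _ ((one_lt_div hX0).2 hXA)).comp
      (tendsto_pow_atTop_atTop_of_one_lt hκ1)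
  obtain ⟨n, hn⟩ := (ht.eventually (eventually_gt_atTop (1 / volume.real (Box d ε')))).exists
  have := hbd n
  rw [div_lt_iff₀ (hvol _ hε'0)] at hn
  linarith
end

noncomputable section

section
variable {d : ℕ} {U : Set (ℝ × EE d)} {w : ℝ × EE d → ℝ} {P F : ℝ × EE d → EE d}

lemma sq_integral_le {g : ℝ → ℝ} (hg : ContinuousOn g (Icc 0 1)) :
    (∫ s in (0:ℝ)..1, g s) ^ 2 ≤ ∫ s in (0:ℝ)..1, g s ^ 2 := by
  have hu : uIcc (0:ℝ) 1 = Icc 0 1 := uIcc_of_le zero_le_one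
  have i1 : IntervalIntegrable g volume 0 1 := ContinuousOn.intervalIntegrable (by rwa [hu])
  have i2 : IntervalIntegrable (fun s => g s ^ 2) volume 0 1 :=
    ContinuousOn.intervalIntegrable (by rw [hu]; exact hg.pow 2)
  set m := ∫ s in (0:ℝ)..1, g s with hm
  have h0 : 0 ≤ ∫ s in (0:ℝ)..1, (g s - m) ^ 2 :=
    intervalIntegral.integral_nonneg zero_le_one fun s _ => sq_nonneg _
  have e : ∫ s in (0:ℝ)..1, (g s - m) ^ 2 = ∫ s in (0:ℝ)..1, (g s ^ 2 - (2 * m) * g s + m ^ 2) := by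
    congr 1; ext s; ring
  rw [e, intervalIntegral.integral_add (i2.sub (i1.const_mul _)) (by simp),
    intervalIntegral.integral_sub i2 (i1.const_mul _), intervalIntegral.integral_const_mul, ← hm] at h0
  simp at h0
  nlinarith

lemma shift_mem {r R : ℝ} {h : EE d} {s : ℝ} (hs : s ∈ Icc (0:ℝ) 1) (hh : r + ‖h‖ ≤ R)
    {z : ℝ × EE d} (hz : z ∈ Box d r) : z + s • ((0 : ℝ), h) ∈ Box d R := by
  obtain ⟨⟨h1, h2⟩, h3⟩ := hz
  have hn := norm_nonneg h
  refine ⟨⟨?_, ?_⟩, ?_⟩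
  · simp; linarith
  · simpa using h2
  · rw [mem_closedBall_zero_iff] at h3 ⊢
    have : ‖(z + s • ((0 : ℝ), h)).2‖ ≤ ‖z.2‖ + s * ‖h‖ := by
      simp only [Prod.snd_add, Prod.smul_snd]
      refine (norm_add_le _ _).trans ?_
      rw [norm_smul, Real.norm_eq_abs, abs_of_nonneg hs.1]
    have : s * ‖h‖ ≤ ‖h‖ := mul_le_of_le_one_left hn hs.2
    linarith

lemma diff_quot (hw : WSol U w P F) (hU : Box d (3 / 2) ⊆ U) {h : EE d} (hh : ‖h‖ ≤ 1 / 2) :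
    ∫ z in Box d 1, (w (z.1, z.2 + h) - w z) ^ 2 ≤
      ‖h‖ ^ 2 * ∫ z in Box d (3 / 2), ‖P z‖ ^ 2 := by
  have hsm : ∀ s ∈ Icc (0:ℝ) 1, ∀ z ∈ Box d 1, z + s • ((0 : ℝ), h) ∈ Box d (3 / 2) :=
    fun s hs z hz => shift_mem hs (by linarith) hz
  have hcP : ContinuousOn P (Box d (3 / 2)) := hw.contP.mono hU
  have hcw : ContinuousOn w (Box d (3 / 2)) := hw.contw.mono hU
  have hcB := isCompact_Box (d := d) 1
  have hcB2 := isCompact_Box (d := d) (3 / 2)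
  have hsl : ∀ z ∈ Box d 1, ContinuousOn (fun s : ℝ => P (z + s • ((0 : ℝ), h))) (Icc 0 1) :=
    fun z hz => hcP.comp (by fun_prop) fun s hs => hsm s hs z hz
  -- pointwise bound
  have hpt : ∀ z ∈ Box d 1, (w (z.1, z.2 + h) - w z) ^ 2 ≤
      ‖h‖ ^ 2 * ∫ s in (0:ℝ)..1, ‖P (z + s • ((0 : ℝ), h))‖ ^ 2 := by
    intro z hz
    have hu : uIcc (0:ℝ) 1 = Icc 0 1 := uIcc_of_le zero_le_one
    have hder : ∀ s ∈ uIcc (0:ℝ) 1, HasDerivAt (fun s : ℝ => w (z.1, z.2 + s • h))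
        (inner ℝ (P (z + s • ((0 : ℝ), h))) h) s := by
      intro s hs
      rw [hu] at hs
      have h1 := hw.grad _ (hU (hsm s hs z hz))
      have e0 : (z + s • ((0 : ℝ), h)).1 = z.1 := by simp
      have e1 : (z + s • ((0 : ℝ), h)).2 = z.2 + s • h := by simp
      rw [e0, e1] at h1
      have h2 : HasDerivAt (fun s : ℝ => z.2 + s • h) h s := by
        simpa using ((hasDerivAt_id s).smul_const h).const_add z.2
      have h3 := h1.comp_hasDerivAt s h2
      simpa [Function.comp_def, innerSL_apply_apply] using h3
    have hci : ContinuousOn (fun s : ℝ => (inner ℝ (P (z + s • ((0 : ℝ), h))) h : ℝ)) (Icc 0 1) :=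
      (hsl z hz).inner continuousOn_const
    have hF := intervalIntegral.integral_eq_sub_of_hasDerivAt hder
      (ContinuousOn.intervalIntegrable (by rwa [hu]))
    have e2 : w (z.1, z.2 + h) - w z = ∫ s in (0:ℝ)..1, inner ℝ (P (z + s • ((0 : ℝ), h))) h := by
      rw [hF]; simp
    rw [e2]
    refine (sq_integral_le hci).trans ?_
    rw [← intervalIntegral.integral_const_mul]
    refine intervalIntegral.integral_mono_on zero_le_one
      (ContinuousOn.intervalIntegrable (by rw [hu]; exact hci.pow 2))
      (ContinuousOn.intervalIntegrable (by
        rw [hu]; exact continuousOn_const.mul ((hsl z hz).norm.pow 2))) fun s _ => ?_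
    have h4 := abs_real_inner_le_norm (P (z + s • ((0 : ℝ), h))) h
    calc (inner ℝ (P (z + s • ((0 : ℝ), h))) h) ^ 2 = |inner ℝ (P (z + s • ((0 : ℝ), h))) h| ^ 2 := by
          rw [sq_abs]
      _ ≤ (‖P (z + s • ((0 : ℝ), h))‖ * ‖h‖) ^ 2 := by gcongr
      _ = _ := by ring
  have hcj : ContinuousOn (fun q : ℝ × (ℝ × EE d) => ‖P (q.2 + q.1 • ((0 : ℝ), h))‖ ^ 2)
      (Icc (0:ℝ) 1 ×ˢ Box d 1) :=
    (hcP.comp (by fun_prop) fun q hq => hsm q.1 hq.1 q.2 hq.2).norm.pow 2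
  have hij : Integrable (fun q : ℝ × (ℝ × EE d) => ‖P (q.2 + q.1 • ((0 : ℝ), h))‖ ^ 2)
      (((volume : Measure ℝ).restrict (Icc 0 1)).prod ((volume : Measure (ℝ × EE d)).restrict (Box d 1))) := by
    rw [Measure.prod_restrict]
    exact hcj.integrableOn_compact' (isCompact_Icc.prod hcB)
      (measurableSet_Icc.prod hcB.measurableSet)
  have iL : IntegrableOn (fun z => (w (z.1, z.2 + h) - w z) ^ 2) (Box d 1) := by
    refine ContinuousOn.integrableOn_compact hcB ?_
    refine (ContinuousOn.sub (hcw.comp (t := Box d (3/2)) (by fun_prop) fun z hz => ?_)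
      (hcw.mono (Box_mono (by norm_num)))).pow 2
    have := hsm 1 (by simp) z hz
    rw [one_smul] at this
    convert this using 1
    ext1 <;> simp
  have h_integ : ∀ z, ∫ s in (0:ℝ)..1, ‖P (z + s • ((0 : ℝ), h))‖ ^ 2 =
      ∫ s in Icc (0:ℝ) 1, ‖P (z + s • ((0 : ℝ), h))‖ ^ 2 := fun z => by
    rw [intervalIntegral.integral_of_le zero_le_one, integral_Icc_eq_integral_Ioc]
  have iR : IntegrableOn (fun z => ∫ s in Icc (0:ℝ) 1, ‖P (z + s • ((0 : ℝ), h))‖ ^ 2) (Box d 1) :=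
    hij.integral_prod_right
  calc ∫ z in Box d 1, (w (z.1, z.2 + h) - w z) ^ 2
      ≤ ∫ z in Box d 1, ‖h‖ ^ 2 * ∫ s in Icc (0:ℝ) 1, ‖P (z + s • ((0 : ℝ), h))‖ ^ 2 := by
        refine setIntegral_mono_on iL (iR.const_mul _) hcB.measurableSet fun z hz => ?_
        rw [← h_integ]; exact hpt z hz
    _ = ‖h‖ ^ 2 * ∫ z in Box d 1, ∫ s in Icc (0:ℝ) 1, ‖P (z + s • ((0 : ℝ), h))‖ ^ 2 := by
        rw [integral_const_mul]
    _ = ‖h‖ ^ 2 * ∫ s in Icc (0:ℝ) 1, ∫ z in Box d 1, ‖P (z + s • ((0 : ℝ), h))‖ ^ 2 := by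
        congr 1
        exact (integral_integral_swap hij).symm
    _ ≤ ‖h‖ ^ 2 * ∫ s in Icc (0:ℝ) 1, ∫ z in Box d (3 / 2), ‖P z‖ ^ 2 := by
        refine mul_le_mul_of_nonneg_left ?_ (by positivity)
        refine setIntegral_mono_on hij.integral_prod_left (integrableOn_const (by simp))
          measurableSet_Icc fun s hs => ?_
        have mp := measurePreserving_add_right (volume : Measure (ℝ × EE d)) (s • ((0 : ℝ), h))
        have me := measurableEmbedding_addRight (s • ((0 : ℝ), h) : ℝ × EE d)
        have e := mp.setIntegral_preimage_emb me (fun z => ‖P z‖ ^ 2) (Box d (3 / 2))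
        rw [← e]
        have iP : IntegrableOn (fun z => ‖P z‖ ^ 2) (Box d (3 / 2)) :=
          (hcP.norm.pow 2).integrableOn_compact hcB2
        have iP2 := (mp.integrableOn_comp_preimage me).2 iP
        refine setIntegral_mono_set iP2 (ae_of_all _ fun z => by simp) ?_
        exact LE.le.eventuallyLE fun z hz => hsm s hs z hz
    _ = _ := by simp

lemma osc_lemma (d : ℕ) (hd : 2 ≤ d) {ν : ℝ} (hν : 0 < ν) (hν1 : ν ≤ 1) :
    ∃ C, 1 ≤ C ∧ ∀ (U U' : Set (ℝ × EE d)) (w w' : ℝ × EE d → ℝ) (P F P' F' : ℝ × EE d → EE d)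
      (G M : ℝ) (h : EE d),
      0 < G → 0 ≤ M → Core ν G U w P F → Box d 2 ⊆ U → (∀ z ∈ Box d 2, |w z| ≤ M) →
      ‖h‖ ≤ 1 / 2 → Core ν G U' w' P' F' → Box d 1 ⊆ U' →
      (∀ z ∈ Box d 1, w' z = w (z.1, z.2 + h) - w z) →
      |w' 0| ≤ C * (‖h‖ * (M + G) + G) := by
  obtain ⟨Cc, hCc, hcac⟩ := caccioppoli d hν hν1
  obtain ⟨D, hD, hloc⟩ := local_bound d hd hν hν1
  set V1 := volume.real (Box d 1)
  set V2 := volume.real (Box d 2)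
  have hV1 : 0 ≤ V1 := measureReal_nonneg
  have hV2 : 0 ≤ V2 := measureReal_nonneg
  set K := D * (Cc * V2 + V1) with hK
  have hK0 : 0 ≤ K := by positivity
  refine ⟨K + 1, by linarith, ?_⟩
  intro U U' w w' P F P' F' G M h hG hM hc hB2 hwM hh hc' hB1 hdiff
  have hcB := isCompact_Box (d := d) 1
  have hcB2 := isCompact_Box (d := d) 2
  have h1 := hloc U' w' P' F' G hG hc' hB1
  have h2 := hcac U w P F G hG hc hB2
  have h3 := diff_quot hc.sol ((Box_mono (by norm_num)).trans hB2) hh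
  have h4 : ∫ z in Box d 2, (w z ^ 2 + G ^ 2) ≤ V2 * (M ^ 2 + G ^ 2) := by
    have cw : ContinuousOn (fun z => w z ^ 2 + G ^ 2) (Box d 2) := by
      have := hc.sol.contw.mono hB2
      fun_prop
    calc ∫ z in Box d 2, (w z ^ 2 + G ^ 2) ≤ ∫ z in Box d 2, (M ^ 2 + G ^ 2) := by
          refine setIntegral_mono_on (cw.integrableOn_compact hcB2)
            (integrableOn_const hcB2.measure_lt_top.ne) hcB2.measurableSet fun z hz => ?_
          have := sq_le_sq' (by linarith [abs_le.1 (hwM z hz)]) (abs_le.1 (hwM z hz)).2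
          linarith
      _ = _ := by rw [setIntegral_const, smul_eq_mul]
  have h5 : ∫ z in Box d 1, (w' z ^ 2 + G ^ 2) =
      (∫ z in Box d 1, (w (z.1, z.2 + h) - w z) ^ 2) + V1 * G ^ 2 := by
    have i1 : IntegrableOn (fun z => w' z ^ 2) (Box d 1) :=
      ((hc'.sol.contw.mono hB1).pow 2).integrableOn_compact hcB
    rw [integral_add i1 (integrableOn_const hcB.measure_lt_top.ne), setIntegral_const, smul_eq_mul]
    congr 1
    refine setIntegral_congr_fun hcB.measurableSet fun z hz => ?_
    simp only [hdiff z hz]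
  have h6 : w' 0 ^ 2 ≤ K * (‖h‖ * (M + G) + G) ^ 2 := by
    have hn := norm_nonneg h
    have a1 : ∫ z in Box d 1, (w (z.1, z.2 + h) - w z) ^ 2 ≤ Cc * V2 * (‖h‖ ^ 2 * (M ^ 2 + G ^ 2)) := by
      refine h3.trans ?_
      calc _ ≤ ‖h‖ ^ 2 * (Cc * (V2 * (M ^ 2 + G ^ 2))) := by
            refine mul_le_mul_of_nonneg_left (h2.trans ?_) (by positivity)
            exact mul_le_mul_of_nonneg_left h4 hCc.le
        _ = _ := by ring
    have a2 : ‖h‖ ^ 2 * (M ^ 2 + G ^ 2) ≤ (‖h‖ * (M + G) + G) ^ 2 := by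
      have : 0 ≤ ‖h‖ * (M + G) * G := by positivity
      have : 0 ≤ ‖h‖ ^ 2 * (M * G) := by positivity
      nlinarith [sq_nonneg G]
    have a3 : G ^ 2 ≤ (‖h‖ * (M + G) + G) ^ 2 := by
      have : 0 ≤ ‖h‖ * (M + G) := by positivity
      nlinarith
    rw [h5] at h1
    refine h1.trans ?_
    rw [hK, mul_assoc]
    refine mul_le_mul_of_nonneg_left ?_ (by linarith)
    have b1 := mul_le_mul_of_nonneg_left a2 (by positivity : 0 ≤ Cc * V2)
    have b2 := mul_le_mul_of_nonneg_left a3 hV1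
    linarith
  refine abs_le_of_sq_le_sq ?_ (by positivity)
  refine h6.trans ?_
  rw [mul_pow]
  refine mul_le_mul_of_nonneg_right ?_ (by positivity)
  nlinarith

end
end

noncomputable section

section
variable {d : ℕ} {U V : Set (ℝ × EE d)} {w w' : ℝ × EE d → ℝ} {P F P' F' : ℝ × EE d → EE d}

lemma WSol.mono (h : WSol U w P F) (hV : IsOpen V) (hVU : V ⊆ U) : WSol V w P F :=
  ⟨hV, h.contw.mono hVU, h.contP.mono hVU, fun z hz => h.grad z (hVU hz), h.locF.mono_set hVU,
    fun φ h1 h2 h3 => h.weak φ h1 h2 (h3.trans hVU)⟩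

lemma WSol.integ1 (h : WSol U w P F) {φ : ℝ × EE d → ℝ} (hφ : ContDiff ℝ (⊤ : ℕ∞) φ)
    (hc : HasCompactSupport φ) (hs : tsupport φ ⊆ U) :
    Integrable (fun z => w z * fderiv ℝ φ z (1, 0)) := by
  have hd : Continuous (fun z => fderiv ℝ φ z (1, 0)) :=
    (hφ.continuous_fderiv (by simp)).clm_apply continuous_const
  have hc1 : IsCompact (tsupport φ) := hc
  have h1 : IntegrableOn (fun z => w z * fderiv ℝ φ z (1, 0)) (tsupport φ) :=
    ContinuousOn.integrableOn_compact hc1 ((h.contw.mono hs).mul hd.continuousOn)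
  refine (integrableOn_iff_integrable_of_support_subset ?_).1 h1
  intro z hz
  by_contra hcon
  apply hz
  have : fderiv ℝ φ z = 0 := by
    by_contra h2
    exact hcon (support_fderiv_subset ℝ h2)
  simp [this]

lemma WSol.integ2 (h : WSol U w P F) {φ : ℝ × EE d → ℝ} (hφ : ContDiff ℝ (⊤ : ℕ∞) φ)
    (hc : HasCompactSupport φ) (hs : tsupport φ ⊆ U) :
    Integrable (fun z => fderiv ℝ φ z (0, F z)) := by
  have hd : Continuous (fun z => fderiv ℝ φ z) := hφ.continuous_fderiv (by simp)
  have hc1 : IsCompact (tsupport φ) := hc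
  have hF : IntegrableOn F (tsupport φ) := h.locF.integrableOn_compact_subset hs hc1
  have h0 : IntegrableOn (fun z => ((0:ℝ), F z)) (tsupport φ) :=
    (integrable_zero _ _ _).prodMk hF
  obtain ⟨c, hcb⟩ := hd.bounded_above_of_compact_support (hc.fderiv (𝕜 := ℝ))
  have h1 : IntegrableOn (fun z => fderiv ℝ φ z (0, F z)) (tsupport φ) := by
    refine Integrable.mono' (g := fun z => c * ‖((0:ℝ), F z)‖) (h0.norm.const_mul c) ?_ ?_
    · have := hd.aestronglyMeasurable (μ := volume.restrict (tsupport φ))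
      exact (isBoundedBilinearMap_apply (𝕜 := ℝ) (E := ℝ × EE d) (F := ℝ)).continuous.comp_aestronglyMeasurable
        (this.prodMk h0.aestronglyMeasurable)
    · refine ae_of_all _ fun z => ?_
      exact (fderiv ℝ φ z).le_of_opNorm_le (hcb z) _
  refine (integrableOn_iff_integrable_of_support_subset ?_).1 h1
  intro z hz
  by_contra hcon
  apply hz
  have : fderiv ℝ φ z = 0 := by
    by_contra h2
    exact hcon (support_fderiv_subset ℝ h2)
  simp [this]

lemma WSol.sub (h : WSol U w P F) (h' : WSol U w' P' F') :
    WSol U (fun z => w z - w' z) (fun z => P z - P' z) (fun z => F z - F' z) := by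
  refine ⟨h.isOpen, h.contw.sub h'.contw, h.contP.sub h'.contP, fun z hz => ?_,
    h.locF.sub h'.locF, fun φ h1 h2 h3 => ?_⟩
  · rw [map_sub]; exact (h.grad z hz).sub (h'.grad z hz)
  · have e1 : ∀ z, (w z - w' z) * fderiv ℝ φ z (1, 0) =
      w z * fderiv ℝ φ z (1, 0) - w' z * fderiv ℝ φ z (1, 0) := fun z => by ring
    have e2 : ∀ z, fderiv ℝ φ z (0, F z - F' z) = fderiv ℝ φ z (0, F z) - fderiv ℝ φ z (0, F' z) :=
      fun z => by rw [← map_sub]; simp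
    simp_rw [e1, e2]
    rw [integral_sub (h.integ1 h1 h2 h3) (h'.integ1 h1 h2 h3),
      integral_sub (h.integ2 h1 h2 h3) (h'.integ2 h1 h2 h3), h.weak φ h1 h2 h3, h'.weak φ h1 h2 h3]

/-- parabolic dilation. -/
def dil (d : ℕ) (r : ℝ) (hr : r ≠ 0) : (ℝ × EE d) ≃L[ℝ] (ℝ × EE d) :=
  (ContinuousLinearEquiv.smulLeft (Units.mk0 (r ^ 2) (pow_ne_zero 2 hr))).prodCongr
    (ContinuousLinearEquiv.smulLeft (Units.mk0 r hr))

lemma dil_apply (r : ℝ) (hr : r ≠ 0) (z : ℝ × EE d) : dil d r hr z = (r ^ 2 * z.1, r • z.2) := rfl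

lemma dil_symm_apply (r : ℝ) (hr : r ≠ 0) (z : ℝ × EE d) :
    (dil d r hr).symm z = ((r ^ 2)⁻¹ * z.1, r⁻¹ • z.2) := by
  apply (dil d r hr).injective
  rw [ContinuousLinearEquiv.apply_symm_apply, dil_apply]
  ext1
  · simp; field_simp
  · simp [smul_smul, hr]

/-- parabolic affine map. -/
def aff (r : ℝ) (z0 z : ℝ × EE d) : ℝ × EE d := (z0.1 + r ^ 2 * z.1, z0.2 + r • z.2)

lemma aff_eq (r : ℝ) (hr : r ≠ 0) (z0 z : ℝ × EE d) : aff r z0 z = z0 + dil d r hr z := rfl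

def affH (r : ℝ) (hr : r ≠ 0) (z0 : ℝ × EE d) : (ℝ × EE d) ≃ₜ (ℝ × EE d) :=
  (dil d r hr).toHomeomorph.trans (Homeomorph.addLeft z0)

lemma affH_apply (r : ℝ) (hr : r ≠ 0) (z0 z : ℝ × EE d) : affH r hr z0 z = aff r z0 z := rfl

lemma affH_symm_apply (r : ℝ) (hr : r ≠ 0) (z0 z : ℝ × EE d) :
    (affH r hr z0).symm z = (dil d r hr).symm (-z0 + z) := rfl

lemma aff_map (r : ℝ) (hr : r ≠ 0) (z0 : ℝ × EE d) : ∃ c : ENNReal, c ≠ ⊤ ∧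
    Measure.map (affH r hr z0) volume = c • volume := by
  have hdet : LinearMap.det ((dil d r hr : (ℝ × EE d) →L[ℝ] (ℝ × EE d)) : (ℝ × EE d) →ₗ[ℝ] (ℝ × EE d)) ≠ 0 :=
    (LinearEquiv.isUnit_det' (dil d r hr).toLinearEquiv).ne_zero
  obtain ⟨c, h1⟩ : ∃ c : ℝ, Measure.map (dil d r hr) (volume : Measure (ℝ × EE d)) =
      ENNReal.ofReal c • volume :=
    ⟨_, Measure.map_linearMap_addHaar_eq_smul_addHaar (volume : Measure (ℝ × EE d)) hdet⟩
  refine ⟨ENNReal.ofReal c, ENNReal.ofReal_ne_top, ?_⟩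
  have h2 : (affH r hr z0 : ℝ × EE d → ℝ × EE d) = (fun z => z0 + z) ∘ (dil d r hr) := rfl
  rw [h2, ← Measure.map_map (by fun_prop) (dil d r hr).continuous.measurable]
  rw [h1, Measure.map_smul, map_add_left_eq_self]

lemma aff_integral (r : ℝ) (hr : r ≠ 0) (z0 : ℝ × EE d) : ∃ c : ℝ, ∀ g : ℝ × EE d → ℝ,
    ∫ z, g (aff r z0 z) = c * ∫ z, g z := by
  obtain ⟨c, -, hc⟩ := aff_map r hr z0
  refine ⟨c.toReal, fun g => ?_⟩
  have := (affH r hr z0).measurableEmbedding.integral_map (μ := volume) g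
  rw [hc, integral_smul_measure, smul_eq_mul] at this
  exact this.symm

lemma aff_cont (r : ℝ) (z0 : ℝ × EE d) : Continuous (aff r z0) := by
  unfold aff; fun_prop

lemma WSol.affine (h : WSol U w P F) {r : ℝ} (hr : 0 < r) (z0 : ℝ × EE d) :
    WSol (aff r z0 ⁻¹' U) (fun z => w (aff r z0 z)) (fun z => r • P (aff r z0 z))
      (fun z => r • F (aff r z0 z)) := by
  have hA := aff_cont r z0
  refine ⟨h.isOpen.preimage hA, h.contw.comp hA.continuousOn fun z hz => hz,
    (h.contP.comp hA.continuousOn fun z hz => hz).const_smul r, fun z hz => ?_, ?_,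
    fun φ h1 h2 h3 => ?_⟩
  · have g1 := h.grad _ hz
    have g2 : HasFDerivAt (fun y : EE d => z0.2 + r • y) (r • ContinuousLinearMap.id ℝ (EE d)) z.2 :=
      ((hasFDerivAt_id z.2).const_smul r).const_add z0.2
    have g3 := HasFDerivAt.comp z.2 (f := fun y : EE d => z0.2 + r • y) g1 g2
    have hL : innerSL ℝ (r • P (aff r z0 z)) =
        (innerSL ℝ (P (aff r z0 z))).comp (r • ContinuousLinearMap.id ℝ (EE d)) := by
      ext y
      simp [innerSL_apply_apply, inner_smul_left, inner_smul_right]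
    rw [hL]
    exact g3
  · have h0 := h.locF
    rw [locallyIntegrableOn_iff (h.isOpen.isLocallyClosed)] at h0
    rw [locallyIntegrableOn_iff ((h.isOpen.preimage hA).isLocallyClosed)]
    intro k hk hkc
    refine Integrable.smul r ?_
    have hi := h0 (aff r z0 '' k) (by rintro _ ⟨z, hz, rfl⟩; exact hk hz) (hkc.image hA)
    obtain ⟨c, hct, hc⟩ := aff_map (d := d) r hr.ne' z0
    have me := (affH r hr.ne' z0).measurableEmbedding
    have h5 : IntegrableOn F (aff r z0 '' k) (Measure.map (affH r hr.ne' z0) volume) := by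
      rw [hc]; rw [IntegrableOn, Measure.restrict_smul]; exact Integrable.smul_measure hi hct
    rw [me.integrableOn_map_iff] at h5
    refine h5.mono_set fun z hz => ⟨z, hz, rfl⟩
  · obtain ⟨c, hc⟩ := aff_integral (d := d) r hr.ne' z0
    set T := affH (d := d) r hr.ne' z0 with hT
    set ψ : ℝ × EE d → ℝ := fun z => φ (T.symm z) with hψ
    have hTs : ContDiff ℝ (⊤ : ℕ∞) (T.symm : ℝ × EE d → ℝ × EE d) := by
      have : (T.symm : ℝ × EE d → ℝ × EE d) = fun z => (dil d r hr.ne').symm (-z0 + z) := rfl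
      rw [this]
      exact (dil d r hr.ne').symm.contDiff.comp (contDiff_const.add contDiff_id)
    have hψs : ContDiff ℝ (⊤ : ℕ∞) ψ := h1.comp hTs
    have hψc : HasCompactSupport ψ := h2.comp_homeomorph T.symm
    have hψt : tsupport ψ ⊆ U := by
      have : tsupport ψ = T.symm ⁻¹' (tsupport φ) := by
        exact tsupport_comp_eq_preimage φ T.symm
      rw [this]
      intro z hz
      have := h3 hz
      have e : aff r z0 (T.symm z) = z := T.apply_symm_apply z
      rw [mem_preimage, e] at this
      exact this
    have hfd : ∀ z, fderiv ℝ φ z = (fderiv ℝ ψ (aff r z0 z)).comp (dil d r hr.ne' : (ℝ × EE d) →L[ℝ] _) := by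
      intro z
      have e : φ = ψ ∘ (aff r z0) := by
        ext y
        simp only [hψ, Function.comp]
        congr 1
        exact (T.symm_apply_apply y).symm
      have hA1 : HasFDerivAt (aff r z0) (dil d r hr.ne' : (ℝ × EE d) →L[ℝ] _) z := by
        have := (dil d r hr.ne').hasFDerivAt (x := z)
        exact this.const_add z0
      have hp : DifferentiableAt ℝ ψ (aff r z0 z) := (hψs.differentiable (by simp)) _
      conv_lhs => rw [e]
      exact (hp.hasFDerivAt.comp z hA1).fderiv
    have e1 : ∀ z, w (aff r z0 z) * fderiv ℝ φ z (1, 0) =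
        r ^ 2 * (w (aff r z0 z) * fderiv ℝ ψ (aff r z0 z) (1, 0)) := by
      intro z
      rw [hfd z]
      have : (dil d r hr.ne') (1, 0) = r ^ 2 • ((1:ℝ), (0 : EE d)) := by
        rw [dil_apply]; simp
      rw [ContinuousLinearMap.comp_apply, ContinuousLinearEquiv.coe_coe, this, map_smul, smul_eq_mul]
      ring
    have e2 : ∀ z, fderiv ℝ φ z (0, r • F (aff r z0 z)) =
        r ^ 2 * (fderiv ℝ ψ (aff r z0 z) (0, F (aff r z0 z))) := by
      intro z
      rw [hfd z]
      have : (dil d r hr.ne') (0, r • F (aff r z0 z)) = r ^ 2 • ((0:ℝ), F (aff r z0 z)) := by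
        rw [dil_apply]; simp [smul_smul, sq]
      rw [ContinuousLinearMap.comp_apply, ContinuousLinearEquiv.coe_coe, this, map_smul, smul_eq_mul]
    simp_rw [e1, e2]
    rw [integral_const_mul, integral_const_mul, hc (fun z => w z * fderiv ℝ ψ z (1, 0)),
      hc (fun z => fderiv ℝ ψ z (0, F z)), h.weak ψ hψs hψc hψt]

/-- spatial shift -/
def sh (h : EE d) (z : ℝ × EE d) : ℝ × EE d := (z.1, z.2 + h)

/-- spatial difference -/
def dl {E : Type} [AddCommGroup E] (h : EE d) (g : ℝ × EE d → E) (z : ℝ × EE d) : E :=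
  g (sh h z) - g z

lemma sh_cont (h : EE d) : Continuous (sh h) := by unfold sh; fun_prop

lemma WSol.dl (h : WSol U w P F) (k : EE d) :
    WSol (U ∩ sh k ⁻¹' U) (dl k w) (dl k P) (dl k F) := by
  have h1 := h.affine one_pos ((0:ℝ), k)
  have e : aff 1 ((0:ℝ), k) = sh k := by
    ext z : 1
    unfold aff sh
    ext1 <;> simp [add_comm]
  rw [e] at h1
  simp only [one_smul] at h1
  have ho : IsOpen (U ∩ sh k ⁻¹' U) := h.isOpen.inter (h.isOpen.preimage (sh_cont k))
  exact (h1.mono ho inter_subset_right).sub (h.mono ho inter_subset_left)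

lemma Core.affine {ν G : ℝ} (h : Core ν G U w P F) {r : ℝ} (hr : 0 < r) (z0 : ℝ × EE d) :
    Core ν (r * G) (aff r z0 ⁻¹' U) (fun z => w (aff r z0 z)) (fun z => r • P (aff r z0 z))
      (fun z => r • F (aff r z0 z)) := by
  refine ⟨h.sol.affine hr z0, fun z hz => ?_, fun z hz => ?_⟩
  · have := h.Fb _ hz
    rw [norm_smul, norm_smul, Real.norm_eq_abs, abs_of_pos hr]
    nlinarith
  · have := h.ell _ hz
    rw [norm_smul, inner_smul_left, inner_smul_right, Real.norm_eq_abs, abs_of_pos hr]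
    simp only [conj_trivial]
    nlinarith [mul_le_mul_of_nonneg_left this (sq_nonneg r)]
end
end

noncomputable section

structure Dat {d : ℕ} (H : Submodule ℝ (EE d)) (ν K δ M : ℝ) (u : ℝ × EE d → ℝ)
    (P : ℝ × EE d → EE d) (A : ℝ × EE d → EE d →ₗ[ℝ] EE d) (f : ℝ × EE d → EE d) : Prop where
  sol : WSol (parQ d 1) u P (fun z => A z (P z) - f z)
  Ab : ∀ z ξ, ‖A z ξ‖ ≤ ν⁻¹ * ‖ξ‖
  Ae : ∀ z ξ, ν * ‖ξ‖ ^ 2 ≤ inner ℝ ξ (A z ξ)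
  Ainv : ∀ z, ∀ h ∈ H, A (sh h z) = A z
  fH : ∀ z ∈ parQ d 1, ∀ h ∈ H, sh h z ∈ parQ d 1 → ‖f (sh h z) - f z‖ ≤ K * ‖h‖ ^ δ
  ub : ∀ z ∈ parQ d 1, |u z| ≤ M

section
variable {d : ℕ} {H : Submodule ℝ (EE d)} {ν K δ M : ℝ} {u : ℝ × EE d → ℝ}
  {P : ℝ × EE d → EE d} {A : ℝ × EE d → EE d →ₗ[ℝ] EE d} {f : ℝ × EE d → EE d}

def VV (h : EE d) : ℕ → Set (ℝ × EE d)
  | 0 => parQ d 1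
  | (k + 1) => VV h k ∩ sh h ⁻¹' VV h k

lemma dl_struct {h : EE d} (hA : ∀ z, A (sh h z) = A z) (P f : ℝ × EE d → EE d) :
    dl h (fun z => A z (P z) - f z) = fun z => A z (dl h P z) - dl h f z := by
  ext1 z
  simp only [dl]
  rw [hA, map_sub]
  abel

lemma sh_sh (h k : EE d) (z : ℝ × EE d) : sh h (sh k z) = sh (k + h) z := by
  unfold sh; ext1 <;> simp [add_assoc]

lemma core_of (U : Set (ℝ × EE d)) {w : ℝ × EE d → ℝ} {P g : ℝ × EE d → EE d} {G : ℝ}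
    (h : WSol U w P (fun z => A z (P z) - g z)) (Ab : ∀ z ξ, ‖A z ξ‖ ≤ ν⁻¹ * ‖ξ‖)
    (Ae : ∀ z ξ, ν * ‖ξ‖ ^ 2 ≤ inner ℝ ξ (A z ξ)) (hg : ∀ z ∈ U, ‖g z‖ ≤ G) :
    Core ν G U w P (fun z => A z (P z) - g z) := by
  refine ⟨h, fun z hz => ?_, fun z hz => ?_⟩
  · exact (norm_sub_le _ _).trans (add_le_add (Ab _ _) (hg z hz))
  · rw [inner_sub_right]
    have h1 := real_inner_le_norm (P z) (g z)
    have h2 := mul_le_mul_of_nonneg_left (hg z hz) (norm_nonneg (P z))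
    have h3 := Ae z (P z)
    linarith

lemma three_diff (d : ℕ) (hd : 2 ≤ d) {ν : ℝ} (hν : 0 < ν) (hν1 : ν ≤ 1) :
    ∃ C, 1 ≤ C ∧ ∀ (H : Submodule ℝ (EE d)) (K δ M : ℝ) (u : ℝ × EE d → ℝ)
      (P : ℝ × EE d → EE d) (A : ℝ × EE d → EE d →ₗ[ℝ] EE d) (f : ℝ × EE d → EE d),
      Dat H ν K δ M u P A f → 0 < K → ∀ h ∈ H, h ≠ 0 → ∀ (z0 : ℝ × EE d) (r S : ℝ), 0 < r →
      ‖h‖ ≤ r / 2 → z0.1 < 0 → -1 < z0.1 - 2 * r ^ 2 → ‖z0.2‖ + 4 * r < 1 → 0 ≤ S →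
      (∀ z ∈ Box d 2, |dl h (dl h u) (aff r z0 z)| ≤ S) →
      |dl h (dl h (dl h u)) z0| ≤ C * (‖h‖ / r * S + r * (K * ‖h‖ ^ δ)) := by
  obtain ⟨C, hC, hosc⟩ := osc_lemma d hd hν hν1
  refine ⟨8 * C, by linarith, ?_⟩
  intro H K δ M u P A f hD hK h hH h0 z0 r S hr hhr ht1 ht2 hx hS hbd
  have hn : 0 < ‖h‖ := norm_pos_iff.2 h0
  set k := K * ‖h‖ ^ δ with hk
  have hk0 : 0 < k := by positivity
  have hA : ∀ z, A (sh h z) = A z := fun z => hD.Ainv z h hH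
  have s1 : WSol (VV h 1) (dl h u) (dl h P) (fun z => A z (dl h P z) - dl h f z) := by
    have := hD.sol.dl h
    rwa [dl_struct hA] at this
  have s2 : WSol (VV h 2) (dl h (dl h u)) (dl h (dl h P))
      (fun z => A z (dl h (dl h P) z) - dl h (dl h f) z) := by
    have := s1.dl h
    rwa [dl_struct hA] at this
  have s3 : WSol (VV h 3) (dl h (dl h (dl h u))) (dl h (dl h (dl h P)))
      (fun z => A z (dl h (dl h (dl h P)) z) - dl h (dl h (dl h f)) z) := by
    have := s2.dl h
    rwa [dl_struct hA] at this
  have f1 : ∀ z ∈ VV h 1, ‖dl h f z‖ ≤ k := fun z hz => hD.fH z hz.1 h hH hz.2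
  have f2 : ∀ z ∈ VV h 2, ‖dl h (dl h f) z‖ ≤ 2 * k := fun z hz => by
    refine (norm_sub_le _ _).trans ?_
    have a1 := f1 _ hz.1
    have a2 := f1 _ hz.2
    linarith
  have f3 : ∀ z ∈ VV h 3, ‖dl h (dl h (dl h f)) z‖ ≤ 4 * k := fun z hz => by
    refine (norm_sub_le _ _).trans ?_
    have a1 := f2 _ hz.1
    have a2 := f2 _ hz.2
    linarith
  have c2 := (core_of (G := 4 * k) _ s2 hD.Ab hD.Ae (fun z hz => (f2 z hz).trans (by linarith))).affine hr z0
  have c3 := (core_of (G := 4 * k) _ s3 hD.Ab hD.Ae f3).affine hr z0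
  -- membership
  have hm : ∀ z ∈ Box d 2, ∀ h' : EE d, ‖h'‖ < 2 * r → sh h' (aff r z0 z) ∈ parQ d 1 := by
    intro z hz h' hh'
    obtain ⟨⟨z1, z2⟩, z3⟩ := hz
    rw [mem_closedBall_zero_iff] at z3
    have hr2 : 0 < r ^ 2 := by positivity
    refine ⟨⟨?_, ?_⟩, ?_⟩
    · simp only [sh, aff]; nlinarith
    · simp only [sh, aff]; nlinarith
    · simp only [sh, aff, mem_ball_zero_iff]
      have e1 : ‖z0.2 + r • z.2 + h'‖ ≤ ‖z0.2‖ + r * ‖z.2‖ + ‖h'‖ := by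
        refine (norm_add_le _ _).trans (add_le_add_left ((norm_add_le _ _).trans ?_) _)
        rw [norm_smul, Real.norm_eq_abs, abs_of_pos hr]
      nlinarith
  have hm1 : ∀ z ∈ Box d 1, ∀ h' : EE d, ‖h'‖ < 3 * r → sh h' (aff r z0 z) ∈ parQ d 1 := by
    intro z hz h' hh'
    obtain ⟨⟨z1, z2⟩, z3⟩ := hz
    rw [mem_closedBall_zero_iff] at z3
    have hr2 : 0 < r ^ 2 := by positivity
    refine ⟨⟨?_, ?_⟩, ?_⟩
    · simp only [sh, aff]; nlinarith
    · simp only [sh, aff]; nlinarith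
    · simp only [sh, aff, mem_ball_zero_iff]
      have e1 : ‖z0.2 + r • z.2 + h'‖ ≤ ‖z0.2‖ + r * ‖z.2‖ + ‖h'‖ := by
        refine (norm_add_le _ _).trans (add_le_add_left ((norm_add_le _ _).trans ?_) _)
        rw [norm_smul, Real.norm_eq_abs, abs_of_pos hr]
      nlinarith
  have n2 : ‖h + h‖ ≤ 2 * ‖h‖ := (norm_add_le _ _).trans (by linarith)
  have n3 : ‖h + h + h‖ ≤ 3 * ‖h‖ := (norm_add_le _ _).trans (by linarith)
  have sh0 : ∀ z : ℝ × EE d, sh 0 z = z := fun z => by unfold sh; simp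
  have B2 : Box d 2 ⊆ aff r z0 ⁻¹' VV h 2 := by
    intro z hz
    have a0 := hm z hz 0 (by simp; linarith)
    have a1 := hm z hz h (by linarith)
    have a2 := hm z hz (h + h) (by linarith)
    rw [sh0] at a0
    rw [← sh_sh] at a2
    exact ⟨⟨a0, a1⟩, ⟨a1, a2⟩⟩
  have B1 : Box d 1 ⊆ aff r z0 ⁻¹' VV h 3 := by
    intro z hz
    have a0 := hm1 z hz 0 (by simp; linarith)
    have a1 := hm1 z hz h (by linarith)
    have a2 := hm1 z hz (h + h) (by linarith)
    have a3 := hm1 z hz (h + h + h) (by linarith)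
    rw [sh0] at a0
    rw [← sh_sh] at a2 a3
    rw [← sh_sh] at a3
    exact ⟨⟨⟨a0, a1⟩, ⟨a1, a2⟩⟩, ⟨⟨a1, a2⟩, ⟨a2, a3⟩⟩⟩
  have hnr : ‖r⁻¹ • h‖ = ‖h‖ / r := by
    rw [norm_smul, norm_inv, Real.norm_eq_abs, abs_of_pos hr]; ring
  have hhr2 : ‖h‖ / r ≤ 1 / 2 := by rw [div_le_iff₀ hr]; linarith
  have key := hosc _ _ _ _ _ _ _ _ (r * (4 * k)) S (r⁻¹ • h) (by positivity) hS c2 B2 hbd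
    (by rw [hnr]; exact hhr2) c3 B1 (fun z hz => by
      have e : aff r z0 (z.1, z.2 + r⁻¹ • h) = sh h (aff r z0 z) := by
        unfold aff sh
        ext1
        · simp
        · simp [smul_smul, hr.ne', add_assoc]
      rw [e]; rfl)
  have e0 : aff r z0 0 = z0 := by unfold aff; ext1 <;> simp
  rw [e0, hnr] at key
  refine key.trans ?_
  have hq0 : 0 ≤ ‖h‖ / r := by positivity
  have hrk : 0 < r * k := by positivity
  rw [mul_comm 8 C, mul_assoc]
  refine mul_le_mul_of_nonneg_left ?_ (by linarith)
  have := mul_le_mul_of_nonneg_right hhr2 hrk.le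
  have := mul_nonneg hq0 hS
  nlinarith
end
end

noncomputable section

section
variable {d : ℕ} {H : Submodule ℝ (EE d)} {ν K δ M : ℝ} {u : ℝ × EE d → ℝ}
  {P : ℝ × EE d → EE d} {A : ℝ × EE d → EE d →ₗ[ℝ] EE d} {f : ℝ × EE d → EE d}

lemma dl_identity (h : EE d) (u : ℝ × EE d → ℝ) (z : ℝ × EE d) :
    dl h (dl h u) z = 1 / 4 * (dl (h + h) (dl (h + h) u) z - 3 * dl h (dl h (dl h u)) z -
      dl h (dl h (dl h u)) (sh h z)) := by
  simp only [dl, sh_sh, ← add_assoc]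
  ring

lemma parQ_mono {s s' : ℝ} (h0 : 0 ≤ s) (h : s ≤ s') : parQ d s ⊆ parQ d s' := by
  refine prod_mono (Ioo_subset_Ioo_left ?_) (ball_subset_ball h)
  have := pow_le_pow_left₀ h0 h 2
  linarith

lemma parQ_sh {s s' : ℝ} {z : ℝ × EE d} (hz : z ∈ parQ d s) (h0 : 0 ≤ s) {k : EE d}
    (hk : s + ‖k‖ ≤ s') : sh k z ∈ parQ d s' := by
  have h1 : s ≤ s' := by linarith [norm_nonneg k]
  refine ⟨(parQ_mono h0 h1 hz).1, ?_⟩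
  have := hz.2
  rw [mem_ball_zero_iff] at this ⊢
  have h2 := norm_add_le z.2 k
  simp only [sh]
  linarith

lemma dl2_bound (hu : ∀ z ∈ parQ d 1, |u z| ≤ M) {z : ℝ × EE d} {h : EE d} {s : ℝ}
    (hz : z ∈ parQ d s) (h0 : 0 ≤ s) (hh : s + 2 * ‖h‖ ≤ 1) : |dl h (dl h u) z| ≤ 4 * M := by
  have hn := norm_nonneg h
  have n2 : ‖h + h‖ ≤ 2 * ‖h‖ := (norm_add_le _ _).trans (by linarith)
  have a0 := abs_le.1 (hu _ (parQ_mono h0 (by linarith) hz))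
  have a1 := abs_le.1 (hu _ (parQ_sh hz h0 (k := h) (by linarith)))
  have a2 := abs_le.1 (hu _ (parQ_sh hz h0 (k := h + h) (by linarith)))
  simp only [dl, sh_sh]
  rw [abs_le]; constructor <;> linarith

lemma aff_mem {s R : ℝ} {z0 z : ℝ × EE d} {r : ℝ} (hz0 : z0 ∈ parQ d s) (h0 : 0 ≤ s) (hr : 0 < r)
    (hz : z ∈ Box d 2) (hR : s + 2 * r ≤ R) : aff r z0 z ∈ parQ d R := by
  obtain ⟨⟨z1, z2⟩, z3⟩ := hz
  obtain ⟨⟨y1, y2⟩, y3⟩ := hz0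
  rw [mem_closedBall_zero_iff] at z3
  rw [mem_ball_zero_iff] at y3
  have hr2 : 0 < r ^ 2 := by positivity
  refine ⟨⟨?_, ?_⟩, ?_⟩
  · simp only [aff]; nlinarith [mul_nonneg h0 hr.le, pow_le_pow_left₀ (by positivity : 0 ≤ s + 2 * r) hR 2]
  · simp only [aff]; nlinarith
  · simp only [aff, mem_ball_zero_iff]
    have e1 : ‖z0.2 + r • z.2‖ ≤ ‖z0.2‖ + r * ‖z.2‖ := by
      refine (norm_add_le _ _).trans ?_
      rw [norm_smul, Real.norm_eq_abs, abs_of_pos hr]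
    nlinarith

def PP (H : Submodule ℝ (EE d)) (u : ℝ × EE d → ℝ) (δ ε h0 Θ : ℝ) : Prop :=
  ∀ h ∈ H, ε ≤ ‖h‖ → ‖h‖ ≤ h0 → ∀ s, 0 < s → s < 3 / 4 → ∀ z ∈ parQ d s,
    (3 / 4 - s) ^ 2 * |dl h (dl h u) z| ≤ Θ * ‖h‖ ^ (1 + δ)

set_option maxHeartbeats 1000000 in
lemma diff_step (d : ℕ) (hd : 2 ≤ d) {ν δ : ℝ} (hν : 0 < ν) (hν1 : ν ≤ 1) (hδ : 0 < δ) (hδ1 : δ < 1) :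
    ∃ γ A0 h0 : ℝ, 0 ≤ γ ∧ γ < 1 ∧ 0 ≤ A0 ∧ 0 < h0 ∧ h0 ≤ 1 / 128 ∧
      ∀ (H : Submodule ℝ (EE d)) (K M : ℝ) (u : ℝ × EE d → ℝ)
      (P : ℝ × EE d → EE d) (A : ℝ × EE d → EE d →ₗ[ℝ] EE d) (f : ℝ × EE d → EE d),
      Dat H ν K δ M u P A f → 0 < K → 0 ≤ M → ∀ ε Θ : ℝ, 0 < ε → 0 ≤ Θ → PP H u δ ε h0 Θ →
      PP H u δ ε h0 (γ * Θ + A0 * (K + M)) := by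
  obtain ⟨C, hC, h3⟩ := three_diff d hd hν hν1
  set g0 : ℝ := 2 ^ (δ - 1) with hg0
  have hg0p : 0 < g0 := by positivity
  have hg1 : g0 < 1 := Real.rpow_lt_one_of_one_lt_of_neg (by norm_num) (by linarith)
  set R : ℝ := max 2 (8 * C / (1 - g0)) with hR
  have hR2 : 2 ≤ R := le_max_left _ _
  have hR0 : 0 < R := by linarith
  have hRC : 4 * C / R ≤ (1 - g0) / 2 := by
    have : 8 * C / (1 - g0) ≤ R := le_max_right _ _
    rw [div_le_iff₀ (by linarith)] at this
    rw [div_le_iff₀ hR0]; linarith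
  set L : ℝ := 2 * R + 1 with hL
  set h0 : ℝ := 1 / (64 * R) with hh0
  have hh00 : 0 < h0 := by positivity
  have hRh : R * h0 = 1 / 64 := by rw [hh0]; field_simp
  have hh01 : h0 ≤ 1 / 128 := by nlinarith
  refine ⟨g0 + 4 * C / R, 16 / h0 ^ 2 + 16 * L ^ 2 + C * R, h0, by positivity, by linarith,
    by positivity, hh00, hh01, ?_⟩
  intro H K M u P A f hD hK hM ε Θ hε hΘ hP h hH hεh hhh s hs hs1 z hz
  have hn : 0 < ‖h‖ := hε.trans_le hεh
  have hne : h ≠ 0 := norm_pos_iff.1 hn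
  set N := ‖h‖ with hN
  have hN1 : N ≤ 1 := by linarith
  have hpow : N ^ 2 ≤ N ^ (1 + δ) := by
    rw [← Real.rpow_natCast]
    exact Real.rpow_le_rpow_of_exponent_ge hn hN1 (by push_cast; linarith)
  have hpp : 0 < N ^ (1 + δ) := by positivity
  have hsig : (3 / 4 - s) ^ 2 ≤ 1 := by nlinarith
  have htriv : |dl h (dl h u) z| ≤ 4 * M := dl2_bound hD.ub hz hs.le (by linarith)
  have hCR : 0 ≤ C * R := by positivity
  have hcoef : 0 ≤ g0 + 4 * C / R := by positivity
  set X := |dl h (dl h u) z| with hX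
  have hX0 : 0 ≤ X := abs_nonneg _
  set σ := 3 / 4 - s with hσ
  have hσ0 : 0 < σ := by rw [hσ]; linarith
  by_cases hc1 : h0 < 2 * N
  · -- large h
    have a1 : σ ^ 2 * X ≤ 4 * M := by nlinarith
    have a2 : 4 * M ≤ 16 / h0 ^ 2 * M * N ^ 2 := by
      have : 1 ≤ 4 * N ^ 2 / h0 ^ 2 := by
        rw [le_div_iff₀ (by positivity)]; nlinarith
      calc 4 * M ≤ 4 * M * (4 * N ^ 2 / h0 ^ 2) := le_mul_of_one_le_right (by linarith) this
        _ = _ := by ring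
    have a3 : 16 / h0 ^ 2 * M * N ^ 2 ≤ 16 / h0 ^ 2 * M * N ^ (1 + δ) :=
      mul_le_mul_of_nonneg_left hpow (by positivity)
    refine a1.trans (a2.trans (a3.trans (mul_le_mul_of_nonneg_right ?_ hpp.le)))
    have : 0 ≤ (g0 + 4 * C / R) * Θ := by positivity
    have b1 : 0 ≤ 16 / h0 ^ 2 * K := by positivity
    have b2 : 0 ≤ (16 * L ^ 2 + C * R) * (K + M) := by positivity
    linarith
  by_cases hc2 : σ < 2 * L * N
  · have hL0 : 0 < L := by positivity
    have a1 : σ ^ 2 * X ≤ (2 * L * N) ^ 2 * (4 * M) := by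
      gcongr
    have a3 : 16 * L ^ 2 * M * N ^ 2 ≤ 16 * L ^ 2 * M * N ^ (1 + δ) :=
      mul_le_mul_of_nonneg_left hpow (by positivity)
    have e : (2 * L * N) ^ 2 * (4 * M) = 16 * L ^ 2 * M * N ^ 2 := by ring
    rw [e] at a1
    refine a1.trans (a3.trans (mul_le_mul_of_nonneg_right ?_ hpp.le))
    have : 0 ≤ (g0 + 4 * C / R) * Θ := by positivity
    have b1 : 0 ≤ 16 * L ^ 2 * K := by positivity
    have b2 : 0 ≤ (16 / h0 ^ 2 + C * R) * (K + M) := by positivity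
    linarith
  push Not at hc1 hc2
  have hRN : R * N ≤ 1 / 64 := by rw [← hRh]; gcongr
  have hRN0 : 0 < R * N := by positivity
  set s' := s + L * N with hs'
  have hs'1 : s' < 3 / 4 := by
    have : 0 < L * N := by positivity
    rw [hs']; linarith
  have hs'0 : 0 < s' := by positivity
  have hσ' : σ / 2 ≤ 3 / 4 - s' := by rw [hs']; linarith
  set S := 4 * (Θ * N ^ (1 + δ)) / σ ^ 2 with hS
  have hS0 : 0 ≤ S := by positivity
  -- the third differences
  have hthird : ∀ z0 ∈ parQ d (s + N), |dl h (dl h (dl h u)) z0| ≤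
      C * (N / (R * N) * S + R * N * (K * N ^ δ)) := by
    intro z0 hz0
    have hz0' := hz0
    obtain ⟨⟨t1, t2⟩, t3⟩ := hz0'
    rw [mem_ball_zero_iff] at t3
    refine h3 H K δ M u P A f hD hK h hH hne z0 (R * N) S hRN0 ?_ t2 ?_ ?_ hS0 ?_
    · rw [← hN]
      have := mul_le_mul_of_nonneg_right hR2 hn.le
      linarith
    · have c1 : (s + N) ^ 2 ≤ (4 / 5) ^ 2 := pow_le_pow_left₀ (by positivity) (by linarith) 2
      have c2 : (R * N) ^ 2 ≤ (1 / 64) ^ 2 := pow_le_pow_left₀ hRN0.le hRN 2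
      norm_num at c1 c2
      linarith
    · linarith
    · intro y hy
      have hmem : aff (R * N) z0 y ∈ parQ d s' :=
        aff_mem hz0 (by positivity) hRN0 hy (by rw [hs', hL]; linarith)
      have b := hP h hH hεh hhh s' hs'0 hs'1 _ hmem
      rw [hS, le_div_iff₀ (by positivity)]
      have b2 : (σ / 2) ^ 2 * |dl h (dl h u) (aff (R * N) z0 y)| ≤
        (3 / 4 - s') ^ 2 * |dl h (dl h u) (aff (R * N) z0 y)| := by gcongr
      have b3 : (σ / 2) ^ 2 = σ ^ 2 / 4 := by ring
      rw [b3] at b2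
      linarith
  have t1 := hthird z (parQ_mono hs.le (by linarith) hz)
  have t2 := hthird (sh h z) (parQ_sh hz hs.le le_rfl)
  have e1 : N / (R * N) * S + R * N * (K * N ^ δ) =
      (4 / R * Θ / σ ^ 2 + R * K) * N ^ (1 + δ) := by
    rw [hS, Real.rpow_one_add' hn.le (by linarith)]
    field_simp
  rw [e1] at t1 t2
  have n2 : ‖h + h‖ = 2 * N := by rw [← two_smul ℝ h, norm_smul]; simp [hN]
  have t3 := hP (h + h) (H.add_mem hH hH) (by rw [n2]; linarith) (by rw [n2]; exact hc1) s hs hs1 z hz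
  rw [n2, Real.mul_rpow (by norm_num) hn.le] at t3
  have e2 : (2:ℝ) ^ (1 + δ) = 4 * g0 := by
    have : (4:ℝ) = 2 ^ (2:ℝ) := by norm_num
    rw [hg0, this, ← Real.rpow_add (by norm_num)]
    congr 1; ring
  rw [e2] at t3
  have hXle : X ≤ 1 / 4 * (|dl (h + h) (dl (h + h) u) z| + 3 * |dl h (dl h (dl h u)) z| +
      |dl h (dl h (dl h u)) (sh h z)|) := by
    rw [hX, dl_identity]
    rw [abs_mul, abs_of_pos (by norm_num : (0:ℝ) < 1 / 4)]
    refine mul_le_mul_of_nonneg_left ?_ (by norm_num)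
    refine (abs_sub _ _).trans (add_le_add_left ((abs_sub _ _).trans ?_) _)
    rw [abs_mul, abs_of_pos (by norm_num : (0:ℝ) < 3)]
  have hσ2 : 0 < σ ^ 2 := by positivity
  have m1 := mul_le_mul_of_nonneg_left t1 hσ2.le
  have m2 := mul_le_mul_of_nonneg_left t2 hσ2.le
  have m0 := mul_le_mul_of_nonneg_left hXle hσ2.le
  have e3 : σ ^ 2 * (C * ((4 / R * Θ / σ ^ 2 + R * K) * N ^ (1 + δ))) =
      (4 * C / R * Θ + σ ^ 2 * (C * R * K)) * N ^ (1 + δ) := by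
    field_simp
  have e4 : σ ^ 2 * (C * R * K) ≤ C * R * K := mul_le_of_le_one_left (by positivity) hsig
  have e5 : (4 * C / R * Θ + σ ^ 2 * (C * R * K)) * N ^ (1 + δ) ≤
    (4 * C / R * Θ + C * R * K) * N ^ (1 + δ) := by gcongr
  rw [e3] at m1 m2
  have fin : σ ^ 2 * X ≤ (g0 * Θ + (4 * C / R * Θ + C * R * K)) * N ^ (1 + δ) := by
    have m0' : σ ^ 2 * X ≤ 1 / 4 * (σ ^ 2 * |dl (h + h) (dl (h + h) u) z|) +
      3 / 4 * (σ ^ 2 * |dl h (dl h (dl h u)) z|) + 1 / 4 * (σ ^ 2 * |dl h (dl h (dl h u)) (sh h z)|) := by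
      linarith
    have : g0 * Θ * N ^ (1 + δ) = 1 / 4 * (Θ * (4 * g0 * N ^ (1 + δ))) := by ring
    rw [← hσ] at t3
    rw [add_mul (g0 * Θ), this]
    linarith
  refine fin.trans (mul_le_mul_of_nonneg_right ?_ hpp.le)
  have b1 : 0 ≤ C * R * M := by positivity
  have b2 : 0 ≤ (16 / h0 ^ 2 + 16 * L ^ 2) * (K + M) := by positivity
  linarith

lemma second_diff (d : ℕ) (hd : 2 ≤ d) {ν δ : ℝ} (hν : 0 < ν) (hν1 : ν ≤ 1) (hδ : 0 < δ) (hδ1 : δ < 1) :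
    ∃ B h0 : ℝ, 0 ≤ B ∧ 0 < h0 ∧ h0 ≤ 1 / 128 ∧
      ∀ (H : Submodule ℝ (EE d)) (K M : ℝ) (u : ℝ × EE d → ℝ)
      (P : ℝ × EE d → EE d) (A : ℝ × EE d → EE d →ₗ[ℝ] EE d) (f : ℝ × EE d → EE d),
      Dat H ν K δ M u P A f → 0 < K → 0 ≤ M → ∀ h ∈ H, ‖h‖ ≤ h0 → ∀ z ∈ parQ d (5 / 8),
      |dl h (dl h u) z| ≤ B * (K + M) * ‖h‖ ^ (1 + δ) := by
  obtain ⟨γ, A0, h0, hγ0, hγ1, hA0, hh0, hh1, hstep⟩ := diff_step d hd hν hν1 hδ hδ1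
  have hg : 0 < 1 - γ := by linarith
  refine ⟨64 * (A0 / (1 - γ)), h0, by positivity, hh0, hh1, ?_⟩
  intro H K M u P A f hD hK hM h hH hhh z hz
  rcases eq_or_ne h 0 with rfl | hne
  · have : dl (0 : EE d) (dl 0 u) z = 0 := by simp [dl, sh]
    rw [this, abs_zero]; positivity
  have hn : 0 < ‖h‖ := norm_pos_iff.2 hne
  set Θ0 := 4 * M / ‖h‖ ^ (1 + δ) with hΘ0
  have hΘ0' : 0 ≤ Θ0 := by positivity
  set a := A0 * (K + M) / (1 - γ) with ha
  have ha0 : 0 ≤ a := by positivity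
  have h_init : PP H u δ ‖h‖ h0 (Θ0 + a) := by
    intro k hk hk1 hk2 s hs hs1 y hy
    have b : |dl k (dl k u) y| ≤ 4 * M := dl2_bound hD.ub hy hs.le (by linarith)
    have hsig : (3 / 4 - s) ^ 2 ≤ 1 := by nlinarith
    have c1 : (3 / 4 - s) ^ 2 * |dl k (dl k u) y| ≤ 4 * M := by
      have := abs_nonneg (dl k (dl k u) y)
      nlinarith
    refine c1.trans ?_
    have c2 : ‖h‖ ^ (1 + δ) ≤ ‖k‖ ^ (1 + δ) := Real.rpow_le_rpow hn.le hk1 (by linarith)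
    calc 4 * M = Θ0 * ‖h‖ ^ (1 + δ) := by rw [hΘ0]; field_simp
      _ ≤ (Θ0 + a) * ‖k‖ ^ (1 + δ) := by gcongr; linarith
  have all : ∀ n : ℕ, PP H u δ ‖h‖ h0 (γ ^ n * Θ0 + a) := by
    intro n
    induction n with
    | zero => simpa using h_init
    | succ n ih =>
      have := hstep H K M u P A f hD hK hM ‖h‖ _ hn (by positivity) ih
      have e : γ * (γ ^ n * Θ0 + a) + A0 * (K + M) = γ ^ (n + 1) * Θ0 + a := by
        rw [ha]; field_simp; ring
      rwa [e] at this
  have lim : (3 / 4 - 5 / 8) ^ 2 * |dl h (dl h u) z| ≤ (0 * Θ0 + a) * ‖h‖ ^ (1 + δ) := by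
    refine ge_of_tendsto' (x := atTop) (f := fun n : ℕ => (γ ^ n * Θ0 + a) * ‖h‖ ^ (1 + δ)) ?_ fun n =>
      all n h hH le_rfl hhh (5 / 8) (by norm_num) (by norm_num) z hz
    exact (((tendsto_pow_atTop_nhds_zero_of_lt_one hγ0 hγ1).mul_const _).add_const _).mul_const _
  have e : 64 * (A0 / (1 - γ)) * (K + M) * ‖h‖ ^ (1 + δ) = 64 * (a * ‖h‖ ^ (1 + δ)) := by
    rw [ha]; ring
  rw [e]
  norm_num at lim
  linarith
end
end

noncomputable section

/-- first order Taylor remainder -/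
def TR {d : ℕ} (u : ℝ × EE d → ℝ) (P : ℝ × EE d → EE d) (z : ℝ × EE d) (h : EE d) : ℝ :=
  u (sh h z) - u z - inner ℝ (P z) h

lemma TR_half {d : ℕ} (u : ℝ × EE d → ℝ) (P : ℝ × EE d → EE d) (z : ℝ × EE d) (h : EE d) :
    TR u P z h = 2 * TR u P z ((1 / 2 : ℝ) • h) +
      dl ((1 / 2 : ℝ) • h) (dl ((1 / 2 : ℝ) • h) u) z := by
  have e : sh ((1 / 2 : ℝ) • h) (sh ((1 / 2 : ℝ) • h) z) = sh h z := by
    rw [sh_sh, ← add_smul]; norm_num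
  simp only [TR, dl, e, inner_smul_right]
  ring

set_option maxHeartbeats 1000000 in
lemma taylor (d : ℕ) (hd : 2 ≤ d) {ν δ : ℝ} (hν : 0 < ν) (hν1 : ν ≤ 1) (hδ : 0 < δ) (hδ1 : δ < 1) :
    ∃ C h0 : ℝ, 0 ≤ C ∧ 0 < h0 ∧ h0 ≤ 1 / 128 ∧
      ∀ (H : Submodule ℝ (EE d)) (K M : ℝ) (u : ℝ × EE d → ℝ)
      (P : ℝ × EE d → EE d) (A : ℝ × EE d → EE d →ₗ[ℝ] EE d) (f : ℝ × EE d → EE d),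
      Dat H ν K δ M u P A f → 0 < K → 0 ≤ M → ∀ h ∈ H, ‖h‖ ≤ h0 → ∀ z ∈ parQ d (5 / 8),
      |TR u P z h| ≤ C * (K + M) * ‖h‖ ^ (1 + δ) := by
  obtain ⟨B, h0, hB, hh0, hh1, hs⟩ := second_diff d hd hν hν1 hδ hδ1
  set r : ℝ := 2 ^ (-δ) with hr
  have hr0 : 0 < r := by positivity
  have hr1 : r < 1 := Real.rpow_lt_one_of_one_lt_of_neg (by norm_num) (by linarith)
  have hrr : 0 < 1 - r := by linarith
  refine ⟨B / (1 - r), h0, by positivity, hh0, hh1, ?_⟩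
  intro H K M u P A f hD hK hM h hH hhh z hz
  set C := B / (1 - r) with hC
  have hC0 : 0 ≤ C := by positivity
  have hhalf : ∀ k : EE d, ‖(1 / 2 : ℝ) • k‖ ^ (1 + δ) = r / 2 * ‖k‖ ^ (1 + δ) := by
    intro k
    rw [norm_smul, Real.mul_rpow (norm_nonneg _) (norm_nonneg _)]
    congr 1
    rw [Real.norm_eq_abs, abs_of_pos (by norm_num : (0:ℝ) < 1 / 2),
      Real.rpow_one_add' (by norm_num) (by linarith), hr, Real.rpow_neg (by norm_num), one_div,
      Real.inv_rpow (by norm_num)]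
    ring
  have hn2 : ∀ k : EE d, ‖(1 / 2 : ℝ) • k‖ = ‖k‖ / 2 := by
    intro k
    rw [norm_smul, Real.norm_eq_abs, abs_of_pos (by norm_num : (0:ℝ) < 1 / 2)]; ring
  have ind : ∀ n : ℕ, ∀ k ∈ H, ‖k‖ ≤ h0 → |TR u P z k| ≤
      2 ^ n * |TR u P z ((1 / 2 : ℝ) ^ n • k)| + C * (K + M) * ‖k‖ ^ (1 + δ) := by
    intro n
    induction n with
    | zero =>
      intro k _ _
      simp only [pow_zero, one_smul, one_mul]
      have : 0 ≤ C * (K + M) * ‖k‖ ^ (1 + δ) := by positivity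
      linarith
    | succ n ih =>
      intro k hk hk0
      have hk' : ‖(1 / 2 : ℝ) • k‖ ≤ h0 := by
        rw [hn2]; have := norm_nonneg k; linarith
      have a1 := ih ((1 / 2 : ℝ) • k) (H.smul_mem _ hk) hk'
      have a2 := hs H K M u P A f hD hK hM ((1 / 2 : ℝ) • k) (H.smul_mem _ hk) hk' z hz
      have a3 : |TR u P z k| ≤ 2 * |TR u P z ((1 / 2 : ℝ) • k)| +
          |dl ((1 / 2 : ℝ) • k) (dl ((1 / 2 : ℝ) • k) u) z| := by
        rw [TR_half]
        refine (abs_add_le _ _).trans ?_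
        rw [abs_mul, abs_of_pos (by norm_num : (0:ℝ) < 2)]
      rw [hhalf] at a1 a2
      rw [smul_smul, ← pow_succ] at a1
      have a4 : C * (r / 2) * 2 + B * (r / 2) ≤ C := by
        have : C * (1 - r) = B := by rw [hC]; field_simp
        rw [← this]
        have : 0 ≤ C * (1 - r) * (2 - r) := mul_nonneg (by positivity) (by linarith)
        nlinarith
      have a5 := mul_le_mul_of_nonneg_right a4
        (by positivity : 0 ≤ (K + M) * ‖k‖ ^ (1 + δ))
      rw [pow_succ]
      linarith
  have hgrad := hD.sol.grad z (parQ_mono (by norm_num) (by norm_num) hz)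
  refine le_of_forall_pos_le_add fun ε hε => ?_
  have hlim : Tendsto (fun n : ℕ => (1 / 2 : ℝ) ^ n • h) atTop (nhds 0) := by
    have := (tendsto_pow_atTop_nhds_zero_of_lt_one (r := (1 / 2 : ℝ)) (by norm_num) (by norm_num)).smul_const h
    simpa using this
  have hpos : 0 < ε / (‖h‖ + 1) := by positivity
  have hev := (hasFDerivAt_iff_isLittleO_nhds_zero.1 hgrad).bound hpos
  obtain ⟨n, hn⟩ := (hlim.eventually hev).exists
  have := ind n h hH hhh
  have e : TR u P z ((1 / 2 : ℝ) ^ n • h) = u (z.1, z.2 + (1 / 2 : ℝ) ^ n • h) - u (z.1, z.2) -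
      (innerSL ℝ (P z)) ((1 / 2 : ℝ) ^ n • h) := by
    simp only [TR, sh, innerSL_apply_apply]
  rw [← e, norm_smul, Real.norm_eq_abs, norm_pow, Real.norm_eq_abs,
    abs_of_pos (by norm_num : (0:ℝ) < 1 / 2)] at hn
  have h2 : (2:ℝ) ^ n * |TR u P z ((1 / 2 : ℝ) ^ n • h)| ≤ ε := by
    calc (2:ℝ) ^ n * |TR u P z ((1 / 2 : ℝ) ^ n • h)|
        ≤ 2 ^ n * (ε / (‖h‖ + 1) * ((1 / 2) ^ n * ‖h‖)) := by gcongr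
      _ = ((2:ℝ) * (1 / 2)) ^ n * (ε * (‖h‖ / (‖h‖ + 1))) := by rw [mul_pow]; ring
      _ = ε * (‖h‖ / (‖h‖ + 1)) := by norm_num
      _ ≤ ε := by
        refine mul_le_of_le_one_right hε.le ?_
        rw [div_le_one (by positivity)]; linarith
  linarith

set_option maxHeartbeats 1000000 in
lemma grad_holder (d : ℕ) (hd : 2 ≤ d) {ν δ : ℝ} (hν : 0 < ν) (hν1 : ν ≤ 1) (hδ : 0 < δ) (hδ1 : δ < 1) :
    ∃ C : ℝ, 0 ≤ C ∧
      ∀ (H : Submodule ℝ (EE d)) (K M : ℝ) (u : ℝ × EE d → ℝ)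
      (P : ℝ × EE d → EE d) (A : ℝ × EE d → EE d →ₗ[ℝ] EE d) (f : ℝ × EE d → EE d),
      Dat H ν K δ M u P A f → 0 < K → 0 ≤ M → ∀ e ∈ H, ‖e‖ = 1 → ∀ k ∈ H, ∀ z ∈ parQ d (1 / 2),
      sh k z ∈ parQ d (1 / 2) →
      |inner ℝ (P (sh k z)) e - inner ℝ (P z) e| ≤ C * (K + M) * ‖k‖ ^ δ := by
  obtain ⟨C, h0, hC, hh0, hh1, ht⟩ := taylor d hd hν hν1 hδ hδ1
  refine ⟨6 * C + 2 * (2 + C) / h0 * (2 / h0), by positivity, ?_⟩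
  intro H K M u P A f hD hK hM e he hen k hk z hz hkz
  have tay := ht H K M u P A f hD hK hM
  have hm : ∀ y ∈ parQ d (1 / 2), y ∈ parQ d (5 / 8) := fun y hy =>
    parQ_mono (by norm_num) (by norm_num) hy
  rcases eq_or_ne k 0 with rfl | hne
  · have : sh (0 : EE d) z = z := by simp [sh]
    rw [this, sub_self, abs_zero]; positivity
  have hn : 0 < ‖k‖ := norm_pos_iff.2 hne
  by_cases hc : ‖k‖ ≤ h0 / 2
  · set h := ‖k‖ • e with hh
    have hhH : h ∈ H := H.smul_mem _ he
    have hhn : ‖h‖ = ‖k‖ := by rw [hh, norm_smul, hen]; simp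
    have hkh : ‖k + h‖ ≤ 2 * ‖k‖ := (norm_add_le _ _).trans (by rw [hhn]; linarith)
    have t1 := tay (k + h) (H.add_mem hk hhH) (by linarith) z (hm z hz)
    have t2 := tay k hk (by linarith) z (hm z hz)
    have t3 := tay h hhH (by linarith) _ (hm _ hkz)
    rw [hhn] at t3
    have p1 : ‖k + h‖ ^ (1 + δ) ≤ 4 * ‖k‖ ^ (1 + δ) := by
      calc ‖k + h‖ ^ (1 + δ) ≤ (2 * ‖k‖) ^ (1 + δ) :=
            Real.rpow_le_rpow (norm_nonneg _) hkh (by linarith)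
        _ = 2 ^ (1 + δ) * ‖k‖ ^ (1 + δ) := Real.mul_rpow (by norm_num) hn.le
        _ ≤ 2 ^ (2 : ℝ) * ‖k‖ ^ (1 + δ) := by
            gcongr
            · norm_num
            · linarith
        _ = _ := by norm_num
    have p2 : C * (K + M) * ‖k + h‖ ^ (1 + δ) ≤ C * (K + M) * (4 * ‖k‖ ^ (1 + δ)) := by gcongr
    have id1 : ‖k‖ * (inner ℝ (P (sh k z)) e - inner ℝ (P z) e) =
        TR u P z (k + h) - TR u P z k - TR u P (sh k z) h := by
      simp only [TR, sh_sh, inner_add_right]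
      rw [hh, inner_smul_right, inner_smul_right]
      ring
    have id2 : ‖k‖ * |inner ℝ (P (sh k z)) e - inner ℝ (P z) e| ≤
        ‖k‖ * (6 * C * (K + M) * ‖k‖ ^ δ) := by
      rw [← abs_of_pos hn, ← abs_mul, abs_of_pos hn, id1]
      have b1 := abs_sub (TR u P z (k + h) - TR u P z k) (TR u P (sh k z) h)
      have b2 := abs_sub (TR u P z (k + h)) (TR u P z k)
      have e1 : ‖k‖ * (6 * C * (K + M) * ‖k‖ ^ δ) = 6 * (C * (K + M) * ‖k‖ ^ (1 + δ)) := by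
        rw [Real.rpow_one_add' hn.le (by linarith)]; ring
      rw [e1]; linarith
    refine (le_of_mul_le_mul_left id2 hn).trans ?_
    have : 0 ≤ 2 * (2 + C) / h0 * (2 / h0) := by positivity
    gcongr
    linarith
  · push Not at hc
    have hb : ∀ y ∈ parQ d (1 / 2), |inner ℝ (P y) e| ≤ (2 + C) * (K + M) / h0 := by
      intro y hy
      have hhn : ‖h0 • e‖ = h0 := by rw [norm_smul, hen, Real.norm_eq_abs, abs_of_pos hh0, mul_one]
      have t := tay (h0 • e) (H.smul_mem _ he) hhn.le y (hm y hy)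
      have m1 := hD.ub y (parQ_mono (by norm_num) (by norm_num) hy)
      have m2 := hD.ub (sh (h0 • e) y) (parQ_sh hy (by norm_num) (by rw [hhn]; linarith))
      rw [hhn] at t
      have p : h0 ^ (1 + δ) ≤ 1 := Real.rpow_le_one hh0.le (by linarith) (by linarith)
      have p' : C * (K + M) * h0 ^ (1 + δ) ≤ C * (K + M) := mul_le_of_le_one_right (by positivity) p
      rw [le_div_iff₀ hh0, ← abs_of_pos hh0, ← abs_mul]
      have id : inner ℝ (P y) e * h0 = u (sh (h0 • e) y) - u y - TR u P y (h0 • e) := by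
        simp only [TR, inner_smul_right]; ring
      rw [id]
      have b1 := abs_sub (u (sh (h0 • e) y) - u y) (TR u P y (h0 • e))
      have b2 := abs_sub (u (sh (h0 • e) y)) (u y)
      linarith
    have b1 := hb z hz
    have b2 := hb _ hkz
    have b3 := abs_sub (inner ℝ (P (sh k z)) e) (inner ℝ (P z) e)
    have one : 1 ≤ 2 / h0 * ‖k‖ ^ δ := by
      have hx : 1 ≤ 2 / h0 := by rw [le_div_iff₀ hh0]; linarith
      calc (1:ℝ) ≤ (2 / h0 * ‖k‖) ^ δ := by
            refine Real.one_le_rpow ?_ hδ.le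
            rw [div_mul_eq_mul_div, le_div_iff₀ hh0]; linarith
        _ = (2 / h0) ^ δ * ‖k‖ ^ δ := Real.mul_rpow (by positivity) hn.le
        _ ≤ (2 / h0) ^ (1:ℝ) * ‖k‖ ^ δ := by gcongr
        _ = _ := by rw [Real.rpow_one]
    have c : 2 * (2 + C) / h0 * (K + M) ≤ 2 * (2 + C) / h0 * (K + M) * (2 / h0 * ‖k‖ ^ δ) :=
      le_mul_of_one_le_right (by positivity) one
    have c2 : 0 ≤ 6 * C * (K + M) * ‖k‖ ^ δ := by positivity
    have c3 : (2 + C) * (K + M) / h0 + (2 + C) * (K + M) / h0 = 2 * (2 + C) / h0 * (K + M) := by ring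
    have c4 : (6 * C + 2 * (2 + C) / h0 * (2 / h0)) * (K + M) * ‖k‖ ^ δ =
      6 * C * (K + M) * ‖k‖ ^ δ + 2 * (2 + C) / h0 * (K + M) * (2 / h0 * ‖k‖ ^ δ) := by ring
    rw [c4]; linarith
end

noncomputable section

section
variable {d : ℕ}

lemma loc_integ {U : Set (ℝ × EE d)} {F : ℝ × EE d → EE d} (hF0 : LocallyIntegrableOn F U)
    {φ : ℝ × EE d → ℝ} (hφ : ContDiff ℝ (⊤ : ℕ∞) φ)
    (hc : HasCompactSupport φ) (hs : tsupport φ ⊆ U) :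
    Integrable (fun z => fderiv ℝ φ z (0, F z)) := by
  have hd : Continuous (fun z => fderiv ℝ φ z) := hφ.continuous_fderiv (by simp)
  have hc1 : IsCompact (tsupport φ) := hc
  have hF : IntegrableOn F (tsupport φ) := hF0.integrableOn_compact_subset hs hc1
  have h0 : IntegrableOn (fun z => ((0:ℝ), F z)) (tsupport φ) :=
    (integrable_zero _ _ _).prodMk hF
  obtain ⟨c, hcb⟩ := hd.bounded_above_of_compact_support (hc.fderiv (𝕜 := ℝ))
  have h1 : IntegrableOn (fun z => fderiv ℝ φ z (0, F z)) (tsupport φ) := by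
    refine Integrable.mono' (g := fun z => c * ‖((0:ℝ), F z)‖) (h0.norm.const_mul c) ?_ ?_
    · have := hd.aestronglyMeasurable (μ := volume.restrict (tsupport φ))
      exact (isBoundedBilinearMap_apply (𝕜 := ℝ) (E := ℝ × EE d) (F := ℝ)).continuous.comp_aestronglyMeasurable
        (this.prodMk h0.aestronglyMeasurable)
    · refine ae_of_all _ fun z => ?_
      exact (fderiv ℝ φ z).le_of_opNorm_le (hcb z) _
  refine (integrableOn_iff_integrable_of_support_subset ?_).1 h1
  intro z hz
  by_contra hcon
  apply hz
  have : fderiv ℝ φ z = 0 := by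
    by_contra h2
    exact hcon (support_fderiv_subset ℝ h2)
  simp [this]

lemma cont_integ {U : Set (ℝ × EE d)} {w : ℝ × EE d → ℝ} (hw : ContinuousOn w U)
    {φ : ℝ × EE d → ℝ} (hφ : ContDiff ℝ (⊤ : ℕ∞) φ)
    (hc : HasCompactSupport φ) (hs : tsupport φ ⊆ U) :
    Integrable (fun z => w z * fderiv ℝ φ z (1, 0)) := by
  have hd : Continuous (fun z => fderiv ℝ φ z (1, 0)) :=
    (hφ.continuous_fderiv (by simp)).clm_apply continuous_const
  have hc1 : IsCompact (tsupport φ) := hc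
  have h1 : IntegrableOn (fun z => w z * fderiv ℝ φ z (1, 0)) (tsupport φ) :=
    ContinuousOn.integrableOn_compact hc1 ((hw.mono hs).mul hd.continuousOn)
  refine (integrableOn_iff_integrable_of_support_subset ?_).1 h1
  intro z hz
  by_contra hcon
  apply hz
  have : fderiv ℝ φ z = 0 := by
    by_contra h2
    exact hcon (support_fderiv_subset ℝ h2)
  simp [this]

/-- the directions of the first `q` variables -/
def HH (d q : ℕ) : Submodule ℝ (EE d) where
  carrier := {h | ∀ i : Fin d, q ≤ (i : ℕ) → h i = 0}
  add_mem' := by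
    intro a b ha hb i hi
    simp [ha i hi, hb i hi]
  zero_mem' := by intro i _; simp
  smul_mem' := by
    intro c a ha i hi
    simp [ha i hi]

def AA (a : Fin d → Fin d → ℝ → EE d → ℝ) (z : ℝ × EE d) : EE d →ₗ[ℝ] EE d where
  toFun ξ := WithLp.toLp 2 (fun i => ∑ j, a i j z.1 z.2 * ξ j)
  map_add' := by
    intro x y
    ext i
    simp [mul_add, Finset.sum_add_distrib]
  map_smul' := by
    intro c x
    ext i
    simp only [PiLp.smul_apply, smul_eq_mul, RingHom.id_apply, Finset.mul_sum]
    exact Finset.sum_congr rfl fun j _ => by ring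

lemma AA_apply (a : Fin d → Fin d → ℝ → EE d → ℝ) (z : ℝ × EE d) (ξ : EE d) (i : Fin d) :
    AA a z ξ i = ∑ j, a i j z.1 z.2 * ξ j := rfl

def GG (u : ℝ → EE d → ℝ) (z : ℝ × EE d) : EE d := WithLp.toLp 2 (fun i => sd i (u z.1) z.2)

def FF (fv : Fin d → ℝ → EE d → ℝ) (z : ℝ × EE d) : EE d := WithLp.toLp 2 (fun i => fv i z.1 z.2)

lemma vec_sum (ξ : EE d) : ξ = ∑ i, ξ i • EuclideanSpace.single i (1:ℝ) := by
  have := (EuclideanSpace.basisFun (Fin d) ℝ).sum_repr ξ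
  simpa using this.symm

lemma clm_sum (L : EE d →L[ℝ] ℝ) (ξ : EE d) :
    L ξ = ∑ i, ξ i * L (EuclideanSpace.single i 1) := by
  conv_lhs => rw [vec_sum ξ]
  simp [map_sum]

lemma AA_bound {ν : ℝ} (hν : 0 < ν) {a : Fin d → Fin d → ℝ → EE d → ℝ}
    (h : ∀ (t : ℝ) (x : EE d), ∑ i, ∑ j, a i j t x ^ 2 ≤ ν⁻¹ ^ 2) (z : ℝ × EE d) (ξ : EE d) :
    ‖AA a z ξ‖ ≤ ν⁻¹ * ‖ξ‖ := by
  refine abs_le_of_sq_le_sq' ?_ (by positivity) |>.2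
  rw [mul_pow, EuclideanSpace.real_norm_sq_eq, EuclideanSpace.real_norm_sq_eq]
  calc ∑ i, (AA a z ξ i) ^ 2 ≤ ∑ i, (∑ j, a i j z.1 z.2 ^ 2) * (∑ j, ξ j ^ 2) := by
        refine Finset.sum_le_sum fun i _ => ?_
        rw [AA_apply]
        exact Finset.sum_mul_sq_le_sq_mul_sq _ _ _
    _ = (∑ i, ∑ j, a i j z.1 z.2 ^ 2) * (∑ j, ξ j ^ 2) := by rw [Finset.sum_mul]
    _ ≤ _ := mul_le_mul_of_nonneg_right (h _ _) (Finset.sum_nonneg fun _ _ => sq_nonneg _)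

lemma AA_ell {ν : ℝ} {a : Fin d → Fin d → ℝ → EE d → ℝ}
    (h : ∀ (t : ℝ) (x : EE d) (ξ : Fin d → ℝ),
          ν * ∑ i, ξ i ^ 2 ≤ ∑ i, ∑ j, a i j t x * ξ i * ξ j) (z : ℝ × EE d) (ξ : EE d) :
    ν * ‖ξ‖ ^ 2 ≤ inner ℝ ξ (AA a z ξ) := by
  rw [EuclideanSpace.real_norm_sq_eq]
  refine (h z.1 z.2 (fun i => ξ i)).trans (le_of_eq ?_)
  rw [PiLp.inner_apply]
  refine Finset.sum_congr rfl fun i _ => ?_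
  simp only [AA_apply, RCLike.inner_apply, conj_trivial, Finset.sum_mul]
  exact Finset.sum_congr rfl fun j _ => by ring

lemma a_bound {ν : ℝ} (hν : 0 < ν) {a : Fin d → Fin d → ℝ → EE d → ℝ}
    (h : ∀ (t : ℝ) (x : EE d), ∑ i, ∑ j, a i j t x ^ 2 ≤ ν⁻¹ ^ 2) (t : ℝ) (x : EE d) (i j : Fin d) :
    |a i j t x| ≤ ν⁻¹ := by
  refine abs_le_of_sq_le_sq ?_ (by positivity)
  refine le_trans ?_ (h t x)
  calc a i j t x ^ 2 ≤ ∑ j, a i j t x ^ 2 :=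
        Finset.single_le_sum (f := fun j => a i j t x ^ 2) (fun _ _ => sq_nonneg _) (Finset.mem_univ j)
    _ ≤ _ := Finset.single_le_sum (f := fun i => ∑ j, a i j t x ^ 2)
        (fun _ _ => Finset.sum_nonneg fun _ _ => sq_nonneg _) (Finset.mem_univ i)

lemma parQ_open (ρ : ℝ) : IsOpen (parQ d ρ) := isOpen_Ioo.prod isOpen_ball

lemma GG_grad {u : ℝ → EE d → ℝ} {z : ℝ × EE d} (h : DifferentiableAt ℝ (u z.1) z.2) :
    HasFDerivAt (u z.1) (innerSL ℝ (GG u z)) z.2 := by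
  have e : fderiv ℝ (u z.1) z.2 = innerSL ℝ (GG u z) := by
    ext ξ
    rw [clm_sum, innerSL_apply_apply, PiLp.inner_apply]
    exact Finset.sum_congr rfl fun i _ => rfl
  rw [← e]; exact h.hasFDerivAt

lemma test_x {φ : ℝ × EE d → ℝ} (hφ : ContDiff ℝ (⊤ : ℕ∞) φ) (z : ℝ × EE d) (i : Fin d) :
    sd i (fun y => φ (z.1, y)) z.2 = fderiv ℝ φ z (0, EuclideanSpace.single i 1) := by
  have h1 : HasFDerivAt φ (fderiv ℝ φ z) (z.1, z.2) :=
    (hφ.differentiable (by simp) z).hasFDerivAt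
  have h2 : HasFDerivAt (fun y : EE d => (z.1, y)) (ContinuousLinearMap.inr ℝ ℝ (EE d)) z.2 :=
    hasFDerivAt_prodMk_right z.1 z.2
  have h3 := h1.comp z.2 h2
  have h4 : fderiv ℝ (fun y => φ (z.1, y)) z.2 = _ := h3.fderiv
  rw [sd, h4]
  simp

lemma test_t {φ : ℝ × EE d → ℝ} (hφ : ContDiff ℝ (⊤ : ℕ∞) φ) (z : ℝ × EE d) :
    deriv (fun s => φ (s, z.2)) z.1 = fderiv ℝ φ z (1, 0) := by
  have h1 : HasFDerivAt φ (fderiv ℝ φ z) (z.1, z.2) :=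
    (hφ.differentiable (by simp) z).hasFDerivAt
  have h2 : HasFDerivAt (fun y : ℝ => (y, z.2)) (ContinuousLinearMap.inl ℝ ℝ (EE d)) z.1 :=
    hasFDerivAt_prodMk_left z.1 z.2
  have h3 := (h1.comp z.1 h2).hasDerivAt
  have h4 : deriv (fun s => φ (s, z.2)) z.1 = _ := h3.deriv
  rw [h4]
  simp

lemma test_sum {φ : ℝ × EE d → ℝ} (hφ : ContDiff ℝ (⊤ : ℕ∞) φ) (z : ℝ × EE d) (ξ : EE d) :
    fderiv ℝ φ z (0, ξ) = ∑ i, ξ i * sd i (fun y => φ (z.1, y)) z.2 := by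
  have := clm_sum ((fderiv ℝ φ z).comp (ContinuousLinearMap.inr ℝ ℝ (EE d))) ξ
  simp only [ContinuousLinearMap.comp_apply, ContinuousLinearMap.inr_apply] at this
  rw [this]
  exact Finset.sum_congr rfl fun i _ => by rw [test_x hφ]

lemma set_full {U : Set (ℝ × EE d)} {φ : ℝ × EE d → ℝ} (hs : tsupport φ ⊆ U)
    (v : ℝ × EE d → ℝ × EE d) (c : ℝ × EE d → ℝ) :
    ∫ z in U, c z * fderiv ℝ φ z (v z) = ∫ z, c z * fderiv ℝ φ z (v z) := by
  refine setIntegral_eq_integral_of_forall_compl_eq_zero fun z hz => ?_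
  have : fderiv ℝ φ z = 0 := by
    by_contra h2
    exact hz (hs (support_fderiv_subset ℝ h2))
  simp [this]

set_option maxHeartbeats 1000000 in
lemma mk_sol {ν : ℝ} (hν : 0 < ν) (a : Fin d → Fin d → ℝ → EE d → ℝ) (u : ℝ → EE d → ℝ)
    (fv : Fin d → ℝ → EE d → ℝ)
    (ham : ∀ i j, Measurable (fun z : ℝ × EE d => a i j z.1 z.2))
    (hab : ∀ (t : ℝ) (x : EE d), ∑ i, ∑ j, a i j t x ^ 2 ≤ ν⁻¹ ^ 2)
    (hu : ContinuousOn (fun z : ℝ × EE d => u z.1 z.2) (parQ d 1))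
    (hud : ∀ z ∈ parQ d 1, DifferentiableAt ℝ (u z.1) z.2)
    (huc : ∀ i : Fin d, ContinuousOn (fun z : ℝ × EE d => sd i (u z.1) z.2) (parQ d 1))
    (hf : ∀ i, IntegrableOn (fun z : ℝ × EE d => fv i z.1 z.2) (parQ d 1))
    (hw : ∀ φ : ℝ × EE d → ℝ, ContDiff ℝ (⊤ : ℕ∞) φ →
          HasCompactSupport φ → tsupport φ ⊆ parQ d 1 →
          ∫ z in parQ d 1,
              (-(u z.1 z.2) * deriv (fun s => φ (s, z.2)) z.1
                + ∑ i, ∑ j, a i j z.1 z.2 * sd j (u z.1) z.2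
                    * sd i (fun y => φ (z.1, y)) z.2)
            = ∫ z in parQ d 1,
                ∑ i, fv i z.1 z.2 * sd i (fun y => φ (z.1, y)) z.2) :
    WSol (parQ d 1) (fun z => u z.1 z.2) (GG u) (fun z => AA a z (GG u z) - FF fv z) := by
  have hAl : LocallyIntegrableOn (fun z => AA a z (GG u z)) (parQ d 1) := by
    rw [locallyIntegrableOn_iff (parQ_open 1).isLocallyClosed]
    intro k hk hkc
    refine Integrable.of_eval_piLp fun i => ?_
    simp only [AA_apply]
    refine integrable_finsetSum _ fun j _ => ?_
    have hs : IntegrableOn (fun z : ℝ × EE d => sd j (u z.1) z.2) k :=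
      ContinuousOn.integrableOn_compact hkc ((huc j).mono hk)
    exact Integrable.bdd_mul hs (ham i j).aestronglyMeasurable
      (c := ν⁻¹) (ae_of_all _ fun z => a_bound hν hab z.1 z.2 i j)
  have hfl : LocallyIntegrableOn (FF fv) (parQ d 1) := by
    refine IntegrableOn.locallyIntegrableOn ?_
    exact Integrable.of_eval_piLp fun i => hf i
  refine ⟨parQ_open 1, hu, ?_, fun z hz => GG_grad (hud z hz), hAl.sub hfl, fun φ h1 h2 h3 => ?_⟩
  · exact (PiLp.continuous_toLp 2 _).comp_continuousOn (continuousOn_pi.2 huc)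
  · have := hw φ h1 h2 h3
    have e1 : ∀ z : ℝ × EE d, (-(u z.1 z.2) * deriv (fun s => φ (s, z.2)) z.1
                + ∑ i, ∑ j, a i j z.1 z.2 * sd j (u z.1) z.2
                    * sd i (fun y => φ (z.1, y)) z.2) =
        1 * fderiv ℝ φ z (-(u z.1 z.2), AA a z (GG u z)) := by
      intro z
      have e : ((-(u z.1 z.2) : ℝ), AA a z (GG u z)) = (-(u z.1 z.2)) • ((1:ℝ), (0 : EE d)) +
        (0, AA a z (GG u z)) := by simp
      rw [one_mul, e, map_add, map_smul, test_t h1, test_sum h1]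
      congr 1
      refine Finset.sum_congr rfl fun i _ => ?_
      rw [AA_apply, Finset.sum_mul]
      rfl
    have e2 : ∀ z : ℝ × EE d, ∑ i, fv i z.1 z.2 * sd i (fun y => φ (z.1, y)) z.2 =
        1 * fderiv ℝ φ z (0, FF fv z) := by
      intro z
      rw [one_mul, test_sum h1]
      rfl
    simp_rw [e1, e2] at this
    rw [set_full h3, set_full h3] at this
    have i1 := cont_integ hu h1 h2 h3
    have i2 := loc_integ hAl h1 h2 h3
    have i3 := loc_integ hfl h1 h2 h3
    have e3 : ∀ z : ℝ × EE d, 1 * fderiv ℝ φ z (-(u z.1 z.2), AA a z (GG u z)) =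
        fderiv ℝ φ z (0, AA a z (GG u z)) - u z.1 z.2 * fderiv ℝ φ z (1, 0) := by
      intro z
      have e : ((-(u z.1 z.2) : ℝ), AA a z (GG u z)) = (-(u z.1 z.2)) • ((1:ℝ), (0 : EE d)) +
        (0, AA a z (GG u z)) := by simp
      rw [one_mul, e, map_add, map_smul, smul_eq_mul]; ring
    have e4 : ∀ z : ℝ × EE d, fderiv ℝ φ z (0, AA a z (GG u z) - FF fv z) =
        fderiv ℝ φ z (0, AA a z (GG u z)) - fderiv ℝ φ z (0, FF fv z) := by
      intro z; rw [← map_sub]; simp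
    simp_rw [e3, one_mul] at this
    simp_rw [e4]
    rw [integral_sub i2 i1] at this
    rw [integral_sub i2 i3]
    linarith

lemma HH_sh {q : ℕ} {h : EE d} (hh : h ∈ HH d q) (z : ℝ × EE d) (i : Fin d) (hi : q ≤ (i:ℕ)) :
    (sh h z).2 i = z.2 i := by
  have : h i = 0 := hh i hi
  simp [sh, this]

lemma FF_holder {q : ℕ} {δ K : ℝ} {fv : Fin d → ℝ → EE d → ℝ} (hK : 0 ≤ K)
    (hf : ∀ i, PHolderXPar d q δ (parQ d 1) (fv i) K) (z : ℝ × EE d) (hz : z ∈ parQ d 1)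
    (h : EE d) (hh : h ∈ HH d q) (hz' : sh h z ∈ parQ d 1) :
    ‖FF fv (sh h z) - FF fv z‖ ≤ d * K * ‖h‖ ^ δ := by
  have hdist : dist (sh h z).2 z.2 = ‖h‖ := by simp [sh]
  have hi : ∀ i, |fv i z.1 (sh h z).2 - fv i z.1 z.2| ≤ K * ‖h‖ ^ δ := by
    intro i
    have := hf i z.1 (sh h z).2 z.2 hz' hz (fun j hj => HH_sh hh z j hj)
    rwa [hdist] at this
  have hX : 0 ≤ K * ‖h‖ ^ δ := by positivity
  refine abs_le_of_sq_le_sq' ?_ (by positivity) |>.2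
  rw [EuclideanSpace.real_norm_sq_eq]
  calc ∑ i, ((FF fv (sh h z) - FF fv z) i) ^ 2 ≤ ∑ i : Fin d, (K * ‖h‖ ^ δ) ^ 2 := by
        refine Finset.sum_le_sum fun i _ => ?_
        rw [sq_le_sq, abs_of_nonneg hX]
        exact hi i
    _ = d * (K * ‖h‖ ^ δ) ^ 2 := by simp
    _ ≤ d ^ 2 * (K * ‖h‖ ^ δ) ^ 2 := by
        gcongr
        rcases Nat.eq_zero_or_pos d with h0 | h0
        · simp [h0]
        · have : (1:ℝ) ≤ d := by exact_mod_cast h0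
          nlinarith
    _ = _ := by ring

end
end

/-- **Theorem 4.1 (iii), first case**: interior partial Schauder estimate in `x'` on the
parabolic cylinder `Q_1` for divergence form parabolic equations with coefficients
independent of `x'`. -/
theorem partial_schauder_parabolic_div_cylinder_x
    (d q : ℕ) (ν δ : ℝ) (hd : 2 ≤ d) (hq1 : 1 ≤ q) (hqd : q < d)
    (hν : ν ∈ Ioc (0 : ℝ) 1) (hδ : δ ∈ Ioo (0 : ℝ) 1) :
    ∃ N : ℝ, 0 < N ∧
      ∀ (a : Fin d → Fin d → ℝ → EuclideanSpace ℝ (Fin d) → ℝ)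
        (u : ℝ → EuclideanSpace ℝ (Fin d) → ℝ)
        (fv : Fin d → ℝ → EuclideanSpace ℝ (Fin d) → ℝ),
        (∀ i j, Measurable (fun z : ℝ × EuclideanSpace ℝ (Fin d) => a i j z.1 z.2)) →
        (∀ (t : ℝ) (x : EuclideanSpace ℝ (Fin d)) (ξ : Fin d → ℝ),
          ν * ∑ i, ξ i ^ 2 ≤ ∑ i, ∑ j, a i j t x * ξ i * ξ j) →
        (∀ (t : ℝ) (x : EuclideanSpace ℝ (Fin d)),
          ∑ i, ∑ j, a i j t x ^ 2 ≤ ν⁻¹ ^ 2) →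
        (∀ i j (t : ℝ) (x y : EuclideanSpace ℝ (Fin d)),
          (∀ k : Fin d, q ≤ (k : ℕ) → x k = y k) → a i j t x = a i j t y) →
        -- `u` is continuous with continuous spatial gradient on `Q_1`
        ContinuousOn (fun z : ℝ × EuclideanSpace ℝ (Fin d) => u z.1 z.2) (parQ d 1) →
        (∀ z ∈ parQ d 1, DifferentiableAt ℝ (u z.1) z.2) →
        (∀ i : Fin d, ContinuousOn
          (fun z : ℝ × EuclideanSpace ℝ (Fin d) => sd i (u z.1) z.2) (parQ d 1)) →
        (∀ i, IntegrableOn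
          (fun z : ℝ × EuclideanSpace ℝ (Fin d) => fv i z.1 z.2) (parQ d 1)) →
        -- weak formulation of `u_t - D_i (a^{ij} D_j u) = div f⃗` in `Q_1`
        (∀ φ : ℝ × EuclideanSpace ℝ (Fin d) → ℝ, ContDiff ℝ (⊤ : ℕ∞) φ →
          HasCompactSupport φ → tsupport φ ⊆ parQ d 1 →
          ∫ z in parQ d 1,
              (-(u z.1 z.2) * deriv (fun s => φ (s, z.2)) z.1
                + ∑ i, ∑ j, a i j z.1 z.2 * sd j (u z.1) z.2
                    * sd i (fun y => φ (z.1, y)) z.2)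
            = ∫ z in parQ d 1,
                ∑ i, fv i z.1 z.2 * sd i (fun y => φ (z.1, y)) z.2) →
        ∀ K M : ℝ, 0 ≤ K →
          (∀ i, PHolderXPar d q δ (parQ d 1) (fv i) K) →
          (∀ z ∈ parQ d 1, |u z.1 z.2| ≤ M) →
          ∀ i : Fin d, (i : ℕ) < q →
            PHolderXPar d q δ (parQ d (1/2)) (fun t x => sd i (u t) x)
              (N * (K + M)) := by
  obtain ⟨C, hC, hmain⟩ := grad_holder d hd hν.1 hν.2 hδ.1 hδ.2
  refine ⟨C * d + 1, by positivity, ?_⟩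
  intro a u fv ham hae hab hai hu hud huc hf hw K M hK hfH hM i hi
  have hM0 : 0 ≤ M := by
    have hz : ((-1 / 2 : ℝ), (0 : EE d)) ∈ parQ d 1 := by
      refine ⟨⟨?_, ?_⟩, ?_⟩
      · norm_num
      · norm_num
      · simp
    exact (abs_nonneg _).trans (hM _ hz)
  have hd1 : (1:ℝ) ≤ d := by exact_mod_cast (by omega : 1 ≤ d)
  have hsol := mk_sol hν.1 a u fv ham hab hu hud huc hf hw
  have key : ∀ η : ℝ, 0 < η → ∀ (t : ℝ) (x y : EE d), (t, x) ∈ parQ d (1 / 2) →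
      (t, y) ∈ parQ d (1 / 2) → (∀ i : Fin d, q ≤ (i : ℕ) → x i = y i) →
      |sd i (u t) x - sd i (u t) y| ≤ C * (d * K + η + M) * dist x y ^ δ := by
    intro η hη t x y hx hy hxy
    have hD : Dat (HH d q) ν (d * K + η) δ M (fun z => u z.1 z.2) (GG u) (AA a) (FF fv) := by
      refine ⟨hsol, AA_bound hν.1 hab, AA_ell hae, ?_, ?_, hM⟩
      · intro z h hh
        ext ξ j
        rw [AA_apply, AA_apply]
        refine Finset.sum_congr rfl fun l _ => ?_
        rw [hai j l (sh h z).1 (sh h z).2 z.2 (fun k hk => HH_sh hh z k hk)]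
        rfl
      · intro z hz h hh hz2
        refine (FF_holder hK hfH z hz h hh hz2).trans ?_
        gcongr
        linarith
    have hk : x - y ∈ HH d q := by
      intro j hj
      simp [hxy j hj]
    have he : EuclideanSpace.single i (1:ℝ) ∈ HH d q := by
      intro j hj
      have : j ≠ i := by rintro rfl; omega
      simp [this]
    have hsh : sh (x - y) (t, y) = (t, x) := by simp [sh]
    have := hmain (HH d q) (d * K + η) M _ _ _ _ hD (by positivity) hM0
      (EuclideanSpace.single i (1:ℝ)) he (by simp) (x - y) hk (t, y) hy (by rw [hsh]; exact hx)
    rw [hsh] at this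
    have e : ∀ z : ℝ × EE d, inner ℝ (GG u z) (EuclideanSpace.single i (1:ℝ)) = sd i (u z.1) z.2 := by
      intro z
      rw [EuclideanSpace.inner_single_right]
      simp [GG]
    rw [e, e] at this
    rw [dist_eq_norm]
    exact this
  intro t x y hx hy hxy
  set D := dist x y ^ δ with hDd
  have hD0 : 0 ≤ D := by positivity
  have lim : |sd i (u t) x - sd i (u t) y| ≤ C * (d * K + M) * D := by
    refine le_of_forall_pos_le_add fun ε hε => ?_
    have hη : 0 < ε / (C * D + 1) := by positivity
    refine (key _ hη t x y hx hy hxy).trans ?_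
    have : C * D * (ε / (C * D + 1)) ≤ ε := by
      rw [mul_div_assoc', div_le_iff₀ (by positivity)]
      nlinarith
    have e : C * (d * K + ε / (C * D + 1) + M) * D = C * (d * K + M) * D + C * D * (ε / (C * D + 1)) := by
      ring
    rw [e]; linarith
  refine lim.trans (mul_le_mul_of_nonneg_right ?_ hD0)
  have b1 : C * M ≤ C * d * M := by
    have := mul_le_mul_of_nonneg_left hd1 (mul_nonneg hC hM0)
    linarith
  linarith
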